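/- There exist a constant C > 0 and N₀ such that for every integer N ≥ N₀, ∫₀¹ |g(α)|²·|S(α)|⁴ dα ≤ C·N^{4/3}. -/

import Mathlib

open MeasureTheory Finset
open scoped Classical

noncomputable section

/-- `eu x = e(x) = exp(2πix)`. -/
def eu (x : ℝ) : ℂ := Complex.exp (2 * Real.pi * Complex.I * x)

/-- `Cq i q a = ∑_{1 ≤ m ≤ q, gcd(m,q)=1} e(a m^i / q)`. -/
def Cq (i q a : ℕ) : ℂ :=
  ∑ m ∈ (Finset.Icc 1 q).filter (fun m => Nat.gcd m q = 1), eu ((a * m ^ i : ℝ) / q)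

/-- `Afun n q = Re( μ(q)/φ(q)^4 · ∑_{1 ≤ a ≤ q, (a,q)=1} C₂(q,a) C₃(q,a)² e(-an/q) )`. -/
def Afun (n q : ℕ) : ℝ :=
  (((ArithmeticFunction.moebius q : ℤ) : ℂ) / ((Nat.totient q : ℂ)) ^ 4 *
    ∑ a ∈ (Finset.Icc 1 q).filter (fun a => Nat.gcd a q = 1),
      Cq 2 q a * (Cq 3 q a) ^ 2 * eu (-(a * n : ℝ) / q)).re

/-- the singular series `𝔖(n) = ∑_{q=1}^∞ A(n,q)`. -/
def SSfun (n : ℕ) : ℝ := ∑' q : ℕ+, Afun n (q : ℕ)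

/-- `U = (N/(16(1+δ)))^{1/3}` with `δ = 10⁻⁴`. -/
def Uconst (N : ℕ) : ℝ := ((N : ℝ) / (16 * (1 + 1e-4))) ^ ((1 : ℝ) / 3)

/-- `V = U^{5/6}`. -/
def Vconst (N : ℕ) : ℝ := Uconst N ^ ((5 : ℝ) / 6)

/-- `f(α) = ∑_{p ≤ N} (log p) e(pα)`. -/
def fsum (N : ℕ) (α : ℝ) : ℂ :=
  ∑ p ∈ (Finset.range (N + 1)).filter Nat.Prime, (Real.log p : ℂ) * eu (p * α)

/-- `g(α) = ∑_{p ≤ N^{1/2}} (log p) e(p²α)`. -/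
def gsum (N : ℕ) (α : ℝ) : ℂ :=
  ∑ p ∈ (Finset.range (N + 1)).filter (fun p : ℕ => p.Prime ∧ (p : ℝ) ≤ Real.sqrt N),
    (Real.log p : ℂ) * eu ((p : ℝ) ^ 2 * α)

/-- `∑_{X < p ≤ 2X} (log p) e(p³α)`; `S = cubeSum U`, `T = cubeSum V`. -/
def cubeSum (X : ℝ) (α : ℝ) : ℂ :=
  ∑ p ∈ (Finset.range (⌊2 * X⌋₊ + 1)).filter
      (fun p : ℕ => p.Prime ∧ X < (p : ℝ) ∧ (p : ℝ) ≤ 2 * X),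
    (Real.log p : ℂ) * eu ((p : ℝ) ^ 3 * α)

/-- `G(α) = ∑_{1 ≤ v ≤ L} e(2^v α)`. -/
def Gsum (L : ℝ) (α : ℝ) : ℂ := ∑ v ∈ Finset.Icc 1 ⌊L⌋₊, eu ((2 : ℝ) ^ v * α)

/-- the major arcs `𝔐 = ⋃_{q ≤ P} ⋃_{1 ≤ a ≤ q, (a,q)=1} {α ∈ [0,1] : |α - a/q| ≤ 1/(qQ)}`. -/
def majorArcs (P Q : ℝ) : Set ℝ :=
  {α | α ∈ Set.Icc (0 : ℝ) 1 ∧ ∃ q a : ℕ, 1 ≤ q ∧ (q : ℝ) ≤ P ∧ 1 ≤ a ∧ a ≤ q ∧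
    Nat.gcd a q = 1 ∧ |α - (a : ℝ) / q| ≤ 1 / ((q : ℝ) * Q)}

/-- the minor arcs `C(𝔐) = [1/Q, 1 + 1/Q] \ 𝔐`. -/
def minorArcs (P Q : ℝ) : Set ℝ := Set.Icc (1 / Q) (1 + 1 / Q) \ majorArcs P Q

lemma eu_add (x y : ℝ) : eu (x + y) = eu x * eu y := by
  unfold eu; rw [← Complex.exp_add]; congr 1; push_cast; ring

lemma eu_zero : eu 0 = 1 := by simp [eu]

lemma eu_int (n : ℤ) : eu n = 1 := by
  unfold eu
  rw [Complex.exp_eq_one_iff]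
  exact ⟨n, by push_cast; ring⟩

lemma eu_nat (n : ℕ) : eu n = 1 := by exact_mod_cast eu_int n

lemma eu_eq_exp (x : ℝ) : eu x = Complex.exp (Complex.I * ((2 * Real.pi * x : ℝ) : ℂ)) := by
  unfold eu; congr 1; push_cast; ring

lemma norm_eu (x : ℝ) : ‖eu x‖ = 1 := by
  rw [eu_eq_exp, mul_comm]; exact Complex.norm_exp_ofReal_mul_I _

lemma eu_ne_zero (x : ℝ) : eu x ≠ 0 := by
  intro h; have := norm_eu x; rw [h] at this; simp at this

lemma eu_neg (x : ℝ) : eu (-x) = (starRingEnd ℂ) (eu x) := by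
  unfold eu
  rw [← Complex.exp_conj]; congr 1; simp [Complex.conj_ofReal]
  left; exact (map_ofNat (starRingEnd ℂ) 2).symm

lemma eu_sub (x y : ℝ) : eu (x - y) = eu x * (starRingEnd ℂ) (eu y) := by
  rw [sub_eq_add_neg, eu_add, eu_neg]

lemma eu_add_int (x : ℝ) (n : ℤ) : eu (x + n) = eu x := by
  rw [eu_add, eu_int, mul_one]

lemma eu_nat_mul (x : ℝ) (n : ℕ) : eu (n * x) = eu x ^ n := by
  unfold eu; rw [← Complex.exp_nat_mul]; congr 1; push_cast; ring

lemma eu_sub_one_le (x : ℝ) : ‖eu x - 1‖ ≤ 2 * Real.pi * |x| := by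
  rw [eu_eq_exp]
  refine (Real.norm_exp_I_mul_ofReal_sub_one_le).trans ?_
  rw [Real.norm_eq_abs, abs_mul, abs_of_pos (by positivity)]

lemma eu_sub_eu_le (x y : ℝ) : ‖eu x - eu y‖ ≤ 2 * Real.pi * |x - y| := by
  have : eu x - eu y = (eu (x - y) - 1) * eu y := by
    rw [sub_mul, ← eu_add]; simp
  rw [this, norm_mul, norm_eu, mul_one]; exact eu_sub_one_le _

@[fun_prop]
lemma continuous_eu : Continuous eu := by unfold eu; fun_prop

lemma eu_eq_one_iff (x : ℝ) : eu x = 1 ↔ ∃ n : ℤ, x = n := by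
  constructor
  · intro h
    unfold eu at h
    rw [Complex.exp_eq_one_iff] at h
    obtain ⟨n, hn⟩ := h
    refine ⟨n, ?_⟩
    have h2 : (2 * Real.pi * Complex.I : ℂ) ≠ 0 := Complex.two_pi_I_ne_zero
    have h3 : ((x:ℝ):ℂ) = ((n:ℝ):ℂ) := by
      apply mul_left_cancel₀ h2; rw [hn]; push_cast; ring
    exact_mod_cast h3
  · rintro ⟨n, rfl⟩; exact eu_int n

lemma integral_eu (m : ℤ) : ∫ α in (0:ℝ)..1, eu (m * α) = if m = 0 then 1 else 0 := by
  split_ifs with h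
  · subst h; simp [eu_zero]
  · have hc : (2 * Real.pi * Complex.I * m : ℂ) ≠ 0 :=
      mul_ne_zero Complex.two_pi_I_ne_zero (by exact_mod_cast h)
    have h1 := integral_exp_mul_complex (a := 0) (b := 1) hc
    have h2 : ∀ α : ℝ, eu (m * α) = Complex.exp (2 * Real.pi * Complex.I * m * α) := by
      intro α; unfold eu; congr 1; push_cast; ring
    simp_rw [h2]
    rw [h1]
    have := eu_int m
    unfold eu at this
    have h3 : Complex.exp (2 * Real.pi * Complex.I * m * ((1:ℝ):ℂ)) = 1 := by
      rw [← this]; congr 1; push_cast; ring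
    rw [h3]; simp

/-- Trigonometric polynomial. -/
def TP {ι : Type*} (J : Finset ι) (w : ι → ℂ) (φ : ι → ℤ) (α : ℝ) : ℂ :=
  ∑ j ∈ J, w j * eu (φ j * α)

lemma continuous_TP {ι : Type*} (J : Finset ι) (w : ι → ℂ) (φ : ι → ℤ) :
    Continuous (TP J w φ) := by
  unfold TP; fun_prop

lemma parseval {ι : Type*} (J : Finset ι) (w : ι → ℂ) (φ : ι → ℤ) :
    ((∫ α in (0:ℝ)..1, ‖TP J w φ α‖ ^ 2 : ℝ) : ℂ) =
      ∑ j ∈ J, ∑ k ∈ J, if φ j = φ k then w j * (starRingEnd ℂ) (w k) else 0 := by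
  rw [← intervalIntegral.integral_ofReal]
  have h1 : ∀ α : ℝ, (((‖TP J w φ α‖ ^ 2 : ℝ)) : ℂ) =
      ∑ j ∈ J, ∑ k ∈ J, w j * (starRingEnd ℂ) (w k) * eu ((φ j - φ k : ℤ) * α) := by
    intro α
    rw [Complex.ofReal_pow, ← Complex.mul_conj']
    unfold TP
    rw [map_sum, Finset.sum_mul_sum]
    refine Finset.sum_congr rfl fun j _ => Finset.sum_congr rfl fun k _ => ?_
    rw [map_mul]
    have : (((φ j - φ k : ℤ) : ℝ)) * α = φ j * α - φ k * α := by push_cast; ring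
    rw [this, eu_sub]; ring
  simp_rw [h1]
  rw [intervalIntegral.integral_finsetSum]
  · refine Finset.sum_congr rfl fun j _ => ?_
    rw [intervalIntegral.integral_finsetSum]
    · refine Finset.sum_congr rfl fun k _ => ?_
      rw [intervalIntegral.integral_const_mul, integral_eu]
      simp only [sub_eq_zero]
      split_ifs <;> simp
    · intro k _
      exact (Continuous.intervalIntegrable (by fun_prop) _ _)
  · intro k _
    exact (Continuous.intervalIntegrable (by fun_prop) _ _)

lemma parseval_le {ι : Type*} (J : Finset ι) (w : ι → ℂ) (φ : ι → ℤ) (b : ι → ℝ)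
    (hb : ∀ j ∈ J, ‖w j‖ ≤ b j) :
    ∫ α in (0:ℝ)..1, ‖TP J w φ α‖ ^ 2 ≤
      ∑ j ∈ J, ∑ k ∈ J, if φ j = φ k then b j * b k else 0 := by
  have h0 : 0 ≤ ∫ α in (0:ℝ)..1, ‖TP J w φ α‖ ^ 2 :=
    intervalIntegral.integral_nonneg (by norm_num) (fun _ _ => by positivity)
  have h1 := congrArg norm (parseval J w φ)
  rw [Complex.norm_real, Real.norm_of_nonneg h0] at h1
  rw [h1]
  refine (norm_sum_le _ _).trans (Finset.sum_le_sum fun j hj => ?_)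
  refine (norm_sum_le _ _).trans (Finset.sum_le_sum fun k hk => ?_)
  split_ifs
  · rw [norm_mul, RCLike.norm_conj]
    exact mul_le_mul (hb j hj) (hb k hk) (norm_nonneg _) ((norm_nonneg _).trans (hb j hj))
  · simp

lemma parseval_eq {ι : Type*} (J : Finset ι) (b : ι → ℝ) (φ : ι → ℤ) :
    ∫ α in (0:ℝ)..1, ‖TP J (fun j => (b j : ℂ)) φ α‖ ^ 2 =
      ∑ j ∈ J, ∑ k ∈ J, if φ j = φ k then b j * b k else 0 := by
  have h1 := parseval J (fun j => (b j : ℂ)) φ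
  have : ((∑ j ∈ J, ∑ k ∈ J, if φ j = φ k then b j * b k else 0 : ℝ) : ℂ) =
     ∑ j ∈ J, ∑ k ∈ J, if φ j = φ k then (b j:ℂ) * (starRingEnd ℂ) (b k : ℂ) else 0 := by
    push_cast
    simp [Complex.conj_ofReal, apply_ite]
  rw [← this] at h1
  exact_mod_cast h1

lemma parseval_mono {ι : Type*} (J : Finset ι) (w : ι → ℂ) (φ : ι → ℤ) (b : ι → ℝ)
    (hb : ∀ j ∈ J, ‖w j‖ ≤ b j) :
    ∫ α in (0:ℝ)..1, ‖TP J w φ α‖ ^ 2 ≤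
      ∫ α in (0:ℝ)..1, ‖TP J (fun j => (b j : ℂ)) φ α‖ ^ 2 := by
  rw [parseval_eq]; exact parseval_le J w φ b hb

lemma TP_mul {ι κ : Type*} (J : Finset ι) (w : ι → ℂ) (φ : ι → ℤ)
    (J' : Finset κ) (w' : κ → ℂ) (φ' : κ → ℤ) (α : ℝ) :
    TP J w φ α * TP J' w' φ' α =
      TP (J ×ˢ J') (fun j => w j.1 * w' j.2) (fun j => φ j.1 + φ' j.2) α := by
  unfold TP
  rw [Finset.sum_mul_sum, Finset.sum_product]
  refine Finset.sum_congr rfl fun j _ => Finset.sum_congr rfl fun k _ => ?_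
  have : ((φ j + φ' k : ℤ) : ℝ) * α = φ j * α + φ' k * α := by push_cast; ring
  rw [this, eu_add]; ring

/-- distance to the nearest integer -/
def dn (x : ℝ) : ℝ := |x - round x|

lemma dn_nonneg (x : ℝ) : 0 ≤ dn x := abs_nonneg _

lemma dn_le_half (x : ℝ) : dn x ≤ 1 / 2 := abs_sub_round x

lemma dn_le (x : ℝ) (n : ℤ) : dn x ≤ |x - n| := round_le x n

lemma dn_mul_le (x : ℝ) : 4 * dn x ≤ ‖eu x - 1‖ := by
  have h1 : eu x = eu (x - round x) := by
    have := eu_add_int (x - round x) (round x)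
    rw [← this]; congr 1; ring
  rw [h1, eu_eq_exp, Complex.norm_exp_I_mul_ofReal_sub_one]
  set y := x - round x with hy
  have hy2 : |y| ≤ 1 / 2 := abs_sub_round x
  have h2 : 2 * Real.pi * y / 2 = Real.pi * y := by ring
  rw [h2, norm_mul, Real.norm_eq_abs, Real.norm_eq_abs, abs_of_pos (by norm_num : (0:ℝ) < 2)]
  have h3 : |Real.sin (Real.pi * y)| = Real.sin (Real.pi * |y|) := by
    rcases le_total 0 y with h | h
    · rw [abs_of_nonneg h, abs_of_nonneg]
      apply Real.sin_nonneg_of_nonneg_of_le_pi (by positivity)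
      rw [abs_of_nonneg h] at hy2
      nlinarith [Real.pi_pos]
    · rw [abs_of_nonpos h]
      rw [abs_of_nonpos h] at hy2
      have : Real.pi * y = -(Real.pi * -y) := by ring
      rw [this, Real.sin_neg, abs_neg, abs_of_nonneg]
      apply Real.sin_nonneg_of_nonneg_of_le_pi
      · nlinarith [Real.pi_pos]
      · nlinarith [Real.pi_pos]
  rw [h3]
  have h4 := Real.mul_le_sin (x := Real.pi * |y|) (by positivity) (by nlinarith [Real.pi_pos])
  have h5 : 2 / Real.pi * (Real.pi * |y|) = 2 * |y| := by field_simp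
  rw [h5] at h4
  have : dn x = |y| := rfl
  rw [this]; linarith

/-- smooth version of `min (L, 1/‖θ‖)` -/
def mn (L θ : ℝ) : ℝ := 2 * L / (1 + L * dn θ)

lemma mn_nonneg {L : ℝ} (hL : 0 ≤ L) (θ : ℝ) : 0 ≤ mn L θ := by
  unfold mn; have := dn_nonneg θ; positivity

lemma mn_le {L : ℝ} (hL : 0 ≤ L) (θ : ℝ) : mn L θ ≤ 2 * L := by
  unfold mn; have := dn_nonneg θ
  apply div_le_self (by positivity)
  nlinarith [mul_nonneg hL this]

lemma mn_mono {L L' : ℝ} (hL : 0 ≤ L) (h : L ≤ L') (θ : ℝ) : mn L θ ≤ mn L' θ := by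
  unfold mn; have := dn_nonneg θ
  have := mul_nonneg hL this
  have h3 : 0 ≤ L' * dn θ := mul_nonneg (hL.trans h) (dn_nonneg θ)
  rw [div_le_div_iff₀ (by positivity) (by positivity)]
  nlinarith

lemma mn_le_inv {L : ℝ} (hL : 0 ≤ L) (θ t : ℝ) (ht : 0 < t) (h : t ≤ dn θ) : mn L θ ≤ 2 / t := by
  unfold mn; have := dn_nonneg θ
  rw [div_le_div_iff₀ (by positivity) ht]
  nlinarith

lemma geom_bound (L : ℕ) (θ c : ℝ) : ‖∑ n ∈ range L, eu (θ * n + c)‖ ≤ mn L θ := by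
  have h1 : ∑ n ∈ range L, eu (θ * n + c) = (∑ n ∈ range L, eu θ ^ n) * eu c := by
    rw [Finset.sum_mul]
    refine Finset.sum_congr rfl fun n _ => ?_
    rw [eu_add, mul_comm θ, eu_nat_mul]
  rw [h1, norm_mul, norm_eu, mul_one]
  set S := ∑ n ∈ range L, eu θ ^ n with hS
  have h2 : ‖S‖ ≤ L := by
    refine (norm_sum_le _ _).trans ?_
    simp [norm_eu]
  have h3 : ‖S‖ * dn θ ≤ 1 := by
    have h4 : S * (eu θ - 1) = eu θ ^ L - 1 := geom_sum_mul _ _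
    have h5 : ‖S‖ * ‖eu θ - 1‖ ≤ 2 := by
      rw [← norm_mul, h4]
      refine (norm_sub_le _ _).trans ?_
      simp [norm_eu]; norm_num
    have h6 := dn_mul_le θ
    nlinarith [norm_nonneg S]
  unfold mn
  have := dn_nonneg θ
  rw [le_div_iff₀ (by positivity)]
  nlinarith [norm_nonneg S, (Nat.cast_nonneg L : (0:ℝ) ≤ L)]

lemma double_sum_split (f : ℕ → ℕ → ℂ) (L : ℕ) :
    ∑ i ∈ range L, ∑ j ∈ range L, f i j = ∑ i ∈ range L, f i i +
      ∑ h ∈ range L, ∑ n ∈ range (L - (h + 1)), (f (n + (h + 1)) n + f n (n + (h + 1))) := by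
  induction L with
  | zero => simp
  | succ L ih =>
    have e1 : ∑ i ∈ range (L+1), ∑ j ∈ range (L+1), f i j =
        ∑ i ∈ range L, ∑ j ∈ range L, f i j + ∑ j ∈ range L, (f L j + f j L) + f L L := by
      rw [Finset.sum_range_succ]
      simp_rw [Finset.sum_range_succ]
      rw [Finset.sum_add_distrib, Finset.sum_add_distrib]; ring
    have e2 : ∑ h ∈ range (L+1), ∑ n ∈ range (L + 1 - (h + 1)), (f (n + (h + 1)) n + f n (n + (h + 1)))
        = ∑ h ∈ range L, ∑ n ∈ range (L - (h + 1)), (f (n + (h + 1)) n + f n (n + (h + 1)))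
          + ∑ j ∈ range L, (f L j + f j L) := by
      rw [Finset.sum_range_succ]
      simp only [Nat.add_sub_add_right, Nat.sub_self, Finset.range_zero, Finset.sum_empty, add_zero]
      rw [← Finset.sum_range_reflect (fun j => f L j + f j L) L, ← Finset.sum_add_distrib]
      refine Finset.sum_congr rfl fun h hh => ?_
      have hh' := Finset.mem_range.mp hh
      have e3 : L - h = (L - (h+1)) + 1 := by omega
      rw [e3, Finset.sum_range_succ]
      have e4 : L - (h+1) + (h + 1) = L := by omega
      have e5 : L - 1 - h = L - (h+1) := by omega
      rw [e4, e5]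
    rw [e1, e2, ih, Finset.sum_range_succ (fun i => f i i)]; ring

lemma vdc (z : ℕ → ℂ) (hz : ∀ n, ‖z n‖ = 1) (L : ℕ) :
    ‖∑ n ∈ range L, z n‖ ^ 2 ≤ L + 2 * ∑ h ∈ range L,
      ‖∑ n ∈ range (L - (h + 1)), z (n + (h + 1)) * (starRingEnd ℂ) (z n)‖ := by
  have h1 : ((‖∑ n ∈ range L, z n‖ ^ 2 : ℝ) : ℂ) =
      ∑ i ∈ range L, ∑ j ∈ range L, z i * (starRingEnd ℂ) (z j) := by
    rw [Complex.ofReal_pow, ← Complex.mul_conj', map_sum, Finset.sum_mul_sum]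
  rw [double_sum_split (fun i j => z i * (starRingEnd ℂ) (z j))] at h1
  have h2 := congrArg norm h1
  rw [Complex.norm_real, Real.norm_of_nonneg (by positivity)] at h2
  rw [h2]
  refine (norm_add_le _ _).trans (add_le_add ?_ ?_)
  · refine (norm_sum_le _ _).trans ?_
    simp [hz]
  · refine (norm_sum_le _ _).trans ?_
    rw [Finset.mul_sum]
    refine Finset.sum_le_sum fun h _ => ?_
    rw [Finset.sum_add_distrib]
    refine (norm_add_le _ _).trans ?_
    have : ∑ n ∈ range (L - (h + 1)), z n * (starRingEnd ℂ) (z (n + (h+1))) =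
       (starRingEnd ℂ) (∑ n ∈ range (L - (h + 1)), z (n + (h + 1)) * (starRingEnd ℂ) (z n)) := by
      rw [map_sum]
      refine Finset.sum_congr rfl fun n _ => ?_
      rw [map_mul, Complex.conj_conj, mul_comm]
    rw [this, RCLike.norm_conj]
    linarith

lemma weyl_sq (a b c : ℝ) (L : ℕ) :
    ‖∑ n ∈ range L, eu (a * n ^ 2 + b * n + c)‖ ^ 2 ≤
      L + 2 * ∑ h ∈ range L, mn L (2 * (h + 1) * a) := by
  refine (vdc _ (fun n => norm_eu _) L).trans ?_
  gcongr with h hh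
  have h1 : ∀ n : ℕ, eu (a * (n + (h+1) : ℕ) ^ 2 + b * (n + (h+1) : ℕ) + c) *
      (starRingEnd ℂ) (eu (a * n ^ 2 + b * n + c)) =
      eu ((2 * (h + 1) * a) * n + (a * (h+1)^2 + b * (h+1))) := by
    intro n
    rw [← eu_sub]; congr 1; push_cast; ring
  simp_rw [h1]
  refine (geom_bound _ _ _).trans (mn_mono (by positivity) ?_ _)
  exact_mod_cast Nat.sub_le _ _

lemma weyl_cube (a b c d : ℝ) (L : ℕ) :
    ‖∑ n ∈ range L, eu (a * n ^ 3 + b * n ^ 2 + c * n + d)‖ ^ 4 ≤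
      10 * L ^ 3 + 16 * L * ∑ h ∈ range L, ∑ k ∈ range L, mn L (6 * (h + 1) * (k + 1) * a) := by
  set S := ‖∑ n ∈ range L, eu (a * n ^ 3 + b * n ^ 2 + c * n + d)‖ with hS
  have h0 := vdc (fun n : ℕ => eu (a * n ^ 3 + b * n ^ 2 + c * n + d)) (fun n => norm_eu _) L
  set T : ℕ → ℝ := fun h => ‖∑ n ∈ range (L - (h + 1)),
    eu (a * (n + (h + 1) : ℕ) ^ 3 + b * (n + (h + 1) : ℕ) ^ 2 + c * (n + (h + 1) : ℕ) + d) *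
      (starRingEnd ℂ) (eu (a * n ^ 3 + b * n ^ 2 + c * n + d))‖ with hT
  have h1 : S ^ 2 ≤ L + 2 * ∑ h ∈ range L, T h := h0
  have h2 : ∀ h ∈ range L, T h ^ 2 ≤ L + 2 * ∑ k ∈ range L, mn L (6 * (h + 1) * (k + 1) * a) := by
    intro h hh
    have e1 : ∀ n : ℕ, eu (a * (n + (h + 1) : ℕ) ^ 3 + b * (n + (h + 1) : ℕ) ^ 2
        + c * (n + (h + 1) : ℕ) + d) *
      (starRingEnd ℂ) (eu (a * n ^ 3 + b * n ^ 2 + c * n + d)) =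
      eu ((3 * (h+1) * a) * n ^ 2 + (3 * (h+1)^2 * a + 2 * b * (h+1)) * n +
        (a * (h+1)^3 + b * (h+1)^2 + c * (h+1))) := by
      intro n
      rw [← eu_sub]; congr 1; push_cast; ring
    simp only [hT]
    simp_rw [e1]
    refine (weyl_sq _ _ _ _).trans ?_
    have hle : L - (h+1) ≤ L := Nat.sub_le _ _
    have hle' : ((L - (h+1) : ℕ) : ℝ) ≤ L := by exact_mod_cast hle
    gcongr ?_ + 2 * ?_
    calc _ ≤ ∑ k ∈ range (L - (h+1)), mn L (6 * (h + 1) * (k + 1) * a) := by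
            refine Finset.sum_le_sum fun k _ => ?_
            have : (2 * ((k:ℝ) + 1) * (3 * (h + 1) * a)) = 6 * (h + 1) * (k + 1) * a := by ring
            rw [this]
            exact mn_mono (by positivity) hle' _
      _ ≤ _ := Finset.sum_le_sum_of_subset_of_nonneg (Finset.range_mono hle)
            (fun _ _ _ => mn_nonneg (by positivity) _)
  have h3 : (∑ h ∈ range L, T h) ^ 2 ≤ L * ∑ h ∈ range L, T h ^ 2 := by
    have := sq_sum_le_card_mul_sum_sq (s := range L) (f := T)
    simpa using this
  have h4 : ∑ h ∈ range L, T h ^ 2 ≤ L * L + 2 * ∑ h ∈ range L, ∑ k ∈ range L,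
      mn L (6 * (h + 1) * (k + 1) * a) := by
    refine (Finset.sum_le_sum h2).trans ?_
    rw [Finset.sum_add_distrib, ← Finset.mul_sum]; simp
  set Sg := ∑ h ∈ range L, ∑ k ∈ range L, mn L (6 * (h + 1) * (k + 1) * a)
  set A := ∑ h ∈ range L, T h
  have hA : 0 ≤ A := Finset.sum_nonneg fun _ _ => norm_nonneg _
  have hL : (L:ℝ) ^ 2 ≤ L ^ 3 := by
    rcases Nat.eq_zero_or_pos L with h | h
    · subst h; simp
    · have : (1:ℝ) ≤ L := by exact_mod_cast h
      nlinarith [sq_nonneg (L:ℝ)]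
  have hL0 : (0:ℝ) ≤ L := by positivity
  calc S ^ 4 = (S^2)^2 := by ring
    _ ≤ (L + 2 * A)^2 := by gcongr
    _ ≤ 2 * L^2 + 8 * A^2 := by nlinarith [sq_nonneg ((L:ℝ) - 2 * A)]
    _ ≤ 2 * L^3 + 8 * (L * (L * L + 2 * Sg)) := by
        have : A^2 ≤ L * (L * L + 2 * Sg) := h3.trans (by gcongr)
        linarith
    _ = _ := by ring

lemma sum_inv_le (q : ℕ) (hq : 1 ≤ q) : ∑ b ∈ range q, ((b:ℝ))⁻¹ ≤ 1 + Real.log q := by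
  have h := harmonic_le_one_add_log q
  refine le_trans ?_ h
  unfold harmonic
  push_cast
  obtain ⟨m, rfl⟩ : ∃ m, q = m + 1 := ⟨q - 1, by omega⟩
  rw [Finset.sum_range_succ', Finset.sum_range_succ]
  push_cast
  simp only [inv_zero, add_zero]
  have : (0:ℝ) ≤ ((m:ℝ)+1)⁻¹ := by positivity
  linarith

lemma sum_inv_sub_le (q : ℕ) : ∑ b ∈ range q, ((q:ℝ) - b)⁻¹ ≤ 1 + Real.log q := by
  have h := harmonic_le_one_add_log q
  refine le_trans (le_of_eq ?_) h
  unfold harmonic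
  push_cast
  rw [← Finset.sum_range_reflect]
  refine Finset.sum_congr rfl fun j hj => ?_
  have := Finset.mem_range.1 hj
  congr 1
  have : q - 1 - j = q - (j + 1) := by omega
  rw [this, Nat.cast_sub (by omega)]; push_cast; ring

lemma block_pt (L : ℝ) (hL : 0 ≤ L) (q : ℕ) (hq : 1 ≤ q) (m : ℤ) (ε : ℝ) (hε : |ε| ≤ 3 / (2 * q)) :
    mn L (m / q + ε) ≤ (fun b : ℕ => (if b = 0 then 2 * L else 0) + (if b = 1 then 2 * L else 0) +
      (if b = q - 1 then 2 * L else 0) + 8 * q * ((b:ℝ)⁻¹ + ((q:ℝ) - b)⁻¹)) (m % q).toNat := by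
  have hq0 : (0:ℤ) < q := by exact_mod_cast hq
  have hqR : (0:ℝ) < q := by exact_mod_cast hq
  obtain ⟨b, hb⟩ : ∃ b : ℕ, (b : ℤ) = m % q :=
    ⟨(m % q).toNat, Int.toNat_of_nonneg (Int.emod_nonneg _ hq0.ne')⟩
  have hbq : b < q := by
    have := Int.emod_lt_of_pos m hq0
    rw [← hb] at this; exact_mod_cast this
  rw [← hb, Int.toNat_natCast]
  simp only
  have hbq' : (b:ℝ) < q := by exact_mod_cast hbq
  have hinv1 : (0:ℝ) ≤ (b:ℝ)⁻¹ := by positivity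
  have hinv2 : (0:ℝ) ≤ ((q:ℝ)-b)⁻¹ := inv_nonneg.2 (by linarith)
  have hpos : 0 ≤ 8 * q * ((b:ℝ)⁻¹ + ((q:ℝ) - b)⁻¹) := by positivity
  by_cases h : b = 0 ∨ b = 1 ∨ b = q - 1
  · refine (mn_le hL _).trans ?_
    have h2 : (0:ℝ) ≤ 2 * L := by positivity
    rcases h with h | h | h <;> simp only [h, if_true] at hpos ⊢ <;> split_ifs <;> linarith
  · push Not at h
    obtain ⟨h0, h1, h2⟩ := h
    have hb2 : 2 ≤ b := by omega
    have hb3 : b + 2 ≤ q := by omega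
    have hb2' : (2:ℝ) ≤ b := by exact_mod_cast hb2
    have hb3' : (b:ℝ) + 2 ≤ q := by exact_mod_cast hb3
    simp only [h0, h1, h2, if_false, zero_add]
    set t : ℝ := min (b:ℝ) (q - b) / (4 * q) with ht
    have ht0 : 0 < t := by
      rw [ht]; apply div_pos _ (by positivity)
      apply lt_min <;> linarith
    have htb : t ≤ b / (4 * q) := by rw [ht]; gcongr; exact min_le_left _ _
    have htb2 : t ≤ (q - b) / (4 * q) := by rw [ht]; gcongr; exact min_le_right _ _
    have key : t ≤ dn (m / q + ε) := by
      unfold dn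
      set r := round ((m:ℝ) / q + ε)
      have hm := Int.emod_add_mul_ediv m q
      rw [← hb] at hm
      have hmR : (m:ℝ) = b + q * (m / (q:ℤ) : ℤ) := by exact_mod_cast hm.symm
      set k := m / (q:ℤ) with hk
      have e1 : (m:ℝ) / q + ε - r = b / q + ε + ((k - r : ℤ) : ℝ) := by
        rw [hmR]; push_cast; field_simp; ring
      rw [e1]
      have hεb := abs_le.1 hε
      have e3 : 3 / (2 * (q:ℝ)) = 6 / (4 * q) := by field_simp; norm_num
      rw [e3] at hεb
      have e4 : (b:ℝ) / q = 4 * b / (4 * q) := by field_simp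
      rcases le_or_gt 0 (k - r) with hz | hz
      · have hz' : (0:ℝ) ≤ ((k - r : ℤ) : ℝ) := by exact_mod_cast hz
        refine le_trans ?_ (le_abs_self _)
        have : (b:ℝ)/(4*q) ≤ b / q + -(6 / (4 * q)) := by
          rw [e4, ← sub_eq_add_neg, ← sub_div]; gcongr; linarith
        linarith [hεb.1]
      · have hz' : ((k - r : ℤ) : ℝ) ≤ -1 := by
          have : k - r ≤ -1 := by omega
          exact_mod_cast this
        refine le_trans ?_ (neg_le_abs _)
        have : ((q:ℝ) - b)/(4*q) ≤ 1 - b / q - (6 / (4 * q)) := by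
          rw [e4]
          have : (1:ℝ) = 4 * q / (4 * q) := by field_simp
          rw [this, ← sub_div, ← sub_div]
          exact div_le_div_of_nonneg_right (by linarith) (by positivity)
        linarith [hεb.2]
    refine (mn_le_inv hL _ t ht0 key).trans ?_
    rw [ht]
    rcases le_total (b:ℝ) (q - b) with hle | hle
    · rw [min_eq_left hle]
      have : 2 / ((b:ℝ) / (4 * q)) = 8 * q * (b:ℝ)⁻¹ := by field_simp; norm_num
      rw [this]; gcongr; linarith
    · rw [min_eq_right hle]
      have hne : (q:ℝ) - b ≠ 0 := by linarith
      have : 2 / (((q:ℝ) - b) / (4 * q)) = 8 * q * ((q:ℝ) - b)⁻¹ := by field_simp; norm_num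
      rw [this]; gcongr; linarith

lemma block_sum (L : ℝ) (hL : 0 ≤ L) (q : ℕ) (hq : 1 ≤ q) (a : ℤ) (haq : IsCoprime a (q:ℤ))
    (α θ : ℝ) (hα : |α - a / q| ≤ 1 / q ^ 2) :
    ∑ j ∈ range q, mn L (θ + j * α) ≤ 6 * L + 16 * q * (1 + Real.log q) := by
  have hq0 : (0:ℤ) < q := by exact_mod_cast hq
  have hqR : (0:ℝ) < q := by exact_mod_cast hq
  set c : ℤ := round (q * θ) with hc
  set σ : ℕ → ℕ := fun j => ((c + j * a) % q).toNat with hσ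
  set W : ℕ → ℝ := fun b : ℕ => (if b = 0 then 2 * L else 0) + (if b = 1 then 2 * L else 0) +
      (if b = q - 1 then 2 * L else 0) + 8 * q * ((b:ℝ)⁻¹ + ((q:ℝ) - b)⁻¹) with hW
  have h1 : ∀ j ∈ range q, mn L (θ + j * α) ≤ W (σ j) := by
    intro j hj
    have hj' : (j:ℝ) ≤ q := by exact_mod_cast (Finset.mem_range.1 hj).le
    have := block_pt L hL q hq (c + j * a) (θ - c / q + j * (α - a / q)) ?_
    · refine le_trans (le_of_eq ?_) this
      congr 1; push_cast; field_simp; ring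
    · have e1 : |θ - c / q| ≤ 1 / (2 * q) := by
        have := abs_sub_round ((q:ℝ) * θ)
        have e : (q:ℝ) * θ - round ((q:ℝ) * θ) = q * (θ - c / q) := by rw [← hc]; field_simp
        rw [e, abs_mul, abs_of_pos hqR] at this
        rw [le_div_iff₀ (by positivity)]; linarith
      have e2 : |(j:ℝ) * (α - a / q)| ≤ 1 / q := by
        rw [abs_mul, abs_of_nonneg (by positivity)]
        calc (j:ℝ) * |α - a/q| ≤ q * (1 / q^2) := by gcongr
          _ = 1 / q := by field_simp
      refine (abs_add_le _ _).trans ?_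
      have : 3 / (2 * (q:ℝ)) = 1 / (2 * q) + 1 / q := by field_simp; norm_num
      rw [this]; gcongr
  have hinj : Set.InjOn σ (range q : Finset ℕ) := by
    intro j hj j' hj' he
    have hj := Finset.mem_range.1 (Finset.mem_coe.1 hj)
    have hj' := Finset.mem_range.1 (Finset.mem_coe.1 hj')
    simp only [hσ] at he
    have he2 : (c + j * a) % q = (c + j' * a) % q := by
      have e1 := Int.toNat_of_nonneg (Int.emod_nonneg (c + j * a) hq0.ne')
      have e2 := Int.toNat_of_nonneg (Int.emod_nonneg (c + j' * a) hq0.ne')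
      rw [← e1, ← e2, he]
    have he3 : (q:ℤ) ∣ (j' - j) * a := by
      have := Int.emod_emod_of_dvd (c + j * a) (dvd_refl (q:ℤ))
      have := (Int.emod_eq_emod_iff_emod_sub_eq_zero).1 he2.symm
      have := Int.dvd_of_emod_eq_zero this
      convert this using 1; ring
    have he4 : (q:ℤ) ∣ (j' - j) := (haq.symm).dvd_of_dvd_mul_right he3
    have := Int.eq_zero_of_abs_lt_dvd he4 (by rw [abs_lt]; omega)
    omega
  have hWnn : ∀ b ∈ range q, 0 ≤ W b := by
    intro b hb
    have hbq' : (b:ℝ) < q := by exact_mod_cast (Finset.mem_range.1 hb)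
    have hinv2 : (0:ℝ) ≤ ((q:ℝ)-b)⁻¹ := inv_nonneg.2 (by linarith)
    simp only [hW]; positivity
  have hsub : (range q).image σ ⊆ range q := by
    intro b hb
    obtain ⟨j, hj, rfl⟩ := Finset.mem_image.1 hb
    rw [Finset.mem_range]
    simp only [hσ]
    have := Int.emod_lt_of_pos (c + j * a) hq0
    have h2 := Int.emod_nonneg (c + j * a) hq0.ne'
    omega
  have hind : ∀ t : ℕ, ∑ b ∈ range q, (if b = t then 2 * L else 0) ≤ 2 * L := by
    intro t
    rw [Finset.sum_ite_eq']; split_ifs <;> linarith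
  calc _ ≤ ∑ j ∈ range q, W (σ j) := Finset.sum_le_sum h1
    _ = ∑ b ∈ (range q).image σ, W b := (Finset.sum_image hinj).symm
    _ ≤ ∑ b ∈ range q, W b := Finset.sum_le_sum_of_subset_of_nonneg hsub fun b hb _ => hWnn b hb
    _ ≤ _ := by
      simp only [hW, Finset.sum_add_distrib, ← Finset.mul_sum]
      have := sum_inv_le q hq
      have := sum_inv_sub_le q
      have := hind 0; have := hind 1; have := hind (q-1)
      have : 8 * (q:ℝ) * (∑ b ∈ range q, ((b:ℝ))⁻¹ + ∑ b ∈ range q, ((q:ℝ) - b)⁻¹) ≤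
        8 * q * ((1 + Real.log q) + (1 + Real.log q)) := by gcongr
      linarith

lemma sum_mn_le (L : ℝ) (hL : 0 ≤ L) (q : ℕ) (hq : 1 ≤ q) (a : ℤ) (haq : IsCoprime a (q:ℤ))
    (α : ℝ) (hα : |α - a / q| ≤ 1 / q ^ 2) (H : ℕ) :
    ∑ u ∈ range H, mn L (((u:ℝ) + 1) * α) ≤
      ((H:ℝ) / q + 1) * (6 * L + 16 * q * (1 + Real.log q)) := by
  have hqR : (0:ℝ) < q := by exact_mod_cast hq
  have hlog : 0 ≤ Real.log q := Real.log_natCast_nonneg q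
  have key : ∀ K : ℕ, ∑ u ∈ range (q * K), mn L (((u:ℝ) + 1) * α) ≤
      K * (6 * L + 16 * q * (1 + Real.log q)) := by
    intro K
    induction K with
    | zero => simp
    | succ K ih =>
      rw [Nat.mul_succ, Finset.sum_range_add]
      have := block_sum L hL q hq a haq α (((q * K : ℕ) + 1) * α) hα
      have e : ∀ j : ℕ, ((q * K : ℕ) + 1 : ℝ) * α + j * α = (((q * K + j : ℕ) : ℝ) + 1) * α := by
        intro j; push_cast; ring
      simp_rw [e] at this
      push_cast at this ih ⊢
      linarith
  have hH : H ≤ q * (H / q + 1) := by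
    have := Nat.lt_mul_div_succ H (show 0 < q by omega)
    exact this.le
  calc _ ≤ ∑ u ∈ range (q * (H / q + 1)), mn L (((u:ℝ) + 1) * α) :=
        Finset.sum_le_sum_of_subset_of_nonneg (Finset.range_mono hH) fun _ _ _ => mn_nonneg hL _
    _ ≤ _ := (key _).trans (by
      push_cast
      gcongr
      exact Nat.cast_div_le)

lemma divisor_bound (ε : ℝ) (hε : 0 < ε) :
    ∃ C : ℝ, 1 ≤ C ∧ ∀ n : ℕ, n ≠ 0 → (n.divisors.card : ℝ) ≤ C * (n:ℝ) ^ ε := by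
  set K : ℝ := 1 + 1 / (ε * Real.log 2) with hK
  have hl2 : 0 < Real.log 2 := Real.log_pos (by norm_num)
  have hK1 : 1 ≤ K := by
    rw [hK]; have : 0 ≤ 1 / (ε * Real.log 2) := by positivity
    linarith
  set P : ℕ := ⌈(2:ℝ) ^ (1 / ε)⌉₊ with hP
  refine ⟨K ^ P, one_le_pow₀ hK1, fun n hn => ?_⟩
  rw [Nat.card_divisors hn]
  have hnprod : ((n:ℝ)) ^ ε = ∏ p ∈ n.primeFactors, ((p:ℝ) ^ ε) ^ (n.factorization p) := by
    conv_lhs => rw [← Nat.prod_factorization_pow_eq_self hn]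
    rw [Finsupp.prod, Nat.support_factorization]
    push_cast
    rw [← Real.finsetProd_rpow _ _ (fun i _ => by positivity)]
    refine Finset.prod_congr rfl fun p _ => ?_
    rw [← Real.rpow_natCast, ← Real.rpow_mul (by positivity), mul_comm, Real.rpow_mul (by positivity),
      Real.rpow_natCast]
  rw [hnprod]
  push_cast
  have h1 : ∀ p ∈ n.primeFactors, ((n.factorization p : ℝ) + 1) ≤
      (if p < P then K else 1) * ((p:ℝ) ^ ε) ^ (n.factorization p) := by
    intro p hp
    have hpp : p.Prime := Nat.prime_of_mem_primeFactors hp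
    have hp2 : (2:ℝ) ≤ p := by exact_mod_cast hpp.two_le
    set v := n.factorization p
    split_ifs with h
    · have e1 : ((2:ℝ) ^ ε) ^ v ≤ ((p:ℝ) ^ ε) ^ v := by gcongr
      have e2 : 1 + v * (ε * Real.log 2) ≤ ((2:ℝ) ^ ε) ^ v := by
        rw [Real.rpow_def_of_pos (by norm_num), ← Real.exp_nat_mul]
        have := Real.add_one_le_exp ((v:ℝ) * (Real.log 2 * ε))
        linarith
      calc (v:ℝ) + 1 ≤ K * (1 + v * (ε * Real.log 2)) := by
            have : K * (1 + v * (ε * Real.log 2)) = 1 + v * (ε * Real.log 2) + 1 / (ε * Real.log 2) + v := by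
              rw [hK]; field_simp; ring
            rw [this]
            have : 0 ≤ 1 / (ε * Real.log 2) := by positivity
            have : 0 ≤ v * (ε * Real.log 2) := by positivity
            linarith
        _ ≤ _ := by gcongr; exact e2.trans e1
    · rw [one_mul]
      have e1 : (2:ℝ) ≤ (p:ℝ) ^ ε := by
        have : (2:ℝ) ^ (1/ε) ≤ p := by
          refine (Nat.le_ceil _).trans ?_
          exact_mod_cast not_lt.1 h
        calc (2:ℝ) = ((2:ℝ) ^ (1/ε)) ^ ε := by
              rw [← Real.rpow_mul (by norm_num)]; field_simp; norm_num
          _ ≤ _ := by gcongr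
      calc (v:ℝ) + 1 ≤ 2 ^ v := by exact_mod_cast Nat.lt_two_pow_self
        _ ≤ _ := by gcongr
  refine (Finset.prod_le_prod (fun p _ => by positivity) h1).trans ?_
  rw [Finset.prod_mul_distrib]
  gcongr
  rw [Finset.prod_ite]
  simp only [Finset.prod_const, one_pow, mul_one]
  refine pow_le_pow_right₀ hK1 ?_
  calc _ ≤ (range P).card := Finset.card_le_card (fun p hp => by
        rw [Finset.mem_filter] at hp; exact Finset.mem_range.2 hp.2)
    _ = P := Finset.card_range P

/-- number of divisors as a real -/
def dv (n : ℕ) : ℝ := (n.divisors.card : ℝ)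

lemma dv_nonneg (n : ℕ) : 0 ≤ dv n := by unfold dv; positivity

/-- divisor bound uniformly for numbers up to a fixed power -/
lemma dv_le_of_le {ε C : ℝ} (hε : 0 < ε) (hC : 1 ≤ C)
    (h : ∀ n : ℕ, n ≠ 0 → dv n ≤ C * (n:ℝ) ^ ε) (n : ℕ) (Y : ℝ) (hY : (n:ℝ) ≤ Y) :
    dv n ≤ C * Y ^ ε := by
  have hY0 : 0 ≤ Y := le_trans (by positivity) hY
  rcases Nat.eq_zero_or_pos n with h0 | h0
  · subst h0; simp [dv]; positivity
  · refine (h n h0.ne').trans ?_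
    gcongr

/-- Ramanujan sum at a prime -/
def cp (p n : ℕ) : ℝ := if p ∣ n then (p:ℝ) - 1 else -1

/-- Ramanujan sum at a squarefree number -/
def cr (r n : ℕ) : ℝ := ∏ p ∈ r.primeFactors, cp p n

/-- squarefree numbers up to `R` -/
def sqf (R : ℕ) : Finset ℕ := (Finset.Icc 1 R).filter Squarefree

def VV (R : ℕ) : ℝ := ∑ r ∈ sqf R, 1 / (r:ℝ)

def fR (R n : ℕ) : ℝ := ∑ r ∈ sqf R, (ArithmeticFunction.moebius r : ℝ) * cr r n / r

def nu (R n : ℕ) : ℝ := (fR R n) ^ 2 / VV R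

lemma mem_sqf {R r : ℕ} : r ∈ sqf R ↔ (1 ≤ r ∧ r ≤ R) ∧ Squarefree r := by
  simp [sqf]

lemma VV_nonneg (R : ℕ) : 0 ≤ VV R := Finset.sum_nonneg fun _ _ => by positivity

lemma one_le_VV {R : ℕ} (hR : 1 ≤ R) : 1 ≤ VV R := by
  have : (1:ℕ) ∈ sqf R := mem_sqf.2 ⟨⟨le_refl _, hR⟩, squarefree_one⟩
  have := Finset.single_le_sum (f := fun r : ℕ => 1 / (r:ℝ)) (fun _ _ => by positivity) this
  simpa [VV] using this

lemma nu_nonneg (R n : ℕ) : 0 ≤ nu R n := div_nonneg (sq_nonneg _) (VV_nonneg R)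

lemma log_le_VV {R : ℕ} : Real.log (R + 1) ≤ 2 * VV R := by
  have h1 := log_add_one_le_harmonic R
  push_cast at h1
  refine h1.trans ?_
  have h2 : ((harmonic R : ℚ) : ℝ) = ∑ n ∈ Finset.Icc 1 R, 1 / (n:ℝ) := by
    rw [harmonic_eq_sum_Icc]; push_cast; simp
  rw [h2]
  have hdec : ∀ n : ℕ, ∃ rk : ℕ × ℕ, n ≠ 0 → (rk.2 ^ 2 * rk.1 = n ∧ Squarefree rk.1) := by
    intro n
    obtain ⟨a, b, hab, ha⟩ := Nat.sq_mul_squarefree n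
    exact ⟨(a, b), fun _ => ⟨hab, ha⟩⟩
  choose g hg using hdec
  have hk : ∑ k ∈ Finset.Icc 1 R, 1 / ((k:ℝ)) ^ 2 ≤ 2 := by
    have h := sum_Ioc_inv_sq_le_sub (α := ℝ) (k := 1) (n := R) one_ne_zero
    rcases Nat.eq_zero_or_pos R with h0 | h0
    · subst h0; simp
    · have h := h h0
      rw [Finset.Icc_eq_cons_Ioc h0, Finset.sum_cons]
      have : (0:ℝ) ≤ (R:ℝ)⁻¹ := by positivity
      simp only [one_div] at *
      push_cast at *
      norm_num at h ⊢
      linarith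
  have hmaps : ∀ n ∈ Finset.Icc 1 R, g n ∈ sqf R ×ˢ Finset.Icc 1 R := by
    intro n hn
    have hn := Finset.mem_Icc.1 hn
    obtain ⟨e1, e2⟩ := hg n (by omega)
    have p1 : 1 ≤ (g n).1 := Nat.pos_of_ne_zero e2.ne_zero
    have p2 : 1 ≤ (g n).2 := by
      rcases Nat.eq_zero_or_pos (g n).2 with h | h
      · rw [h] at e1; simp at e1; omega
      · exact h
    rw [Finset.mem_product, mem_sqf, Finset.mem_Icc]
    refine ⟨⟨⟨p1, ?_⟩, e2⟩, p2, ?_⟩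
    · calc (g n).1 ≤ (g n).2 ^ 2 * (g n).1 := Nat.le_mul_of_pos_left _ (by positivity)
        _ ≤ R := by rw [e1]; exact hn.2
    · calc (g n).2 ≤ (g n).2 ^ 2 := Nat.le_self_pow (by norm_num) _
        _ ≤ (g n).2 ^ 2 * (g n).1 := Nat.le_mul_of_pos_right _ p1
        _ ≤ R := by rw [e1]; exact hn.2
  have hinj : Set.InjOn g (Finset.Icc 1 R : Finset ℕ) := by
    intro n hn n' hn' he
    have hn := Finset.mem_Icc.1 (Finset.mem_coe.1 hn)
    have hn' := Finset.mem_Icc.1 (Finset.mem_coe.1 hn')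
    have e1 := (hg n (by omega)).1
    have e2 := (hg n' (by omega)).1
    rw [← e1, ← e2, he]
  calc ∑ n ∈ Finset.Icc 1 R, 1 / (n:ℝ)
      = ∑ n ∈ Finset.Icc 1 R, (1 / ((g n).1:ℝ)) * (1 / ((g n).2:ℝ)^2) := by
        refine Finset.sum_congr rfl fun n hn => ?_
        have hn := Finset.mem_Icc.1 hn
        have e1 := (hg n (by omega)).1
        conv_lhs => rw [← e1]
        push_cast
        rw [one_div, one_div, one_div, mul_inv, mul_comm]
    _ = ∑ x ∈ (Finset.Icc 1 R).image g, (1 / (x.1:ℝ)) * (1 / (x.2:ℝ)^2) :=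
        (Finset.sum_image (f := fun x : ℕ × ℕ => (1 / (x.1:ℝ)) * (1 / (x.2:ℝ)^2)) hinj).symm
    _ ≤ ∑ x ∈ sqf R ×ˢ Finset.Icc 1 R, (1 / (x.1:ℝ)) * (1 / (x.2:ℝ)^2) := by
        refine Finset.sum_le_sum_of_subset_of_nonneg ?_ fun _ _ _ => by positivity
        intro x hx
        obtain ⟨n, hn, rfl⟩ := Finset.mem_image.1 hx
        exact hmaps n hn
    _ = VV R * ∑ k ∈ Finset.Icc 1 R, 1 / ((k:ℝ)) ^ 2 := by
        rw [Finset.sum_product, VV, Finset.sum_mul_sum]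
    _ ≤ VV R * 2 := by gcongr; exact VV_nonneg R
    _ = 2 * VV R := by ring

lemma cr_of_coprime {r n : ℕ} (hr : Squarefree r) (h : ∀ p, p.Prime → p ∣ r → ¬ p ∣ n) :
    cr r n = (ArithmeticFunction.moebius r : ℝ) := by
  have : cr r n = ∏ p ∈ r.primeFactors, (-1 : ℝ) := by
    refine Finset.prod_congr rfl fun p hp => ?_
    rw [cp, if_neg (h p (Nat.prime_of_mem_primeFactors hp) (Nat.dvd_of_mem_primeFactors hp))]
  rw [this, Finset.prod_const, ArithmeticFunction.moebius_apply_of_squarefree hr,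
    ← ArithmeticFunction.cardDistinctFactors_eq_cardFactors_iff_squarefree hr.ne_zero |>.2 hr]
  push_cast
  rw [ArithmeticFunction.cardDistinctFactors_apply]
  rfl

lemma nu_prime {R p : ℕ} (hR : 1 ≤ R) (hp : p.Prime) (h : R < p) : nu R p = VV R := by
  have h1 : fR R p = VV R := by
    unfold fR VV
    refine Finset.sum_congr rfl fun r hr => ?_
    obtain ⟨⟨h1, h2⟩, h3⟩ := mem_sqf.1 hr
    rw [cr_of_coprime h3]
    · congr 1
      have := ArithmeticFunction.moebius_sq_eq_one_of_squarefree h3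
      rw [← sq]; exact_mod_cast this
    · intro l hl hlr hlp
      have : l = p := (Nat.prime_dvd_prime_iff_eq hl hp).1 hlp
      have := Nat.le_of_dvd (by omega) hlr
      omega
  have := one_le_VV hR
  rw [nu, h1]; field_simp

lemma abs_cp_le {p : ℕ} (hp : p.Prime) (n : ℕ) : |cp p n| ≤ p := by
  have : (2:ℝ) ≤ p := by exact_mod_cast hp.two_le
  unfold cp; split_ifs
  · rw [abs_of_nonneg (by linarith)]; linarith
  · rw [abs_neg, abs_one]; linarith

lemma abs_cr_le {r : ℕ} (hr : Squarefree r) (n : ℕ) : |cr r n| ≤ r := by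
  unfold cr
  rw [Finset.abs_prod]
  calc _ ≤ ∏ p ∈ r.primeFactors, (p:ℝ) := Finset.prod_le_prod (fun _ _ => abs_nonneg _)
        fun p hp => abs_cp_le (Nat.prime_of_mem_primeFactors hp) n
    _ = r := by rw [← Nat.cast_prod, Nat.prod_primeFactors_of_squarefree hr]

lemma abs_moebius_le (r : ℕ) : |(ArithmeticFunction.moebius r : ℝ)| ≤ 1 := by
  exact_mod_cast ArithmeticFunction.abs_moebius_le_one (n := r)

lemma card_sqf_le (R : ℕ) : (sqf R).card ≤ R := by
  refine (Finset.card_filter_le _ _).trans ?_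
  simp

lemma nu_eq (R n : ℕ) : nu R n = ∑ x ∈ sqf R ×ˢ sqf R,
    ((ArithmeticFunction.moebius x.1 : ℝ) * (ArithmeticFunction.moebius x.2 : ℝ) /
      (VV R * x.1 * x.2)) * (cr x.1 n * cr x.2 n) := by
  rw [nu, sq, fR, Finset.sum_mul_sum, Finset.sum_div, Finset.sum_product]
  refine Finset.sum_congr rfl fun r _ => ?_
  rw [Finset.sum_div]
  refine Finset.sum_congr rfl fun s _ => ?_
  ring

lemma coef_le {R r s : ℕ} (hR : 1 ≤ R) :
    |(ArithmeticFunction.moebius r : ℝ) * (ArithmeticFunction.moebius s : ℝ) / (VV R * r * s)| ≤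
      1 / (VV R * r * s) := by
  have := one_le_VV hR
  rw [abs_div, abs_mul, abs_of_nonneg (a := VV R * r * s) (by positivity)]
  gcongr
  have h1 := abs_moebius_le r
  have h2 := abs_moebius_le s
  calc _ ≤ (1:ℝ) * 1 := mul_le_mul h1 h2 (abs_nonneg _) (by norm_num)
    _ = 1 := by ring

/-- multiplier bound in the dual Fourier norm -/
def AN (h : ℕ → ℝ) (K : ℝ) : Prop := ∀ (F : ℕ → ℂ) (s : Finset ℕ) (B : ℝ),
  (∀ θ : ℝ, ‖∑ n ∈ s, F n * eu (θ * n)‖ ≤ B) →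
    ∀ θ : ℝ, ‖∑ n ∈ s, (h n : ℂ) * F n * eu (θ * n)‖ ≤ K * B

lemma AN_mul {h k : ℕ → ℝ} {K L : ℝ} (hh : AN h K) (hk : AN k L) :
    AN (fun n => h n * k n) (K * L) := by
  intro F s B hB θ
  have h1 := hk F s B hB
  have h2 := hh (fun n => (k n : ℂ) * F n) s (L * B) h1 θ
  rw [mul_assoc]
  convert h2 using 4
  push_cast; ring

lemma AN_mono {h : ℕ → ℝ} {K L : ℝ} (hh : AN h K) (hKL : K ≤ L) : AN h L := by
  intro F s B hB θ
  refine (hh F s B hB θ).trans ?_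
  have : 0 ≤ B := (norm_nonneg _).trans (hB 0)
  gcongr

lemma AN_sum {ι : Type*} (I : Finset ι) (c : ι → ℝ) (h : ι → ℕ → ℝ) (K : ι → ℝ)
    (hh : ∀ i ∈ I, AN (h i) (K i)) :
    AN (fun n => ∑ i ∈ I, c i * h i n) (∑ i ∈ I, |c i| * K i) := by
  intro F s B hB θ
  have e : ∑ n ∈ s, ((∑ i ∈ I, c i * h i n : ℝ) : ℂ) * F n * eu (θ * n) =
      ∑ i ∈ I, (c i : ℂ) * ∑ n ∈ s, (h i n : ℂ) * F n * eu (θ * n) := by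
    simp_rw [Finset.mul_sum]
    rw [Finset.sum_comm]
    refine Finset.sum_congr rfl fun n _ => ?_
    push_cast
    rw [Finset.sum_mul, Finset.sum_mul]
    refine Finset.sum_congr rfl fun i _ => ?_
    ring
  rw [e, Finset.sum_mul]
  refine (norm_sum_le _ _).trans (Finset.sum_le_sum fun i hi => ?_)
  rw [norm_mul, Complex.norm_real, Real.norm_eq_abs, mul_assoc]
  gcongr
  exact hh i hi F s B hB θ

lemma AN_one : AN (fun _ => 1) 1 := by
  intro F s B hB θ; simpa using hB θ

lemma cp_eq {p : ℕ} (hp : p.Prime) (n : ℕ) :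
    (cp p n : ℂ) = ∑ b ∈ range (p - 1), eu (((b:ℝ) + 1) / p * n) := by
  have hp0 : (p:ℝ) ≠ 0 := by exact_mod_cast hp.ne_zero
  set ω := eu ((n:ℝ) / p) with hω
  have h1 : ∀ b : ℕ, eu (((b:ℝ) + 1) / p * n) = ω ^ (b + 1) := by
    intro b
    rw [hω, ← eu_nat_mul]; congr 1; push_cast; field_simp
  simp_rw [h1]
  have h2 : ∑ b ∈ range p, ω ^ b = ∑ b ∈ range (p - 1), ω ^ (b + 1) + 1 := by
    obtain ⟨m, hm⟩ : ∃ m, p = m + 1 := ⟨p - 1, by have := hp.pos; omega⟩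
    rw [hm, Finset.sum_range_succ']; simp
  have h3 : ω ^ p = 1 := by
    rw [hω, ← eu_nat_mul, mul_div_cancel₀ _ hp0, eu_nat]
  have h4 : ω = 1 ↔ p ∣ n := by
    rw [hω, eu_eq_one_iff]
    constructor
    · rintro ⟨k, hk⟩
      rw [div_eq_iff hp0] at hk
      have : (n:ℤ) = k * p := by exact_mod_cast hk
      exact_mod_cast Dvd.intro_left k this.symm
    · rintro ⟨k, rfl⟩
      exact ⟨k, by push_cast; field_simp⟩
  rw [eq_comm, ← sub_eq_iff_eq_add.2 h2]
  unfold cp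
  split_ifs with hd
  · rw [h4.2 hd]; simp
  · have hne : ω ≠ 1 := fun h => hd (h4.1 h)
    have := geom_sum_eq hne p
    rw [this, h3]; simp

lemma AN_cp {p : ℕ} (hp : p.Prime) : AN (cp p) p := by
  intro F s B hB θ
  have hB0 : 0 ≤ B := (norm_nonneg _).trans (hB 0)
  have e : ∑ n ∈ s, (cp p n : ℂ) * F n * eu (θ * n) =
      ∑ b ∈ range (p - 1), ∑ n ∈ s, F n * eu ((((b:ℝ) + 1) / p + θ) * n) := by
    rw [Finset.sum_comm]
    refine Finset.sum_congr rfl fun n _ => ?_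
    rw [cp_eq hp, Finset.sum_mul, Finset.sum_mul]
    refine Finset.sum_congr rfl fun b _ => ?_
    rw [add_mul, eu_add]; ring
  rw [e]
  refine (norm_sum_le _ _).trans ((Finset.sum_le_sum fun b _ => hB _).trans ?_)
  rw [Finset.sum_const, Finset.card_range, nsmul_eq_mul]
  gcongr
  omega

lemma AN_prod (P : Finset ℕ) (hP : ∀ p ∈ P, p.Prime) :
    AN (fun n => ∏ p ∈ P, cp p n) (∏ p ∈ P, (p:ℝ)) := by
  induction P using Finset.induction_on with
  | empty => simpa using AN_one
  | insert p P hp ih =>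
    simp_rw [Finset.prod_insert hp]
    exact AN_mul (AN_cp (hP p (Finset.mem_insert_self _ _)))
      (ih fun l hl => hP l (Finset.mem_insert_of_mem hl))

lemma AN_cr {r : ℕ} (hr : Squarefree r) : AN (cr r) r := by
  have := AN_prod r.primeFactors (fun p hp => Nat.prime_of_mem_primeFactors hp)
  have e : ∏ p ∈ r.primeFactors, (p:ℝ) = r := by
    rw [← Nat.cast_prod, Nat.prod_primeFactors_of_squarefree hr]
  rw [e] at this
  exact this

lemma sum_coef_le {R : ℕ} (hR : 1 ≤ R) : ∑ x ∈ sqf R ×ˢ sqf R,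
    |(ArithmeticFunction.moebius x.1 : ℝ) * (ArithmeticFunction.moebius x.2 : ℝ) /
      (VV R * x.1 * x.2)| * (x.1 * x.2) ≤ (R:ℝ) ^ 2 := by
  have hV := one_le_VV hR
  calc _ ≤ ∑ x ∈ sqf R ×ˢ sqf R, (1:ℝ) := by
        refine Finset.sum_le_sum fun x hx => ?_
        obtain ⟨h1, h2⟩ := Finset.mem_product.1 hx
        have p1 : (0:ℝ) < x.1 := by exact_mod_cast (mem_sqf.1 h1).1.1
        have p2 : (0:ℝ) < x.2 := by exact_mod_cast (mem_sqf.1 h2).1.1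
        calc _ ≤ 1 / (VV R * x.1 * x.2) * (x.1 * x.2) := by gcongr; exact coef_le hR
          _ = 1 / VV R := by field_simp
          _ ≤ 1 := by rw [div_le_one (by linarith)]; exact hV
    _ = ((sqf R).card : ℝ) * (sqf R).card := by simp
    _ ≤ R * R := by
        have := card_sqf_le R
        gcongr
    _ = _ := by ring

lemma AN_nu {R : ℕ} (hR : 1 ≤ R) : AN (nu R) ((R:ℝ) ^ 2) := by
  have h := AN_sum (sqf R ×ˢ sqf R) (fun x => ((ArithmeticFunction.moebius x.1 : ℝ) *
    (ArithmeticFunction.moebius x.2 : ℝ) / (VV R * x.1 * x.2)))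
    (fun x n => cr x.1 n * cr x.2 n) (fun x => (x.1:ℝ) * x.2) (fun x hx => by
      obtain ⟨h1, h2⟩ := Finset.mem_product.1 hx
      exact AN_mul (AN_cr (mem_sqf.1 h1).2) (AN_cr (mem_sqf.1 h2).2))
  have e : nu R = fun n => ∑ x ∈ sqf R ×ˢ sqf R, ((ArithmeticFunction.moebius x.1 : ℝ) *
    (ArithmeticFunction.moebius x.2 : ℝ) / (VV R * x.1 * x.2)) * (cr x.1 n * cr x.2 n) := by
    funext n; exact nu_eq R n
  rw [e]
  exact AN_mono h (sum_coef_le hR)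

lemma nu_le {R : ℕ} (hR : 1 ≤ R) (n : ℕ) : nu R n ≤ (R:ℝ) ^ 2 := by
  rw [nu_eq]
  refine le_trans (Finset.sum_le_sum fun x hx => ?_) (sum_coef_le hR)
  obtain ⟨h1, h2⟩ := Finset.mem_product.1 hx
  refine (le_abs_self _).trans ?_
  rw [abs_mul, abs_mul (cr x.1 n)]
  gcongr
  · exact abs_cr_le (mem_sqf.1 h1).2 n
  · exact abs_cr_le (mem_sqf.1 h2).2 n

lemma sum_mul_period (A B : ℕ) (hA : 0 < A) (hB : 0 < B) (hco : Nat.Coprime A B) (f g : ℕ → ℝ)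
    (hf : Function.Periodic f A) (hg : Function.Periodic g B) :
    ∑ n ∈ range (A * B), f n * g n = (∑ n ∈ range A, f n) * (∑ n ∈ range B, g n) := by
  rw [Finset.sum_mul_sum, ← Finset.sum_product']
  have hinj : Set.InjOn (fun n : ℕ => (n % A, n % B)) (range (A * B) : Finset ℕ) := by
    intro n hn n' hn' he
    have hn := Finset.mem_range.1 (Finset.mem_coe.1 hn)
    have hn' := Finset.mem_range.1 (Finset.mem_coe.1 hn')
    simp only [Prod.mk.injEq] at he
    have h := (Nat.modEq_and_modEq_iff_modEq_mul hco).1 ⟨he.1, he.2⟩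
    exact Nat.ModEq.eq_of_lt_of_lt h hn hn'
  have himg : (range (A * B)).image (fun n : ℕ => (n % A, n % B)) = range A ×ˢ range B := by
    apply Finset.eq_of_subset_of_card_le
    · intro x hx
      obtain ⟨n, hn, rfl⟩ := Finset.mem_image.1 hx
      rw [Finset.mem_product, Finset.mem_range, Finset.mem_range]
      exact ⟨Nat.mod_lt _ hA, Nat.mod_lt _ hB⟩
    · rw [Finset.card_image_of_injOn hinj]; simp
  rw [← himg, Finset.sum_image hinj]
  refine Finset.sum_congr rfl fun n _ => ?_
  simp only
  rw [hf.map_mod_nat, hg.map_mod_nat]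

lemma periodic_prod (P : Finset ℕ) (u : ℕ → ℕ → ℝ) (hu : ∀ p ∈ P, Function.Periodic (u p) p) :
    Function.Periodic (fun n => ∏ p ∈ P, u p n) (∏ p ∈ P, p) := by
  intro n
  refine Finset.prod_congr rfl fun p hp => ?_
  obtain ⟨k, hk⟩ := Finset.dvd_prod_of_mem (fun p : ℕ => p) hp
  rw [hk, mul_comm]
  have := (hu p hp).nat_mul k
  simpa using this n

lemma sum_prod_period (P : Finset ℕ) (hP : ∀ p ∈ P, p.Prime) (u : ℕ → ℕ → ℝ)
    (hu : ∀ p ∈ P, Function.Periodic (u p) p) :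
    ∑ n ∈ range (∏ p ∈ P, p), ∏ p ∈ P, u p n = ∏ p ∈ P, ∑ n ∈ range p, u p n := by
  induction P using Finset.induction_on with
  | empty => simp
  | insert p P hp ih =>
    have hP' : ∀ l ∈ P, l.Prime := fun l hl => hP l (Finset.mem_insert_of_mem hl)
    have hu' : ∀ l ∈ P, Function.Periodic (u l) l := fun l hl => hu l (Finset.mem_insert_of_mem hl)
    have hpp := hP p (Finset.mem_insert_self _ _)
    simp_rw [Finset.prod_insert hp]
    rw [sum_mul_period p (∏ l ∈ P, l) hpp.pos (Finset.prod_pos fun l hl => (hP' l hl).pos) ?_ _ _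
      (hu p (Finset.mem_insert_self _ _)) (periodic_prod P u hu'), ih hP' hu']
    apply Nat.Coprime.prod_right
    intro l hl
    exact (Nat.coprime_primes hpp (hP' l hl)).2 (fun h => hp (h ▸ hl))

lemma modEq_add_dvd {p a b : ℕ} (h : p ∣ b) : a + b ≡ a [MOD p] := by
  obtain ⟨k, rfl⟩ := h
  unfold Nat.ModEq; simp

lemma cp_periodic (p : ℕ) : Function.Periodic (cp p) p := by
  intro n; unfold cp; simp

lemma cp_congr {p a b : ℕ} (h : a ≡ b [MOD p]) : cp p a = cp p b := by
  unfold cp; simp only [h.dvd_iff (dvd_refl p)]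

lemma card_dvd_ap {p q : ℕ} (hp : p.Prime) (hq : ¬ p ∣ q) (m : ℕ) :
    ∑ n ∈ range p, (if p ∣ m + q * n then (1:ℝ) else 0) = 1 := by
  have hc : Nat.Coprime q p := ((Nat.Prime.coprime_iff_not_dvd hp).2 hq).symm
  have : NeZero p := ⟨hp.ne_zero⟩
  have : Fact p.Prime := ⟨hp⟩
  set x : ZMod p := -(m:ZMod p) * (q:ZMod p)⁻¹ with hx
  have hq0 : (q:ZMod p) ≠ 0 := by rwa [Ne, ZMod.natCast_eq_zero_iff]
  have h1 : ∀ n ∈ range p, (p ∣ m + q * n ↔ n = x.val) := by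
    intro n hn
    rw [← ZMod.natCast_eq_zero_iff]
    push_cast
    have hn := Finset.mem_range.1 hn
    constructor
    · intro h
      have : (n : ZMod p) = x := by
        rw [hx]; field_simp; linear_combination h
      rw [← this, ZMod.val_natCast, Nat.mod_eq_of_lt hn]
    · intro h
      have : (n : ZMod p) = x := by rw [h]; simp
      rw [this, hx]; field_simp; ring
  rw [Finset.sum_congr rfl (fun n hn => if_congr (h1 n hn) rfl rfl), Finset.sum_ite_eq',
    if_pos (Finset.mem_range.2 (ZMod.val_lt x))]

lemma sum_cp_ap {p q : ℕ} (hp : p.Prime) (hq : ¬ p ∣ q) (m : ℕ) :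
    ∑ n ∈ range p, cp p (m + q * n) = 0 := by
  have h := card_dvd_ap hp hq m
  have e : ∀ n, cp p (m + q * n) = p * (if p ∣ m + q * n then (1:ℝ) else 0) - 1 := by
    intro n; unfold cp; split_ifs <;> simp
  simp_rw [e]
  rw [Finset.sum_sub_distrib, ← Finset.mul_sum, h]; simp

lemma sum_cp_sq_ap {p q : ℕ} (hp : p.Prime) (hq : ¬ p ∣ q) (m : ℕ) :
    ∑ n ∈ range p, cp p (m + q * n) * cp p (m + q * n) = p * ((p:ℝ) - 1) := by
  have h := card_dvd_ap hp hq m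
  have e : ∀ n, cp p (m + q * n) * cp p (m + q * n) =
      ((p:ℝ)^2 - 2 * p) * (if p ∣ m + q * n then (1:ℝ) else 0) + 1 := by
    intro n; unfold cp; split_ifs
    · ring
    · simp
  simp_rw [e]
  rw [Finset.sum_add_distrib, ← Finset.mul_sum, h]; simp; ring

/-- part of `r` composed of primes dividing `q` -/
def pin (q r : ℕ) : ℕ := ∏ p ∈ r.primeFactors.filter (fun p => p ∣ q), p
/-- part of `r` composed of primes not dividing `q` -/
def pout (q r : ℕ) : ℕ := ∏ p ∈ r.primeFactors.filter (fun p => ¬ p ∣ q), p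

lemma pin_mul_pout {q r : ℕ} (hr : Squarefree r) : pin q r * pout q r = r := by
  unfold pin pout
  rw [Finset.prod_filter_mul_prod_filter_not, Nat.prod_primeFactors_of_squarefree hr]

lemma pin_dvd (q r : ℕ) : pin q r ∣ q := by
  apply Finset.prod_primes_dvd
  · intro p hp; exact (Nat.prime_of_mem_primeFactors (Finset.mem_filter.1 hp).1).prime
  · intro p hp; exact (Finset.mem_filter.1 hp).2

lemma pf_pin (q r : ℕ) : (pin q r).primeFactors = r.primeFactors.filter (fun p => p ∣ q) :=
  Nat.primeFactors_prod fun _ hp => Nat.prime_of_mem_primeFactors (Finset.mem_filter.1 hp).1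

lemma pf_pout (q r : ℕ) : (pout q r).primeFactors = r.primeFactors.filter (fun p => ¬ p ∣ q) :=
  Nat.primeFactors_prod fun _ hp => Nat.prime_of_mem_primeFactors (Finset.mem_filter.1 hp).1

lemma pin_sqf {q r : ℕ} (hr : Squarefree r) : Squarefree (pin q r) :=
  hr.squarefree_of_dvd (Dvd.intro _ (pin_mul_pout (q := q) hr))

lemma pout_sqf {q r : ℕ} (hr : Squarefree r) : Squarefree (pout q r) :=
  hr.squarefree_of_dvd (Dvd.intro_left _ (pin_mul_pout (q := q) hr))

/-- the primes involved in a pair -/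
def prs (r s : ℕ) : Finset ℕ := r.primeFactors ∪ s.primeFactors
def Pi2 (r s : ℕ) : ℕ := ∏ p ∈ prs r s, p

def kap (q r s : ℕ) : ℝ := ∏ p ∈ (prs r s).filter (fun p => ¬ p ∣ q),
  (if p ∈ r.primeFactors ∧ p ∈ s.primeFactors then (p:ℝ) - 1 else 0)

lemma prime_of_mem_prs {r s p : ℕ} (h : p ∈ prs r s) : p.Prime := by
  rcases Finset.mem_union.1 h with h | h <;> exact Nat.prime_of_mem_primeFactors h

lemma Pi2_pos (r s : ℕ) : 0 < Pi2 r s := Finset.prod_pos fun _ hp => (prime_of_mem_prs hp).pos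

lemma Pi2_le {r s : ℕ} (hr : Squarefree r) (hs : Squarefree s) : Pi2 r s ≤ r * s := by
  apply Nat.le_of_dvd
  · exact Nat.mul_pos (Nat.pos_of_ne_zero hr.ne_zero) (Nat.pos_of_ne_zero hs.ne_zero)
  · apply Finset.prod_primes_dvd
    · intro p hp; exact (prime_of_mem_prs hp).prime
    · intro p hp
      rcases Finset.mem_union.1 hp with h | h
      · exact (Nat.dvd_of_mem_primeFactors h).mul_right s
      · exact (Nat.dvd_of_mem_primeFactors h).mul_left r

lemma kap_le (q r s : ℕ) :
    |kap q r s| ≤ if pout q r = pout q s then (pout q r : ℝ) else 0 := by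
  by_cases hk : kap q r s = 0
  · rw [hk, abs_zero]; split_ifs <;> positivity
  · have hne := Finset.prod_ne_zero_iff.1 hk
    have hmem : ∀ p ∈ (prs r s).filter (fun p => ¬ p ∣ q),
        p ∈ r.primeFactors ∧ p ∈ s.primeFactors := by
      intro p hp
      by_contra h
      exact hne p hp (if_neg h)
    have e1 : r.primeFactors.filter (fun p => ¬ p ∣ q) = (prs r s).filter (fun p => ¬ p ∣ q) := by
      apply Finset.Subset.antisymm
      · exact Finset.filter_subset_filter _ Finset.subset_union_left
      · intro p hp
        exact Finset.mem_filter.2 ⟨(hmem p hp).1, (Finset.mem_filter.1 hp).2⟩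
    have e2 : s.primeFactors.filter (fun p => ¬ p ∣ q) = (prs r s).filter (fun p => ¬ p ∣ q) := by
      apply Finset.Subset.antisymm
      · exact Finset.filter_subset_filter _ Finset.subset_union_right
      · intro p hp
        exact Finset.mem_filter.2 ⟨(hmem p hp).2, (Finset.mem_filter.1 hp).2⟩
    have e3 : pout q r = pout q s := by unfold pout; rw [e1, e2]
    rw [if_pos e3]
    unfold kap pout
    rw [e1, Finset.abs_prod]
    push_cast
    refine Finset.prod_le_prod (fun _ _ => abs_nonneg _) fun p hp => ?_
    have : (1:ℝ) ≤ p := by exact_mod_cast (prime_of_mem_prs (Finset.mem_filter.1 hp).1).one_le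
    rw [if_pos (hmem p hp), abs_of_nonneg (by linarith)]; linarith

lemma avg_ap (q r s m : ℕ) :
    ∑ n ∈ range (Pi2 r s), cr r (m + q * n) * cr s (m + q * n) =
      Pi2 r s * (kap q r s * (cr (pin q r) m * cr (pin q s) m)) := by
  set u : ℕ → ℕ → ℝ := fun p n => (if p ∈ r.primeFactors then cp p (m + q * n) else 1) *
    (if p ∈ s.primeFactors then cp p (m + q * n) else 1) with hu
  have h1 : ∀ n, cr r (m + q * n) * cr s (m + q * n) = ∏ p ∈ prs r s, u p n := by
    intro n
    simp only [hu]
    rw [Finset.prod_mul_distrib, Finset.prod_ite_mem, Finset.prod_ite_mem]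
    unfold prs cr
    rw [Finset.union_inter_cancel_left, Finset.union_inter_cancel_right]
  have hper : ∀ p ∈ prs r s, Function.Periodic (u p) p := by
    intro p _ n
    have : cp p (m + q * (n + p)) = cp p (m + q * n) := by
      apply cp_congr
      have : m + q * (n + p) = m + q * n + p * q := by ring
      rw [this]; exact modEq_add_dvd (Dvd.intro _ rfl)
    simp only [hu, this]
  simp_rw [h1]
  unfold Pi2
  rw [sum_prod_period _ (fun p hp => prime_of_mem_prs hp) u hper]
  have h2 : ∀ p ∈ prs r s, ∑ n ∈ range p, u p n = (p:ℝ) *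
      (if p ∣ q then u p 0 else
        (if p ∈ r.primeFactors ∧ p ∈ s.primeFactors then (p:ℝ) - 1 else 0)) := by
    intro p hp
    have hpp := prime_of_mem_prs hp
    split_ifs with h h'
    · have : ∀ n ∈ range p, u p n = u p 0 := by
        intro n _
        have : cp p (m + q * n) = cp p (m + q * 0) := by
          apply cp_congr
          rw [mul_zero, add_zero]
          exact modEq_add_dvd (h.mul_right n)
        simp only [hu, this]
      rw [Finset.sum_congr rfl this]; simp
    · simp only [hu, h'.1, h'.2, if_true]
      exact sum_cp_sq_ap hpp h m
    · rw [mul_zero]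
      rcases Finset.mem_union.1 hp with h3 | h3
      · have h4 : p ∉ s.primeFactors := fun h4 => h' ⟨h3, h4⟩
        simp only [hu, h3, h4, if_true, if_false, mul_one]
        exact sum_cp_ap hpp h m
      · have h4 : p ∉ r.primeFactors := fun h4 => h' ⟨h4, h3⟩
        simp only [hu, h3, h4, if_true, if_false, one_mul]
        exact sum_cp_ap hpp h m
  rw [Finset.prod_congr rfl h2, Finset.prod_mul_distrib]
  push_cast
  congr 1
  rw [Finset.prod_ite, mul_comm]
  unfold kap
  congr 1
  simp only [hu, mul_zero, add_zero]
  rw [Finset.prod_mul_distrib, Finset.prod_ite_mem, Finset.prod_ite_mem]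
  unfold cr
  rw [pf_pin, pf_pin]
  congr 1
  · refine Finset.prod_congr ?_ fun _ _ => rfl
    ext p; simp only [Finset.mem_inter, Finset.mem_filter, prs, Finset.mem_union]; tauto
  · refine Finset.prod_congr ?_ fun _ _ => rfl
    ext p; simp only [Finset.mem_inter, Finset.mem_filter, prs, Finset.mem_union]; tauto

lemma periodic_partial (w : ℕ → ℂ) (P : ℕ) (hP : 0 < P) (hw : Function.Periodic w P) (B : ℝ)
    (hB : ∀ n, ‖w n‖ ≤ B) (x : ℕ) :
    ‖∑ n ∈ range x, w n - x * ((∑ n ∈ range P, w n) / P)‖ ≤ 2 * P * B := by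
  have hB0 : 0 ≤ B := (norm_nonneg _).trans (hB 0)
  have hPR : (0:ℝ) < P := by exact_mod_cast hP
  have hPC : (P:ℂ) ≠ 0 := by exact_mod_cast hP.ne'
  set S := ∑ n ∈ range P, w n with hS
  have key : ∀ k : ℕ, ∑ n ∈ range (P * k), w n = k * S := by
    intro k
    induction k with
    | zero => simp
    | succ k ih =>
      rw [Nat.mul_succ, Finset.sum_range_add, ih]
      have : ∀ n, w (P * k + n) = w n := by
        intro n; rw [add_comm, mul_comm]
        have := hw.nat_mul k n
        simpa using this
      simp_rw [this]
      push_cast; rw [← hS]; ring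
  have hx : x = P * (x / P) + x % P := (Nat.div_add_mod x P).symm
  set k := x / P
  set t := x % P
  have ht : t < P := Nat.mod_lt _ hP
  have e : ∑ n ∈ range x, w n - x * (S / P) = ∑ n ∈ range t, w (P * k + n) - t * (S / P) := by
    rw [hx, Finset.sum_range_add, key]
    push_cast
    field_simp; ring
  rw [e]
  have hSn : ‖S‖ ≤ P * B := by
    refine (norm_sum_le _ _).trans ((Finset.sum_le_sum fun n _ => hB n).trans ?_)
    simp
  have htR : (t:ℝ) ≤ P := by exact_mod_cast ht.le
  calc _ ≤ ‖∑ n ∈ range t, w (P * k + n)‖ + ‖t * (S / P)‖ := norm_sub_le _ _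
    _ ≤ P * B + P * B := by
      gcongr
      · refine (norm_sum_le _ _).trans ((Finset.sum_le_sum fun n _ => hB _).trans ?_)
        simp; gcongr
      · rw [norm_mul, norm_div, Complex.norm_natCast, Complex.norm_natCast]
        calc (t:ℝ) * (‖S‖ / P) ≤ P * ((P * B) / P) := by gcongr
          _ = P * B := by field_simp
    _ = _ := by ring

def coef (R r s : ℕ) : ℝ :=
  (ArithmeticFunction.moebius r : ℝ) * (ArithmeticFunction.moebius s : ℝ) / (VV R * r * s)

def Tq (q : ℕ) (ψ : ℕ → ℂ) (d e : ℕ) : ℂ := (∑ m ∈ range q, ψ m * (cr d m * cr e m : ℝ)) / q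

def EE (R q : ℕ) (ψ : ℕ → ℂ) : ℂ := ∑ x ∈ sqf R ×ˢ sqf R,
  (coef R x.1 x.2 * kap q x.1 x.2 : ℝ) * Tq q ψ (pin q x.1) (pin q x.2)

lemma cr_periodic_aux {r k : ℕ} (h : ∀ p ∈ r.primeFactors, p ∣ k) (n : ℕ) :
    cr r (n + k) = cr r n := by
  unfold cr
  exact Finset.prod_congr rfl fun p hp => cp_congr (modEq_add_dvd (h p hp))

lemma sum_range_mul_ap (f : ℕ → ℂ) (q P : ℕ) :
    ∑ n ∈ range (P * q), f n = ∑ m ∈ range q, ∑ j ∈ range P, f (m + q * j) := by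
  induction P with
  | zero => simp
  | succ P ih =>
    rw [Nat.succ_mul, Finset.sum_range_add, ih, ← Finset.sum_add_distrib]
    refine Finset.sum_congr rfl fun m _ => ?_
    rw [Finset.sum_range_succ]
    congr 2
    ring

lemma pair_partial {q r s : ℕ} (hq : 0 < q) (hr : Squarefree r) (hs : Squarefree s) (ψ : ℕ → ℂ)
    (hψ : Function.Periodic ψ q) (hψ1 : ∀ n, ‖ψ n‖ ≤ 1) (x : ℕ) :
    ‖∑ n ∈ range x, ((cr r n * cr s n : ℝ) : ℂ) * ψ n -
      x * ((kap q r s : ℂ) * Tq q ψ (pin q r) (pin q s))‖ ≤ 2 * q * (r * s) ^ 2 := by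
  set w : ℕ → ℂ := fun n => ((cr r n * cr s n : ℝ) : ℂ) * ψ n with hw
  have hPi := Pi2_pos r s
  have hper : Function.Periodic w ((Pi2 r s * q : ℕ)) := by
    intro n
    simp only [hw]
    rw [cr_periodic_aux, cr_periodic_aux]
    · congr 1
      have := hψ.nat_mul (Pi2 r s) n
      simpa using this
    · intro p hp
      exact (Finset.dvd_prod_of_mem (fun p : ℕ => p) (Finset.mem_union_right _ hp)).mul_right q
    · intro p hp
      exact (Finset.dvd_prod_of_mem (fun p : ℕ => p) (Finset.mem_union_left _ hp)).mul_right q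
  have hbd : ∀ n, ‖w n‖ ≤ (r * s : ℝ) := by
    intro n
    simp only [hw]
    rw [norm_mul, Complex.norm_real, Real.norm_eq_abs, abs_mul]
    calc _ ≤ ((r:ℝ) * s) * 1 := by
          gcongr
          · exact abs_cr_le hr n
          · exact abs_cr_le hs n
          · exact hψ1 n
      _ = _ := by ring
  have h := periodic_partial w (Pi2 r s * q) (by positivity) hper _ hbd x
  have hsum : ∑ n ∈ range (Pi2 r s * q), w n =
      (Pi2 r s : ℂ) * kap q r s * ∑ m ∈ range q, ψ m * (cr (pin q r) m * cr (pin q s) m : ℝ) := by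
    rw [sum_range_mul_ap, Finset.mul_sum]
    refine Finset.sum_congr rfl fun m _ => ?_
    have e : ∀ j, w (m + q * j) = ((cr r (m + q * j) * cr s (m + q * j) : ℝ) : ℂ) * ψ m := by
      intro j
      simp only [hw]
      congr 1
      have := hψ.nat_mul j m
      rw [mul_comm q j]; simpa using this
    simp_rw [e]
    rw [← Finset.sum_mul, ← Complex.ofReal_sum, avg_ap]
    push_cast; ring
  have hPC : (Pi2 r s : ℂ) ≠ 0 := by exact_mod_cast hPi.ne'
  have hqC : (q:ℂ) ≠ 0 := by exact_mod_cast hq.ne'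
  have e2 : (∑ n ∈ range (Pi2 r s * q), w n) / ((Pi2 r s * q : ℕ) : ℂ) =
      (kap q r s : ℂ) * Tq q ψ (pin q r) (pin q s) := by
    rw [hsum, Tq]; push_cast; field_simp
  rw [e2] at h
  refine h.trans ?_
  have hle : (Pi2 r s : ℝ) ≤ r * s := by exact_mod_cast Pi2_le hr hs
  push_cast
  calc 2 * ((Pi2 r s : ℝ) * q) * (r * s) ≤ 2 * ((r * s : ℝ) * q) * (r * s) := by gcongr
    _ = _ := by ring

lemma nu_partial {R q : ℕ} (hR : 1 ≤ R) (hq : 0 < q) (ψ : ℕ → ℂ)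
    (hψ : Function.Periodic ψ q) (hψ1 : ∀ n, ‖ψ n‖ ≤ 1) (x : ℕ) :
    ‖∑ n ∈ range x, (nu R n : ℂ) * ψ n - x * EE R q ψ‖ ≤ 2 * q * (R:ℝ) ^ 4 := by
  have hV := one_le_VV hR
  have e : ∑ n ∈ range x, (nu R n : ℂ) * ψ n - x * EE R q ψ =
      ∑ y ∈ sqf R ×ˢ sqf R, (coef R y.1 y.2 : ℂ) *
        (∑ n ∈ range x, ((cr y.1 n * cr y.2 n : ℝ) : ℂ) * ψ n -
      x * ((kap q y.1 y.2 : ℂ) * Tq q ψ (pin q y.1) (pin q y.2))) := by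
    simp_rw [mul_sub, Finset.sum_sub_distrib]
    congr 1
    · simp_rw [Finset.mul_sum]
      rw [Finset.sum_comm]
      refine Finset.sum_congr rfl fun n _ => ?_
      rw [nu_eq]
      push_cast
      rw [Finset.sum_mul]
      refine Finset.sum_congr rfl fun y _ => ?_
      unfold coef; push_cast; ring
    · unfold EE
      rw [Finset.mul_sum]
      refine Finset.sum_congr rfl fun y _ => ?_
      push_cast; ring
  rw [e]
  refine (norm_sum_le _ _).trans ?_
  calc _ ≤ ∑ y ∈ sqf R ×ˢ sqf R, 2 * q * (R:ℝ) ^ 2 := by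
        refine Finset.sum_le_sum fun y hy => ?_
        obtain ⟨h1, h2⟩ := Finset.mem_product.1 hy
        obtain ⟨⟨a1, a2⟩, a3⟩ := mem_sqf.1 h1
        obtain ⟨⟨b1, b2⟩, b3⟩ := mem_sqf.1 h2
        have p1 : (0:ℝ) < y.1 := by exact_mod_cast a1
        have p2 : (0:ℝ) < y.2 := by exact_mod_cast b1
        rw [norm_mul, Complex.norm_real, Real.norm_eq_abs]
        calc _ ≤ 1 / (VV R * y.1 * y.2) * (2 * q * (y.1 * y.2) ^ 2) := by
              gcongr
              · exact coef_le hR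
              · exact pair_partial hq a3 b3 ψ hψ hψ1 x
          _ = (1 / VV R) * (2 * q * (y.1 * y.2)) := by field_simp
          _ ≤ 1 * (2 * q * (R * R)) := by
              gcongr
              rw [div_le_one (by linarith)]; exact hV
          _ = _ := by ring
    _ = ((sqf R).card : ℝ) * (sqf R).card * (2 * q * (R:ℝ) ^ 2) := by simp
    _ ≤ R * R * (2 * q * (R:ℝ) ^ 2) := by
        have := card_sqf_le R
        gcongr
    _ = _ := by ring

/-- squarefree divisors -/
def sdv (q : ℕ) : Finset ℕ := q.divisors.filter Squarefree

lemma card_sdv_le (q : ℕ) : ((sdv q).card : ℝ) ≤ dv q := by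
  unfold sdv dv; exact_mod_cast Finset.card_filter_le _ _

lemma EE_le {R q : ℕ} (hR : 1 ≤ R) (hq : 0 < q) (ψ : ℕ → ℂ) :
    ‖EE R q ψ‖ ≤ ∑ y ∈ sdv q ×ˢ sdv q, ‖Tq q ψ y.1 y.2‖ / (y.1 * y.2) := by
  have hV := one_le_VV hR
  set g : ℕ × ℕ → ℕ × (ℕ × ℕ) := fun x => (pout q x.1, (pin q x.1, pin q x.2)) with hg
  set I := (sqf R ×ˢ sqf R).filter (fun x => pout q x.1 = pout q x.2) with hI
  set Φ : ℕ × (ℕ × ℕ) → ℝ := fun z => (1 / VV R) * ((1 / (z.1:ℝ)) *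
    (‖Tq q ψ z.2.1 z.2.2‖ / (z.2.1 * z.2.2))) with hΦ
  have hinj : Set.InjOn g (I : Finset (ℕ × ℕ)) := by
    intro x hx y hy he
    have hx := Finset.mem_filter.1 (Finset.mem_coe.1 hx)
    have hy := Finset.mem_filter.1 (Finset.mem_coe.1 hy)
    have hx1 := Finset.mem_product.1 hx.1
    have hy1 := Finset.mem_product.1 hy.1
    simp only [hg, Prod.mk.injEq] at he
    have a1 := pin_mul_pout (q := q) (mem_sqf.1 hx1.1).2
    have a2 := pin_mul_pout (q := q) (mem_sqf.1 hx1.2).2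
    have a3 := pin_mul_pout (q := q) (mem_sqf.1 hy1.1).2
    have a4 := pin_mul_pout (q := q) (mem_sqf.1 hy1.2).2
    ext
    · rw [← a1, ← a3, he.1, he.2.1]
    · rw [← a2, ← a4, ← hx.2, ← hy.2, he.1, he.2.2]
  have hmaps : I.image g ⊆ sqf R ×ˢ (sdv q ×ˢ sdv q) := by
    intro z hz
    obtain ⟨x, hx, rfl⟩ := Finset.mem_image.1 hz
    have hx := Finset.mem_filter.1 hx
    have hx1 := Finset.mem_product.1 hx.1
    obtain ⟨⟨a1, a2⟩, a3⟩ := mem_sqf.1 hx1.1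
    obtain ⟨⟨b1, b2⟩, b3⟩ := mem_sqf.1 hx1.2
    simp only [hg, Finset.mem_product, sdv, Finset.mem_filter, Nat.mem_divisors]
    refine ⟨mem_sqf.2 ⟨⟨Nat.pos_of_ne_zero (pout_sqf a3).ne_zero, ?_⟩, pout_sqf a3⟩,
      ⟨⟨pin_dvd q _, hq.ne'⟩, pin_sqf a3⟩, ⟨⟨pin_dvd q _, hq.ne'⟩, pin_sqf b3⟩⟩
    exact (Nat.le_of_dvd (by omega) (Dvd.intro_left _ (pin_mul_pout (q := q) a3))).trans a2
  calc ‖EE R q ψ‖ ≤ ∑ x ∈ sqf R ×ˢ sqf R,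
        ‖((coef R x.1 x.2 * kap q x.1 x.2 : ℝ) : ℂ) * Tq q ψ (pin q x.1) (pin q x.2)‖ :=
        norm_sum_le _ _
    _ ≤ ∑ x ∈ sqf R ×ˢ sqf R, if pout q x.1 = pout q x.2 then Φ (g x) else 0 := by
        refine Finset.sum_le_sum fun x hx => ?_
        have hx1 := Finset.mem_product.1 hx
        obtain ⟨⟨a1, a2⟩, a3⟩ := mem_sqf.1 hx1.1
        obtain ⟨⟨b1, b2⟩, b3⟩ := mem_sqf.1 hx1.2
        rw [norm_mul, Complex.norm_real, Real.norm_eq_abs, abs_mul]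
        have hk := kap_le q x.1 x.2
        have hc := coef_le (R := R) (r := x.1) (s := x.2) hR
        split_ifs at hk ⊢ with h
        · have p1 : (0:ℝ) < pin q x.1 := by
            exact_mod_cast Nat.pos_of_ne_zero (pin_sqf a3).ne_zero
          have p2 : (0:ℝ) < pin q x.2 := by
            exact_mod_cast Nat.pos_of_ne_zero (pin_sqf b3).ne_zero
          have p3 : (0:ℝ) < pout q x.1 := by
            exact_mod_cast Nat.pos_of_ne_zero (pout_sqf a3).ne_zero
          have e1 : (x.1:ℝ) = pin q x.1 * pout q x.1 := by
            exact_mod_cast (pin_mul_pout (q := q) a3).symm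
          have e2 : (x.2:ℝ) = pin q x.2 * pout q x.1 := by
            rw [h]; exact_mod_cast (pin_mul_pout (q := q) b3).symm
          calc _ ≤ 1 / (VV R * x.1 * x.2) * pout q x.1 * ‖Tq q ψ (pin q x.1) (pin q x.2)‖ := by
                gcongr; exact hc
            _ = Φ (g x) := by
                simp only [hΦ, hg]
                rw [e1, e2]; field_simp
        · have : |kap q x.1 x.2| = 0 := le_antisymm hk (abs_nonneg _)
          rw [this]; simp
    _ = ∑ x ∈ I, Φ (g x) := by rw [hI, Finset.sum_filter]
    _ = ∑ z ∈ I.image g, Φ z := (Finset.sum_image hinj).symm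
    _ ≤ ∑ z ∈ sqf R ×ˢ (sdv q ×ˢ sdv q), Φ z :=
        Finset.sum_le_sum_of_subset_of_nonneg hmaps fun z _ _ => by simp only [hΦ]; positivity
    _ = (1 / VV R) * (VV R * ∑ y ∈ sdv q ×ˢ sdv q, ‖Tq q ψ y.1 y.2‖ / (y.1 * y.2)) := by
        simp only [hΦ]
        rw [← Finset.mul_sum, VV, Finset.sum_mul_sum, Finset.sum_product]
    _ = _ := by field_simp

lemma Tq_le {q d e : ℕ} (hd : Squarefree d) (he : Squarefree e) (ψ : ℕ → ℂ) (B : ℝ)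
    (hB : ∀ θ : ℝ, ‖∑ m ∈ range q, ψ m * eu (θ * m)‖ ≤ B) :
    ‖Tq q ψ d e‖ / (d * e) ≤ B / q := by
  have p1 : (0:ℝ) < d := by exact_mod_cast Nat.pos_of_ne_zero hd.ne_zero
  have p2 : (0:ℝ) < e := by exact_mod_cast Nat.pos_of_ne_zero he.ne_zero
  have h := AN_mul (AN_cr hd) (AN_cr he) ψ (range q) B hB 0
  simp only [zero_mul, eu_zero, mul_one] at h
  unfold Tq
  rw [norm_div, Complex.norm_natCast, div_div, mul_comm (q:ℝ), ← div_div]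
  gcongr
  rw [div_le_iff₀ (by positivity), mul_comm B]
  refine le_trans (le_of_eq ?_) h
  congr 1
  exact Finset.sum_congr rfl fun m _ => mul_comm _ _

lemma EE_sup {R q : ℕ} (hR : 1 ≤ R) (hq : 0 < q) (ψ : ℕ → ℂ) (B : ℝ)
    (hB : ∀ θ : ℝ, ‖∑ m ∈ range q, ψ m * eu (θ * m)‖ ≤ B) :
    ‖EE R q ψ‖ ≤ dv q ^ 2 * (B / q) := by
  have hB0 : 0 ≤ B := (norm_nonneg _).trans (hB 0)
  refine (EE_le hR hq ψ).trans ?_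
  calc _ ≤ ∑ y ∈ sdv q ×ˢ sdv q, B / q := Finset.sum_le_sum fun y hy => by
        have := Finset.mem_product.1 hy
        exact Tq_le (Finset.mem_filter.1 this.1).2 (Finset.mem_filter.1 this.2).2 ψ B hB
    _ = (sdv q).card * (sdv q).card * (B / q) := by simp
    _ ≤ dv q * dv q * (B / q) := by
        have := card_sdv_le q
        have := dv_nonneg q
        gcongr
    _ = _ := by ring

/-- pairs with congruent cubes -/
def Zs (q : ℕ) : Finset (ℕ × ℕ) :=
  (range q ×ˢ range q).filter (fun x => x.1 ^ 3 ≡ x.2 ^ 3 [MOD q])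

lemma mem_Zs {q : ℕ} {x : ℕ × ℕ} : x ∈ Zs q ↔ (x.1 < q ∧ x.2 < q) ∧ x.1 ^ 3 ≡ x.2 ^ 3 [MOD q] := by
  simp [Zs]

lemma Zs_mul_le {A B : ℕ} (hA : 0 < A) (hB : 0 < B) (hco : Nat.Coprime A B) :
    (Zs (A * B)).card ≤ (Zs A).card * (Zs B).card := by
  rw [← Finset.card_product]
  refine Finset.card_le_card_of_injOn
    (fun x => ((x.1 % A, x.2 % A), (x.1 % B, x.2 % B))) ?_ ?_
  · intro x hx
    obtain ⟨⟨h1, h2⟩, h3⟩ := mem_Zs.1 (Finset.mem_coe.1 hx)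
    have key : ∀ C, C ∣ A * B → (x.1 % C) ^ 3 ≡ (x.2 % C) ^ 3 [MOD C] := by
      intro C hC
      exact ((Nat.mod_modEq _ _).pow 3).trans ((h3.of_dvd hC).trans ((Nat.mod_modEq _ _).symm.pow 3))
    simp only [Finset.coe_product, Set.mem_prod, Finset.mem_coe, mem_Zs]
    exact ⟨⟨⟨Nat.mod_lt _ hA, Nat.mod_lt _ hA⟩, key A (Dvd.intro _ rfl)⟩,
      ⟨⟨Nat.mod_lt _ hB, Nat.mod_lt _ hB⟩, key B (Dvd.intro_left _ rfl)⟩⟩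
  · intro x hx y hy he
    obtain ⟨⟨h1, h2⟩, h3⟩ := mem_Zs.1 (Finset.mem_coe.1 hx)
    obtain ⟨⟨k1, k2⟩, k3⟩ := mem_Zs.1 (Finset.mem_coe.1 hy)
    simp only [Prod.mk.injEq] at he
    ext
    · exact Nat.ModEq.eq_of_lt_of_lt
        ((Nat.modEq_and_modEq_iff_modEq_mul hco).1 ⟨he.1.1, he.2.1⟩) h1 k1
    · exact Nat.ModEq.eq_of_lt_of_lt
        ((Nat.modEq_and_modEq_iff_modEq_mul hco).1 ⟨he.1.2, he.2.2⟩) h2 k2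

lemma card_cube_roots {p k : ℕ} (hp : p.Prime) (hk : 1 ≤ k) [NeZero (p ^ k)] :
    (Finset.univ.filter (fun t : (ZMod (p ^ k))ˣ => t ^ 3 = 1)).card ≤ 3 := by
  by_cases h2 : p = 2
  · subst h2
    have : Finset.univ.filter (fun t : (ZMod (2 ^ k))ˣ => t ^ 3 = 1) ⊆ {1} := by
      intro t ht
      have ht := (Finset.mem_filter.1 ht).2
      have h1 : orderOf t ∣ 3 := orderOf_dvd_of_pow_eq_one ht
      have h3 : orderOf t ∣ 2 ^ (k - 1) := by
        have := orderOf_dvd_card (x := t)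
        rw [ZMod.card_units_eq_totient, Nat.totient_prime_pow Nat.prime_two (by omega)] at this
        simpa using this
      have h4 : Nat.Coprime 3 (2 ^ (k-1)) := Nat.Coprime.pow_right _ (by norm_num)
      have h5 : orderOf t = 1 := Nat.eq_one_of_dvd_coprimes h4 h1 h3
      rw [Finset.mem_singleton]; exact orderOf_eq_one_iff.1 h5
    exact (Finset.card_le_card this).trans (by simp)
  · have hc : IsCyclic (ZMod (p ^ k))ˣ := ZMod.isCyclic_units_of_prime_pow p hp h2 k
    exact IsCyclic.card_pow_eq_one_le (by norm_num)

lemma card_unit_fiber {p k : ℕ} (hp : p.Prime) (hk : 1 ≤ k) (x : ℕ) (hx : ¬ p ∣ x) :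
    ((range (p ^ k)).filter (fun y => x ^ 3 ≡ y ^ 3 [MOD p ^ k])).card ≤ 3 := by
  have : NeZero (p ^ k) := ⟨pow_ne_zero _ hp.ne_zero⟩
  have hxc : Nat.Coprime x (p ^ k) :=
    Nat.Coprime.pow_right _ ((Nat.Prime.coprime_iff_not_dvd hp).2 hx).symm
  set u := ZMod.unitOfCoprime x hxc with hu
  refine le_trans ?_ (card_cube_roots hp hk)
  refine le_trans (Finset.card_le_card ?_) (Finset.card_image_le
    (f := fun t : (ZMod (p ^ k))ˣ => ((t * u : (ZMod (p ^ k))ˣ) : ZMod (p ^ k)).val))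
  intro y hy
  obtain ⟨hy1, hy2⟩ := Finset.mem_filter.1 hy
  have hy1 := Finset.mem_range.1 hy1
  have hyc : Nat.Coprime y (p ^ k) := by
    apply Nat.Coprime.pow_right
    refine ((Nat.Prime.coprime_iff_not_dvd hp).2 fun h => hx ?_).symm
    have h1 : p ∣ y ^ 3 := h.trans (dvd_pow_self _ (by norm_num))
    have h2 := hy2.of_dvd (dvd_pow_self p (by omega : k ≠ 0))
    exact hp.dvd_of_dvd_pow ((h2.dvd_iff (dvd_refl p)).2 h1)
  set v := ZMod.unitOfCoprime y hyc with hv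
  refine Finset.mem_image.2 ⟨v * u⁻¹, ?_, ?_⟩
  · rw [Finset.mem_filter]
    refine ⟨Finset.mem_univ _, ?_⟩
    have : u ^ 3 = v ^ 3 := by
      ext
      push_cast
      rw [hu, hv, ZMod.coe_unitOfCoprime, ZMod.coe_unitOfCoprime]
      have := (ZMod.natCast_eq_natCast_iff _ _ _).2 hy2
      push_cast at this
      exact this
    rw [mul_pow, ← this, ← mul_pow]; simp
  · simp only [inv_mul_cancel_right]
    rw [hv, ZMod.coe_unitOfCoprime, ZMod.val_natCast, Nat.mod_eq_of_lt hy1]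

lemma Zs_split {p k : ℕ} (hp : p.Prime) (hk : 1 ≤ k) :
    (Zs (p ^ k)).card ≤ 3 * p ^ k + ((Zs (p ^ k)).filter (fun x => p ∣ x.1 ∧ p ∣ x.2)).card := by
  rw [← Finset.card_filter_add_card_filter_not (fun x : ℕ × ℕ => p ∣ x.1 ∧ p ∣ x.2), add_comm]
  gcongr
  have : (Zs (p ^ k)).filter (fun x => ¬ (p ∣ x.1 ∧ p ∣ x.2)) ⊆
      ((range (p ^ k)).filter (fun x => ¬ p ∣ x)).biUnion fun x =>
        ((range (p ^ k)).filter (fun y => x ^ 3 ≡ y ^ 3 [MOD p ^ k])).image fun y => (x, y) := by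
    intro z hz
    obtain ⟨h1, h2⟩ := Finset.mem_filter.1 hz
    obtain ⟨⟨a1, a2⟩, a3⟩ := mem_Zs.1 h1
    rw [Finset.mem_biUnion]
    refine ⟨z.1, Finset.mem_filter.2 ⟨Finset.mem_range.2 a1, fun h => h2 ⟨h, ?_⟩⟩, ?_⟩
    · have h1 : p ∣ z.1 ^ 3 := h.trans (dvd_pow_self _ (by norm_num))
      have h2 := a3.of_dvd (dvd_pow_self p (by omega : k ≠ 0))
      exact hp.dvd_of_dvd_pow ((h2.dvd_iff (dvd_refl p)).1 h1)
    · exact Finset.mem_image.2 ⟨z.2, Finset.mem_filter.2 ⟨Finset.mem_range.2 a2, a3⟩, rfl⟩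
  refine (Finset.card_le_card this).trans (Finset.card_biUnion_le.trans ?_)
  calc _ ≤ ∑ x ∈ (range (p ^ k)).filter (fun x => ¬ p ∣ x), 3 := by
        refine Finset.sum_le_sum fun x hx => ?_
        exact Finset.card_image_le.trans (card_unit_fiber hp hk x (Finset.mem_filter.1 hx).2)
    _ = ((range (p ^ k)).filter (fun x => ¬ p ∣ x)).card * 3 := by simp
    _ ≤ (range (p^k)).card * 3 := by gcongr; exact Finset.filter_subset _ _
    _ = 3 * p ^ k := by rw [Finset.card_range, mul_comm]

lemma Zs_mult_small {p k : ℕ} (hp : p.Prime) (hk : 1 ≤ k) :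
    ((Zs (p ^ k)).filter (fun x => p ∣ x.1 ∧ p ∣ x.2)).card ≤ p ^ (2 * (k - 1)) := by
  have : p ^ (2 * (k - 1)) = (range (p ^ (k-1)) ×ˢ range (p ^ (k-1))).card := by
    rw [Finset.card_product, Finset.card_range]; ring
  rw [this]
  refine Finset.card_le_card_of_injOn (fun x => (x.1 / p, x.2 / p)) ?_ ?_
  · intro x hx
    obtain ⟨h1, h2⟩ := Finset.mem_filter.1 (Finset.mem_coe.1 hx)
    obtain ⟨⟨a1, a2⟩, a3⟩ := mem_Zs.1 h1
    have e : p ^ k = p * p ^ (k-1) := by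
      rw [← pow_succ', Nat.sub_add_cancel hk]
    rw [e] at a1 a2
    simp only [Finset.coe_product, Set.mem_prod, Finset.coe_range, Set.mem_Iio]
    exact ⟨Nat.div_lt_of_lt_mul a1, Nat.div_lt_of_lt_mul a2⟩
  · intro x hx y hy he
    obtain ⟨h1, h2⟩ := Finset.mem_filter.1 (Finset.mem_coe.1 hx)
    obtain ⟨h3, h4⟩ := Finset.mem_filter.1 (Finset.mem_coe.1 hy)
    simp only [Prod.mk.injEq] at he
    ext
    · exact (Nat.div_left_inj h2.1 h4.1).1 he.1
    · exact (Nat.div_left_inj h2.2 h4.2).1 he.2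

lemma Zs_mult_big {p k : ℕ} (hp : p.Prime) :
    ((Zs (p ^ (k + 3))).filter (fun x => p ∣ x.1 ∧ p ∣ x.2)).card ≤ (Zs (p ^ k)).card * p ^ 4 := by
  have hpos : 0 < p ^ k := pow_pos hp.pos _
  have : (Zs (p ^ k)).card * p ^ 4 = (Zs (p ^ k) ×ˢ (range (p ^ 2) ×ˢ range (p ^ 2))).card := by
    rw [Finset.card_product, Finset.card_product, Finset.card_range]; ring
  rw [this]
  refine Finset.card_le_card_of_injOn (fun x => ((x.1 / p % p ^ k, x.2 / p % p ^ k),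
    (x.1 / p / p ^ k, x.2 / p / p ^ k))) ?_ ?_
  · intro x hx
    obtain ⟨h1, h2, h3⟩ := Finset.mem_filter.1 (Finset.mem_coe.1 hx)
    obtain ⟨⟨a1, a2⟩, a3⟩ := mem_Zs.1 h1
    obtain ⟨x1, hx1⟩ := h2
    obtain ⟨x2, hx2⟩ := h3
    rw [hx1] at a1 a3
    rw [hx2] at a2 a3
    have e : p ^ (k + 3) = p * (p ^ k * p ^ 2) := by ring
    rw [e] at a1 a2
    have b1 := Nat.lt_of_mul_lt_mul_left a1
    have b2 := Nat.lt_of_mul_lt_mul_left a2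
    have b3 : x1 ^ 3 ≡ x2 ^ 3 [MOD p ^ k] := by
      rw [mul_pow, mul_pow, add_comm, pow_add] at a3
      exact Nat.ModEq.mul_left_cancel' (pow_ne_zero _ hp.ne_zero) a3
    simp only [Finset.coe_product, Set.mem_prod, Finset.coe_range, Set.mem_Iio, Finset.mem_coe,
      mem_Zs, hx1, hx2, Nat.mul_div_cancel_left _ hp.pos]
    refine ⟨⟨⟨Nat.mod_lt _ hpos, Nat.mod_lt _ hpos⟩, ?_⟩, Nat.div_lt_of_lt_mul b1,
      Nat.div_lt_of_lt_mul b2⟩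
    exact ((Nat.mod_modEq _ _).pow 3).trans (b3.trans ((Nat.mod_modEq _ _).symm.pow 3))
  · intro x hx y hy he
    obtain ⟨h1, h2⟩ := Finset.mem_filter.1 (Finset.mem_coe.1 hx)
    obtain ⟨h3, h4⟩ := Finset.mem_filter.1 (Finset.mem_coe.1 hy)
    simp only [Prod.mk.injEq] at he
    have key : ∀ a b : ℕ, p ∣ a → p ∣ b → a / p % p ^ k = b / p % p ^ k →
        a / p / p ^ k = b / p / p ^ k → a = b := by
      intro a b ha hb e1 e2
      apply (Nat.div_left_inj ha hb).1
      rw [← Nat.div_add_mod (a / p) (p ^ k), ← Nat.div_add_mod (b / p) (p ^ k), e1, e2]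
    ext
    · exact key _ _ h2.1 h4.1 he.1.1 he.2.1
    · exact key _ _ h2.2 h4.2 he.1.2 he.2.2

lemma Zs_prime_pow {p : ℕ} (hp : p.Prime) (c : ℝ) (hc : 1 ≤ c) (hcp : c ^ 3 = p) (k : ℕ) :
    ((Zs (p ^ k)).card : ℝ) ≤ (k + 3) * c ^ (4 * k) := by
  induction k using Nat.strong_induction_on with
  | _ k ih =>
    have hpw : ∀ j, (p:ℝ) ^ j = c ^ (3 * j) := by intro j; rw [← hcp, ← pow_mul]
    rcases Nat.lt_or_ge k 3 with h | h
    · have h34 : c ^ 3 ≤ c ^ 4 := pow_le_pow_right₀ hc (by norm_num)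
      have h04 : 1 ≤ c ^ 4 := one_le_pow₀ hc
      have h68 : c ^ 6 ≤ c ^ 8 := pow_le_pow_right₀ hc (by norm_num)
      interval_cases k
      · have : (Zs (p ^ 0)).card ≤ 1 := by
          refine (Finset.card_filter_le _ _).trans ?_; simp
        have : ((Zs (p ^ 0)).card : ℝ) ≤ 1 := by exact_mod_cast this
        simp at this ⊢; linarith
      · have := (Zs_split hp (le_refl 1)).trans (add_le_add_right (Zs_mult_small hp (le_refl 1)) _)
        have : ((Zs (p ^ 1)).card : ℝ) ≤ 3 * (p:ℝ) ^ 1 + (p:ℝ) ^ (2 * (1 - 1)) := by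
          exact_mod_cast this
        rw [hpw] at this
        norm_num at this ⊢
        linarith
      · have := (Zs_split hp (show 1 ≤ 2 by norm_num)).trans
          (add_le_add_right (Zs_mult_small hp (show 1 ≤ 2 by norm_num)) _)
        have : ((Zs (p ^ 2)).card : ℝ) ≤ 3 * (p:ℝ) ^ 2 + (p:ℝ) ^ (2 * (2 - 1)) := by
          exact_mod_cast this
        rw [hpw] at this
        norm_num at this ⊢
        linarith
    · obtain ⟨j, rfl⟩ : ∃ j, k = j + 3 := ⟨k - 3, by omega⟩
      have h1 := (Zs_split hp (show 1 ≤ j + 3 by omega)).trans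
        (add_le_add_right (Zs_mult_big (k := j) hp) _)
      have h1 : ((Zs (p ^ (j+3))).card : ℝ) ≤ 3 * (p:ℝ) ^ (j+3) + (Zs (p ^ j)).card * (p:ℝ) ^ 4 := by
        exact_mod_cast h1
      have h2 := ih j (by omega)
      have h3 : c ^ (3 * (j+3)) ≤ c ^ (4 * (j + 3)) := pow_le_pow_right₀ hc (by omega)
      rw [hpw, hpw] at h1
      calc _ ≤ 3 * c ^ (3 * (j + 3)) + ((j + 3) * c ^ (4 * j)) * c ^ (3 * 4) := h1.trans (by gcongr)
        _ ≤ 3 * c ^ (4 * (j + 3)) + ((j + 3) * c ^ (4 * j)) * c ^ (3 * 4) := by gcongr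
        _ = _ := by push_cast; ring

lemma Zs_le (q : ℕ) : 0 < q → ((Zs q).card : ℝ) ≤ dv q ^ 2 * (q:ℝ) ^ ((4:ℝ) / 3) := by
  induction q using Nat.recOnPosPrimePosCoprime with
  | prime_pow p n hp hn =>
    intro _
    set c : ℝ := (p:ℝ) ^ ((1:ℝ)/3) with hc
    have hp1 : (1:ℝ) ≤ p := by exact_mod_cast hp.one_le
    have hc1 : 1 ≤ c := Real.one_le_rpow hp1 (by norm_num)
    have hc3 : c ^ 3 = p := by
      rw [hc, ← Real.rpow_natCast, ← Real.rpow_mul (by positivity)]; norm_num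
    have h := Zs_prime_pow hp c hc1 hc3 n
    have e1 : dv (p ^ n) = n + 1 := by
      unfold dv; rw [Nat.divisors_prime_pow hp]; simp
    have e2 : ((p ^ n : ℕ) : ℝ) ^ ((4:ℝ)/3) = c ^ (4 * n) := by
      push_cast
      rw [← hc3, ← pow_mul, ← Real.rpow_natCast, ← Real.rpow_mul (by positivity),
        ← Real.rpow_natCast]
      congr 1; push_cast; ring
    rw [e1, e2]
    refine h.trans ?_
    gcongr
    have : (1:ℝ) ≤ n := by exact_mod_cast hn
    nlinarith
  | zero => intro h; omega
  | one =>
    intro _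
    have : (Zs 1).card ≤ 1 := by
      refine (Finset.card_filter_le _ _).trans ?_; simp
    have : ((Zs 1).card : ℝ) ≤ 1 := by exact_mod_cast this
    simpa [dv] using this
  | coprime a b ha hb hab iha ihb =>
    intro _
    have h1 := Zs_mul_le (by omega : 0 < a) (by omega : 0 < b) hab
    have h1 : ((Zs (a * b)).card : ℝ) ≤ (Zs a).card * (Zs b).card := by exact_mod_cast h1
    have e1 : dv (a * b) = dv a * dv b := by
      unfold dv; rw [hab.card_divisors_mul]; push_cast; rfl
    have iha := iha (by omega)
    have ihb := ihb (by omega)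
    rw [e1]
    push_cast
    rw [Real.mul_rpow (by positivity) (by positivity)]
    calc _ ≤ (dv a ^ 2 * (a:ℝ) ^ ((4:ℝ) / 3)) * (dv b ^ 2 * (b:ℝ) ^ ((4:ℝ) / 3)) := h1.trans (by gcongr)
      _ = _ := by ring

lemma sum_fiber_le {ι κ : Type*} (s : Finset ι) (t : Finset κ) (g : ι → κ)
    (f : κ → ℝ) (D : ℝ) (hg : ∀ x ∈ s, g x ∈ t) (hf : ∀ u ∈ t, 0 ≤ f u)
    (hD : ∀ u ∈ t, (((s.filter (fun x => g x = u)).card : ℕ) : ℝ) ≤ D) :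
    ∑ x ∈ s, f (g x) ≤ D * ∑ u ∈ t, f u := by
  rw [← Finset.sum_fiberwise_of_maps_to hg, Finset.mul_sum]
  refine Finset.sum_le_sum fun u hu => ?_
  calc _ = ∑ x ∈ s.filter (fun x => g x = u), f u :=
        Finset.sum_congr rfl fun x hx => by rw [(Finset.mem_filter.1 hx).2]
    _ = ((s.filter (fun x => g x = u)).card : ℕ) * f u := by simp
    _ ≤ _ := mul_le_mul_of_nonneg_right (hD u hu) (hf u hu)

lemma W_sq (q : ℕ) (hq : 1 ≤ q) (a : ℤ) (haq : IsCoprime a (q:ℤ))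
    (α : ℝ) (hα : |α - a / q| ≤ 1 / q ^ 2) (b c : ℝ) (L : ℕ) :
    ‖∑ n ∈ range L, eu (α * n ^ 2 + b * n + c)‖ ^ 2 ≤
      L + 2 * (((2 * L : ℕ) : ℝ) / q + 1) * (6 * L + 16 * q * (1 + Real.log q)) := by
  refine (weyl_sq α b c L).trans ?_
  have h1 : ∑ h ∈ range L, mn L (2 * (h + 1) * α) ≤
      1 * ∑ u ∈ range (2 * L), mn L (((u:ℝ) + 1) * α) := by
    have := sum_fiber_le (range L) (range (2 * L)) (fun h => 2 * h + 1)
      (fun u => mn L (((u:ℝ) + 1) * α)) 1 ?_ (fun u _ => mn_nonneg (by positivity) _) ?_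
    · refine le_trans (le_of_eq ?_) this
      refine Finset.sum_congr rfl fun h _ => ?_
      congr 1; push_cast; ring
    · intro x hx; simp at hx ⊢; omega
    · intro u _
      refine Nat.cast_le_one.2 (Finset.card_le_one.2 ?_)
      intro x hx y hy
      simp at hx hy; omega
  have := sum_mn_le (L:ℝ) (by positivity) q hq a haq α hα (2 * L)
  nlinarith

lemma W_cube (q : ℕ) (hq : 1 ≤ q) (a : ℤ) (haq : IsCoprime a (q:ℤ))
    (α : ℝ) (hα : |α - a / q| ≤ 1 / q ^ 2) (b c d : ℝ) (L : ℕ) (D : ℝ) (hD0 : 0 ≤ D)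
    (hD : ∀ u : ℕ, u ≠ 0 → u ≤ 6 * L ^ 2 → dv u ≤ D) :
    ‖∑ n ∈ range L, eu (α * n ^ 3 + b * n ^ 2 + c * n + d)‖ ^ 4 ≤
      10 * L ^ 3 + 16 * L * (D *
        ((((6 * L ^ 2 : ℕ) : ℝ) / q + 1) * (6 * L + 16 * q * (1 + Real.log q)))) := by
  refine (weyl_cube α b c d L).trans ?_
  have h1 : ∑ h ∈ range L, ∑ k ∈ range L, mn L (6 * (h + 1) * (k + 1) * α) ≤
      D * ∑ u ∈ range (6 * L ^ 2), mn L (((u:ℝ) + 1) * α) := by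
    rw [← Finset.sum_product (s := range L) (t := range L)
      (f := fun x : ℕ × ℕ => mn L (6 * (x.1 + 1) * (x.2 + 1) * α))]
    have hlt : ∀ x ∈ range L ×ˢ range L, 6 * (x.1 + 1) * (x.2 + 1) - 1 ∈ range (6 * L ^ 2) := by
      intro x hx
      simp only [Finset.mem_product, Finset.mem_range] at hx ⊢
      have : (x.1 + 1) * (x.2 + 1) ≤ L * L := Nat.mul_le_mul hx.1 hx.2
      have h3 : 0 < (x.1 + 1) * (x.2 + 1) := by positivity
      rw [pow_two, mul_assoc]; omega
    have := sum_fiber_le (range L ×ˢ range L) (range (6 * L ^ 2))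
      (fun x => 6 * (x.1 + 1) * (x.2 + 1) - 1)
      (fun u => mn L (((u:ℝ) + 1) * α)) D hlt (fun u _ => mn_nonneg (by positivity) _) ?_
    · refine le_trans (le_of_eq ?_) this
      refine Finset.sum_congr rfl fun x _ => ?_
      have h3 : 1 ≤ 6 * (x.1 + 1) * (x.2 + 1) := by
        have : 0 < 6 * (x.1 + 1) * (x.2 + 1) := by positivity
        omega
      rw [Nat.cast_sub h3]
      congr 1; push_cast; ring
    · intro u hu
      refine le_trans ?_ (hD (u + 1) (by omega) (by simp at hu; omega))
      unfold dv
      rw [Nat.cast_le]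
      refine Finset.card_le_card_of_injOn (fun x => x.1 + 1) ?_ ?_
      · intro x hx
        simp only [Finset.coe_filter, Set.mem_ofPred_eq, Finset.mem_coe, Nat.mem_divisors] at hx ⊢
        refine ⟨⟨6 * (x.2 + 1), ?_⟩, by omega⟩
        have h3 : 0 < 6 * (x.1 + 1) * (x.2 + 1) := by positivity
        have : (x.1 + 1) * (6 * (x.2 + 1)) = 6 * (x.1 + 1) * (x.2 + 1) := by ring
        omega
      · intro x hx y hy hxy
        simp only [Finset.coe_filter, Set.mem_ofPred_eq] at hx hy hxy
        have e1 : x.1 = y.1 := by omega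
        have h3 : 0 < 6 * (x.1 + 1) * (x.2 + 1) := by positivity
        have h4 : 0 < 6 * (y.1 + 1) * (y.2 + 1) := by positivity
        have : 6 * (x.1 + 1) * (x.2 + 1) = 6 * (x.1 + 1) * (y.2 + 1) := by
          have e2 : 6 * (x.1 + 1) * (y.2 + 1) = 6 * (y.1 + 1) * (y.2 + 1) := by rw [e1]
          omega
        have := Nat.eq_of_mul_eq_mul_left (by positivity) this
        exact Prod.ext e1 (by omega)
  have h2 := sum_mn_le (L:ℝ) (by positivity) q hq a haq α hα (6 * L ^ 2)
  have h3 := mul_le_mul_of_nonneg_left h2 hD0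
  have h4 := mul_le_mul_of_nonneg_left (h1.trans h3) (show (0:ℝ) ≤ 16 * L by positivity)
  linarith

lemma orth (q : ℕ) (hq : 0 < q) (t : ℤ) :
    ∑ a ∈ range q, eu (a * (t / q)) = if (q:ℤ) ∣ t then (q:ℂ) else 0 := by
  have hqR : (q:ℝ) ≠ 0 := by positivity
  simp_rw [eu_nat_mul]
  split_ifs with h
  · obtain ⟨k, rfl⟩ := h
    have : (((q:ℤ) * k : ℤ) : ℝ) / q = (k:ℤ) := by push_cast; field_simp
    rw [this, eu_int]; simp
  · have h1 : eu (t / q) ≠ 1 := by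
      rw [Ne, eu_eq_one_iff]
      rintro ⟨n, hn⟩
      rw [div_eq_iff hqR] at hn
      exact h ⟨n, by rw [mul_comm]; exact_mod_cast hn⟩
    rw [geom_sum_eq h1]
    have : eu (t / q) ^ q = 1 := by
      rw [← eu_nat_mul, mul_div_cancel₀ _ hqR, eu_int]
    rw [this]; simp

lemma mean_sq (q : ℕ) (hq : 0 < q) (h : ℕ → ℝ) (H : ℝ) (hH : ∀ n, |h n| ≤ H) :
    ∑ a ∈ range q, ‖∑ m ∈ range q, eu ((a:ℝ) * m ^ 3 / q) * (h m : ℂ)‖ ^ 2 ≤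
      q * (H ^ 2 * (Zs q).card) := by
  have hH0 : 0 ≤ H := (abs_nonneg _).trans (hH 0)
  have key : ((∑ a ∈ range q, ‖∑ m ∈ range q, eu ((a:ℝ) * m ^ 3 / q) * (h m : ℂ)‖ ^ 2 : ℝ) : ℂ) =
      ∑ x ∈ Zs q, (q:ℂ) * ((h x.1 * h x.2 : ℝ) : ℂ) := by
    have e1 : ∀ a : ℕ, ((‖∑ m ∈ range q, eu ((a:ℝ) * m ^ 3 / q) * (h m : ℂ)‖ ^ 2 : ℝ) : ℂ) =
        ∑ x ∈ range q ×ˢ range q, ((h x.1 * h x.2 : ℝ) : ℂ) *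
          eu (a * ((((x.1:ℤ) ^ 3 - (x.2:ℤ) ^ 3 : ℤ) : ℝ) / q)) := by
      intro a
      rw [Complex.ofReal_pow, ← Complex.mul_conj', map_sum, Finset.sum_mul_sum, Finset.sum_product]
      refine Finset.sum_congr rfl fun x _ => Finset.sum_congr rfl fun y _ => ?_
      have : (a:ℝ) * ((((x:ℤ) ^ 3 - (y:ℤ) ^ 3 : ℤ) : ℝ) / q) =
        (a:ℝ) * x ^ 3 / q - (a:ℝ) * y ^ 3 / q := by push_cast; ring
      rw [this, eu_sub, map_mul, Complex.conj_ofReal]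
      push_cast; ring
    rw [Complex.ofReal_sum]
    simp_rw [e1]
    rw [Finset.sum_comm]
    simp_rw [← Finset.mul_sum, orth q hq]
    rw [Zs, Finset.mul_sum, Finset.sum_filter (s := range q ×ˢ range q) (p := fun x : ℕ × ℕ => x.1 ^ 3 ≡ x.2 ^ 3 [MOD q])
      (f := fun x : ℕ × ℕ => (q:ℂ) * ((h x.1 * h x.2 : ℝ) : ℂ))]
    refine Finset.sum_congr rfl fun x _ => ?_
    have : (q:ℤ) ∣ (x.1:ℤ) ^ 3 - (x.2:ℤ) ^ 3 ↔ x.1 ^ 3 ≡ x.2 ^ 3 [MOD q] := by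
      rw [Nat.ModEq.comm, Nat.modEq_iff_dvd]; push_cast; rfl
    simp only [this]
    split_ifs
    · ring
    · simp
  have key2 : ∑ a ∈ range q, ‖∑ m ∈ range q, eu ((a:ℝ) * m ^ 3 / q) * (h m : ℂ)‖ ^ 2 =
      ∑ x ∈ Zs q, (q:ℝ) * (h x.1 * h x.2) := by exact_mod_cast key
  rw [key2, ← Finset.mul_sum]
  gcongr
  calc _ ≤ ∑ x ∈ Zs q, H ^ 2 := Finset.sum_le_sum fun x _ => by
        have h1 := hH x.1
        have h2 := hH x.2
        calc _ ≤ |h x.1 * h x.2| := le_abs_self _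
          _ = |h x.1| * |h x.2| := abs_mul _ _
          _ ≤ H * H := by gcongr
          _ = _ := by ring
    _ = _ := by simp [mul_comm]

def psi (k q a : ℕ) (m : ℕ) : ℂ := eu ((a:ℝ) * m ^ k / q)

lemma norm_psi (k q a m : ℕ) : ‖psi k q a m‖ = 1 := norm_eu _

lemma psi_periodic (k : ℕ) {q : ℕ} (hq : 0 < q) (a : ℕ) : Function.Periodic (psi k q a) q := by
  intro m
  have hqR : (q:ℝ) ≠ 0 := by positivity
  unfold psi
  have hd : (q:ℤ) ∣ ((m + q : ℕ) : ℤ) ^ k - (m:ℤ) ^ k := by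
    refine dvd_trans ?_ (sub_dvd_pow_sub_pow _ _ k)
    exact ⟨1, by push_cast; ring⟩
  obtain ⟨c, hc⟩ := hd
  have hc' : ((m + q : ℕ) : ℝ) ^ k = (m:ℝ) ^ k + q * c := by
    have : (((m + q : ℕ) : ℤ) : ℝ) ^ k - ((m:ℤ):ℝ) ^ k = (q:ℤ) * c := by exact_mod_cast hc
    push_cast at this ⊢
    linarith
  rw [hc']
  have : (a:ℝ) * ((m:ℝ) ^ k + q * c) / q = (a:ℝ) * m ^ k / q + ((a * c : ℤ) : ℝ) := by
    push_cast; field_simp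
  rw [this, eu_add_int]

lemma cast_log_nonneg (q : ℕ) : 0 ≤ Real.log q := Real.log_natCast_nonneg q

lemma one_le_dv {q : ℕ} (hq : 0 < q) : 1 ≤ dv q := by
  unfold dv
  exact_mod_cast Finset.card_pos.2 ⟨1, by simp; omega⟩

lemma E2_le {R q a : ℕ} (hR : 1 ≤ R) (hq : 0 < q) (ha : Nat.Coprime a q) :
    ‖EE R q (psi 2 q a)‖ ^ 2 ≤ 133 * (dv q ^ 4 * (1 + Real.log q) / q) := by
  have hqR : (0:ℝ) < q := by exact_mod_cast hq
  have hlog := cast_log_nonneg q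
  have hc : IsCoprime ((a:ℤ)) (q:ℤ) := Nat.isCoprime_iff_coprime.2 ha
  have hB : ∀ θ : ℝ, ‖∑ m ∈ range q, psi 2 q a m * eu (θ * m)‖ ≤
      Real.sqrt (133 * q * (1 + Real.log q)) := by
    intro θ
    apply Real.le_sqrt_of_sq_le
    have := W_sq q hq a hc ((a:ℝ)/q) (by simp) θ 0 q
    have e : ∀ m : ℕ, psi 2 q a m * eu (θ * m) = eu ((a:ℝ)/q * m ^ 2 + θ * m + 0) := by
      intro m; rw [psi, ← eu_add]; congr 1; ring
    simp_rw [e]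
    refine this.trans ?_
    have : ((2 * q : ℕ):ℝ) / q = 2 := by push_cast; field_simp
    rw [this]
    nlinarith
  have h1 := EE_sup hR hq (psi 2 q a) _ hB
  calc _ ≤ (dv q ^ 2 * (Real.sqrt (133 * q * (1 + Real.log q)) / q)) ^ 2 := by gcongr
    _ = dv q ^ 4 * (Real.sqrt (133 * q * (1 + Real.log q)) ^ 2 / q ^ 2) := by ring
    _ = _ := by
      rw [Real.sq_sqrt (by positivity)]; field_simp

lemma E3_le {R q a : ℕ} (hR : 1 ≤ R) (hq : 0 < q) (ha : Nat.Coprime a q) (D : ℝ)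
    (hD : ∀ u : ℕ, u ≠ 0 → u ≤ 6 * q ^ 2 → dv u ≤ D) :
    ‖EE R q (psi 3 q a)‖ ^ 4 ≤ dv q ^ 8 * (2500 * D * (1 + Real.log q) / q) := by
  have hqR : (1:ℝ) ≤ q := by exact_mod_cast hq
  have hlog := cast_log_nonneg q
  have hD1 : 1 ≤ D := (one_le_dv (q := 1) one_pos).trans
    (hD 1 (by omega) (by have : 0 < q ^ 2 := by positivity
                         omega))
  have hc : IsCoprime ((a:ℤ)) (q:ℤ) := Nat.isCoprime_iff_coprime.2 ha
  set B := (2500 * D * (1 + Real.log q) * (q:ℝ) ^ 3) with hBdef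
  have hB0 : 0 ≤ B := by positivity
  have hB : ∀ θ : ℝ, ‖∑ m ∈ range q, psi 3 q a m * eu (θ * m)‖ ≤ Real.sqrt (Real.sqrt B) := by
    intro θ
    apply Real.le_sqrt_of_sq_le
    apply Real.le_sqrt_of_sq_le
    rw [← pow_mul]
    have := W_cube q hq a hc ((a:ℝ)/q) (by simp) 0 θ 0 q D (by linarith) hD
    have e : ∀ m : ℕ, psi 3 q a m * eu (θ * m) =
        eu ((a:ℝ)/q * m ^ 3 + 0 * m ^ 2 + θ * m + 0) := by
      intro m; rw [psi, ← eu_add]; congr 1; ring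
    simp_rw [e]
    refine this.trans ?_
    have e2 : ((6 * q ^ 2 : ℕ):ℝ) / q = 6 * q := by push_cast; field_simp
    rw [e2, hBdef]
    have i1 : (6 * (q:ℝ) + 1) ≤ 7 * q := by linarith
    have i2 : 6 * (q:ℝ) + 16 * q * (1 + Real.log q) ≤ 22 * q * (1 + Real.log q) := by nlinarith
    have i3 : 1 ≤ D * (1 + Real.log q) := by nlinarith
    calc _ ≤ 10 * (q:ℝ) ^ 3 * (D * (1 + Real.log q)) +
          16 * q * (D * ((7 * q) * (22 * q * (1 + Real.log q)))) := by
          refine add_le_add (le_mul_of_one_le_right (by positivity) i3) ?_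
          gcongr
      _ = 2474 * ((q:ℝ) ^ 3 * (D * (1 + Real.log q))) := by ring
      _ ≤ 2500 * ((q:ℝ) ^ 3 * (D * (1 + Real.log q))) := by
          gcongr; norm_num
      _ = _ := by ring
  have h1 := EE_sup hR hq (psi 3 q a) _ hB
  calc _ ≤ (dv q ^ 2 * (Real.sqrt (Real.sqrt B) / q)) ^ 4 := by gcongr
    _ = dv q ^ 8 * (((Real.sqrt (Real.sqrt B)) ^ 2) ^ 2 / q ^ 4) := by ring
    _ = _ := by
      rw [Real.sq_sqrt (by positivity), Real.sq_sqrt hB0, hBdef]; field_simp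

lemma E3_mean {R q : ℕ} (hR : 1 ≤ R) (hq : 0 < q) :
    ∑ a ∈ range q, ‖EE R q (psi 3 q a)‖ ^ 2 ≤ dv q ^ 6 * (q:ℝ) ^ ((1:ℝ)/3) := by
  have hqR : (0:ℝ) < q := by exact_mod_cast hq
  have h1 : ∀ a, ‖EE R q (psi 3 q a)‖ ^ 2 ≤ dv q ^ 2 *
      ∑ y ∈ sdv q ×ˢ sdv q, (‖Tq q (psi 3 q a) y.1 y.2‖ / (y.1 * y.2)) ^ 2 := by
    intro a
    calc _ ≤ (∑ y ∈ sdv q ×ˢ sdv q, ‖Tq q (psi 3 q a) y.1 y.2‖ / (y.1 * y.2)) ^ 2 := by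
          gcongr; exact EE_le hR hq _
      _ ≤ ((sdv q ×ˢ sdv q).card : ℝ) * _ := sq_sum_le_card_mul_sum_sq
      _ ≤ _ := by
          gcongr
          rw [Finset.card_product, sq, Nat.cast_mul]
          have := card_sdv_le q
          have := dv_nonneg q
          gcongr
  have h2 : ∀ y ∈ sdv q ×ˢ sdv q,
      ∑ a ∈ range q, (‖Tq q (psi 3 q a) y.1 y.2‖ / (y.1 * y.2)) ^ 2 ≤ (Zs q).card / q := by
    intro y hy
    have := Finset.mem_product.1 hy
    have hd := (Finset.mem_filter.1 this.1).2
    have he := (Finset.mem_filter.1 this.2).2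
    have p1 : (0:ℝ) < y.1 := by exact_mod_cast Nat.pos_of_ne_zero hd.ne_zero
    have p2 : (0:ℝ) < y.2 := by exact_mod_cast Nat.pos_of_ne_zero he.ne_zero
    have := mean_sq q hq (fun m => cr y.1 m * cr y.2 m) (y.1 * y.2) (by
      intro n; rw [abs_mul]
      have h1 := abs_cr_le hd n
      have h2 := abs_cr_le he n
      gcongr)
    have e : ∀ a : ℕ, (‖Tq q (psi 3 q a) y.1 y.2‖ / ((y.1:ℝ) * y.2)) ^ 2 =
       (1 / (q * (y.1 * y.2) : ℝ) ^ 2) *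
        ‖∑ m ∈ range q, eu ((a:ℝ) * m ^ 3 / q) * ((cr y.1 m * cr y.2 m : ℝ) : ℂ)‖ ^ 2 := by
      intro a
      unfold Tq psi
      rw [norm_div, Complex.norm_natCast]; field_simp
    simp_rw [e, ← Finset.mul_sum]
    calc _ ≤ (1 / (q * (y.1 * y.2) : ℝ) ^ 2) * (q * (((y.1:ℝ) * y.2) ^ 2 * (Zs q).card)) := by
          gcongr
      _ = _ := by field_simp
  calc _ ≤ ∑ a ∈ range q, dv q ^ 2 *
      ∑ y ∈ sdv q ×ˢ sdv q, (‖Tq q (psi 3 q a) y.1 y.2‖ / (y.1 * y.2)) ^ 2 :=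
        Finset.sum_le_sum fun a _ => h1 a
    _ = dv q ^ 2 * ∑ y ∈ sdv q ×ˢ sdv q, ∑ a ∈ range q,
        (‖Tq q (psi 3 q a) y.1 y.2‖ / (y.1 * y.2)) ^ 2 := by
        rw [← Finset.mul_sum, Finset.sum_comm]
    _ ≤ dv q ^ 2 * ∑ y ∈ sdv q ×ˢ sdv q, ((Zs q).card / q : ℝ) := by
        gcongr with y hy
        exact h2 y hy
    _ = dv q ^ 2 * (((sdv q).card * (sdv q).card) * ((Zs q).card / q : ℝ)) := by simp
    _ ≤ dv q ^ 2 * ((dv q * dv q) * ((dv q ^ 2 * (q:ℝ) ^ ((4:ℝ)/3)) / q : ℝ)) := by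
        have := card_sdv_le q
        have := dv_nonneg q
        have := Zs_le q hq
        gcongr
    _ = dv q ^ 6 * ((q:ℝ) ^ ((4:ℝ)/3) / q) := by ring
    _ = _ := by
        congr 1
        rw [← Real.rpow_sub_one hqR.ne']; norm_num

lemma E3_four {R q : ℕ} (hR : 1 ≤ R) (hq : 0 < q) (D : ℝ)
    (hD : ∀ u : ℕ, u ≠ 0 → u ≤ 6 * q ^ 2 → dv u ≤ D) :
    ∑ a ∈ (range q).filter (fun a => Nat.Coprime a q), ‖EE R q (psi 3 q a)‖ ^ 4 ≤
      50 * dv q ^ 10 * Real.sqrt (D * (1 + Real.log q)) * (q:ℝ) ^ (-(1:ℝ)/6) := by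
  have hqR : (0:ℝ) < q := by exact_mod_cast hq
  have hlog := cast_log_nonneg q
  have hD1 : 1 ≤ D := (one_le_dv (q := 1) one_pos).trans
    (hD 1 (by omega) (by have : 0 < q ^ 2 := by positivity
                         omega))
  have hdv := dv_nonneg q
  have h1 : ∀ a ∈ (range q).filter (fun a => Nat.Coprime a q), ‖EE R q (psi 3 q a)‖ ^ 4 ≤
      (dv q ^ 4 * (50 * Real.sqrt (D * (1 + Real.log q)) * (q:ℝ) ^ (-(1:ℝ)/2))) *
        ‖EE R q (psi 3 q a)‖ ^ 2 := by
    intro a ha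
    have := E3_le hR hq (Finset.mem_filter.1 ha).2 D hD
    have h2 : ‖EE R q (psi 3 q a)‖ ^ 2 ≤
        (dv q ^ 4 * (50 * Real.sqrt (D * (1 + Real.log q)) * (q:ℝ) ^ (-(1:ℝ)/2))) := by
      refine le_of_sq_le_sq ?_ (by positivity)
      rw [← pow_mul]
      refine this.trans (le_of_eq ?_)
      have e1 : ((q:ℝ) ^ (-(1:ℝ)/2)) ^ 2 = 1 / q := by
        rw [← Real.rpow_natCast, ← Real.rpow_mul hqR.le]; norm_num [Real.rpow_neg_one]
      rw [mul_pow, mul_pow, mul_pow, Real.sq_sqrt (by positivity), e1]; ring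
    calc _ = ‖EE R q (psi 3 q a)‖ ^ 2 * ‖EE R q (psi 3 q a)‖ ^ 2 := by ring
      _ ≤ _ := by gcongr
  calc _ ≤ _ := Finset.sum_le_sum h1
    _ ≤ (dv q ^ 4 * (50 * Real.sqrt (D * (1 + Real.log q)) * (q:ℝ) ^ (-(1:ℝ)/2))) *
        ∑ a ∈ range q, ‖EE R q (psi 3 q a)‖ ^ 2 := by
        rw [← Finset.mul_sum]
        gcongr
        exact Finset.filter_subset _ _
    _ ≤ (dv q ^ 4 * (50 * Real.sqrt (D * (1 + Real.log q)) * (q:ℝ) ^ (-(1:ℝ)/2))) *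
        (dv q ^ 6 * (q:ℝ) ^ ((1:ℝ)/3)) := by
        gcongr; exact E3_mean hR hq
    _ = 50 * dv q ^ 10 * Real.sqrt (D * (1 + Real.log q)) *
        ((q:ℝ) ^ (-(1:ℝ)/2) * (q:ℝ) ^ ((1:ℝ)/3)) := by ring
    _ = _ := by rw [← Real.rpow_add hqR]; norm_num

/-- size of the square of the quadratic local factor -/
def sig (q : ℕ) : ℝ := dv q ^ 4 * (1 + Real.log q) / q

lemma sig_nonneg (q : ℕ) : 0 ≤ sig q := by
  have := cast_log_nonneg q
  have := dv_nonneg q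
  unfold sig; positivity

lemma sing_series : ∃ C : ℝ, 0 < C ∧ ∀ R q : ℕ, 1 ≤ R → 0 < q → sig q *
    ∑ a ∈ (range q).filter (fun a => Nat.Coprime a q), ‖EE R q (psi 3 q a)‖ ^ 4 ≤
      C * (q:ℝ) ^ (-(13:ℝ)/12) := by
  obtain ⟨C, hC, h⟩ := divisor_bound (1/300) (by norm_num)
  refine ⟨C ^ 4 * 300 * (50 * C ^ 10 * (6 * C * 300)), by positivity, fun R q hR hq => ?_⟩
  have hqR : (1:ℝ) ≤ q := by exact_mod_cast hq
  have hq0 : (0:ℝ) < q := by linarith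
  have hlog := cast_log_nonneg q
  set y := (q:ℝ) ^ ((1:ℝ)/300) with hy
  have hy1 : 1 ≤ y := Real.one_le_rpow hqR (by norm_num)
  have hd : dv q ≤ C * y := h q hq.ne'
  have hl : 1 + Real.log q ≤ 300 * y := by
    have : Real.log y = 1/300 * Real.log q := Real.log_rpow hq0 _
    have h2 := Real.add_one_le_exp (Real.log y)
    rw [Real.exp_log (by linarith)] at h2
    nlinarith
  have hDD : ∀ u : ℕ, u ≠ 0 → u ≤ 6 * q ^ 2 → dv u ≤ 6 * C * y ^ 2 := by
    intro u hu huq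
    calc dv u ≤ C * (u:ℝ) ^ ((1:ℝ)/300) := h u hu
      _ ≤ C * (6 * (q:ℝ) ^ 2) ^ ((1:ℝ)/300) := by
          have : (u:ℝ) ≤ 6 * (q:ℝ) ^ 2 := by exact_mod_cast huq
          gcongr
      _ = C * ((6:ℝ) ^ ((1:ℝ)/300) * y ^ 2) := by
          rw [Real.mul_rpow (by norm_num) (by positivity), hy, ← Real.rpow_natCast,
            ← Real.rpow_natCast, ← Real.rpow_mul hq0.le, ← Real.rpow_mul hq0.le, mul_comm (((2:ℕ)):ℝ)]
      _ ≤ C * (6 * y ^ 2) := by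
          gcongr
          calc (6:ℝ) ^ ((1:ℝ)/300) ≤ (6:ℝ) ^ (1:ℝ) :=
                Real.rpow_le_rpow_of_exponent_le (by norm_num) (by norm_num)
            _ = 6 := Real.rpow_one _
      _ = _ := by ring
  have h4 := E3_four hR hq _ hDD
  have hs : Real.sqrt (6 * C * y ^ 2 * (1 + Real.log q)) ≤ 6 * C * 300 * y ^ 3 := by
    have h1 : (1:ℝ) ≤ 6 * C * 300 * y ^ 3 := by
      have : (1:ℝ) ≤ y ^ 3 := one_le_pow₀ hy1
      nlinarith
    have h2 : 6 * C * y ^ 2 * (1 + Real.log q) ≤ 6 * C * 300 * y ^ 3 := by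
      calc _ ≤ 6 * C * y ^ 2 * (300 * y) := by gcongr
        _ = _ := by ring
    rw [Real.sqrt_le_left (by positivity)]
    nlinarith
  have hdv := dv_nonneg q
  calc _ ≤ ((C * y) ^ 4 * (300 * y) / q) *
        (50 * (C * y) ^ 10 * (6 * C * 300 * y ^ 3) * (q:ℝ) ^ (-(1:ℝ)/6)) := by
        refine mul_le_mul ?_ (h4.trans ?_) (Finset.sum_nonneg fun _ _ => by positivity) (by positivity)
        · unfold sig; gcongr
        · gcongr
    _ = C ^ 4 * 300 * (50 * C ^ 10 * (6 * C * 300)) *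
          (y ^ 18 * ((q:ℝ)⁻¹ * (q:ℝ) ^ (-(1:ℝ)/6))) := by ring
    _ ≤ C ^ 4 * 300 * (50 * C ^ 10 * (6 * C * 300)) *
          (y ^ 25 * ((q:ℝ)⁻¹ * (q:ℝ) ^ (-(1:ℝ)/6))) := by
        gcongr
        norm_num
    _ = _ := by
        congr 1
        rw [hy, ← Real.rpow_natCast, ← Real.rpow_mul hq0.le, ← Real.rpow_neg_one, ← Real.rpow_add hq0,
          ← Real.rpow_add hq0]
        norm_num

lemma sing_sum : ∃ C : ℝ, 0 < C ∧ ∀ R Q : ℕ, 1 ≤ R → ∑ q ∈ Finset.Icc 1 Q, (sig q *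
    ∑ a ∈ (range q).filter (fun a => Nat.Coprime a q), ‖EE R q (psi 3 q a)‖ ^ 4) ≤ C := by
  obtain ⟨C, hC, h⟩ := sing_series
  have hs : Summable (fun n : ℕ => (n:ℝ) ^ (-(13:ℝ)/12)) := Real.summable_nat_rpow.2 (by norm_num)
  refine ⟨C * ∑' n : ℕ, (n:ℝ) ^ (-(13:ℝ)/12) + 1, ?_, fun R Q hR => ?_⟩
  · have : 0 ≤ ∑' n : ℕ, (n:ℝ) ^ (-(13:ℝ)/12) := tsum_nonneg fun _ => by positivity
    positivity
  · calc _ ≤ ∑ q ∈ Finset.Icc 1 Q, C * (q:ℝ) ^ (-(13:ℝ)/12) :=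
          Finset.sum_le_sum fun q hq => h R q hR (Finset.mem_Icc.1 hq).1
      _ = C * ∑ q ∈ Finset.Icc 1 Q, (q:ℝ) ^ (-(13:ℝ)/12) := by rw [Finset.mul_sum]
      _ ≤ C * ∑' n : ℕ, (n:ℝ) ^ (-(13:ℝ)/12) := by
          gcongr
          exact hs.sum_le_tsum _ fun _ _ => by positivity
      _ ≤ _ := by linarith

/-- Dirichlet-type kernel -/
def DK (M : ℕ) (θ : ℝ) : ℂ := ∑ l ∈ range M, eu (l * θ)

lemma DK_low (M : ℕ) (hM : 0 < M) (θ : ℝ) (h : dn θ ≤ 1 / (16 * M)) :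
    1 ≤ 4 / (M:ℝ) ^ 2 * ‖DK M θ‖ ^ 2 := by
  have hMR : (0:ℝ) < M := by exact_mod_cast hM
  set t := θ - round θ with ht
  have e : DK M θ = ∑ l ∈ range M, eu (l * t) := by
    unfold DK
    refine Finset.sum_congr rfl fun l _ => ?_
    have : (l:ℝ) * θ = l * t + ((l * round θ : ℤ) : ℝ) := by rw [ht]; push_cast; ring
    rw [this, eu_add_int]
  have h1 : ‖DK M θ - M‖ ≤ M / 2 := by
    have e2 : DK M θ - M = ∑ l ∈ range M, (eu (l * t) - 1) := by
      rw [Finset.sum_sub_distrib, e]; simp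
    rw [e2]
    calc _ ≤ ∑ l ∈ range M, ‖eu (l * t) - 1‖ := norm_sum_le _ _
      _ ≤ ∑ l ∈ range M, (1 / 2 : ℝ) := by
          refine Finset.sum_le_sum fun l hl => (eu_sub_one_le _).trans ?_
          have hl : (l:ℝ) ≤ M := by exact_mod_cast (Finset.mem_range.1 hl).le
          rw [abs_mul, Nat.abs_cast]
          have h2 : |t| ≤ 1 / (16 * M) := h
          have h3 : (l:ℝ) * |t| ≤ M * (1 / (16 * M)) := by gcongr
          have h4 : (M:ℝ) * (1 / (16 * M)) = 1 / 16 := by field_simp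
          have := Real.pi_lt_four
          have := Real.pi_pos
          nlinarith
      _ = _ := by simp; ring
  have h2 : (M:ℝ) / 2 ≤ ‖DK M θ‖ := by
    have := norm_sub_norm_le (M:ℂ) (DK M θ)
    rw [norm_sub_rev, Complex.norm_natCast] at this
    linarith
  have h3 : ((M:ℝ) / 2) ^ 2 ≤ ‖DK M θ‖ ^ 2 := by gcongr
  rw [div_mul_eq_mul_div, le_div_iff₀ (by positivity)]
  linarith

lemma DK_TP (M q : ℕ) (α : ℝ) :
    DK M (q * α) = TP (range M) (fun _ => 1) (fun l => ((q:ℤ) * l)) α := by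
  unfold DK TP
  refine Finset.sum_congr rfl fun l _ => ?_
  rw [one_mul]; congr 1; push_cast; ring

lemma sum_ite_card {ι : Type*} (s : Finset ι) (p : ι → Prop) [DecidablePred p] (c : ℝ) :
    (∑ x ∈ s, if p x then c else 0) = (s.filter p).card * c := by
  rw [← Finset.sum_filter]; simp

lemma cube_sum_count (s : Finset ℕ) (n : ℕ) (hn : n ≠ 0) :
    (((s ×ˢ s).filter (fun y => y.1 ^ 3 + y.2 ^ 3 = n)).card : ℝ) ≤ 2 * dv n := by
  have : ((s ×ˢ s).filter (fun y => y.1 ^ 3 + y.2 ^ 3 = n)).card ≤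
      (n.divisors ×ˢ (Finset.univ : Finset Bool)).card := by
    refine Finset.card_le_card_of_injOn (fun y => (y.1 + y.2, decide (y.1 ≤ y.2))) ?_ ?_
    · intro y hy
      simp only [Finset.coe_filter, Set.mem_ofPred_eq] at hy
      simp only [Finset.coe_product, Set.mem_prod, Finset.mem_coe, Finset.mem_univ, and_true,
        Nat.mem_divisors]
      refine ⟨?_, hn⟩
      rw [← hy.2]
      exact Odd.nat_add_dvd_pow_add_pow _ _ (by decide)
    · intro x hx y hy hxy
      simp only [Finset.coe_filter, Set.mem_ofPred_eq] at hx hy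
      simp only [Prod.mk.injEq, decide_eq_decide] at hxy
      have hs : ((x.1:ℤ) + x.2) = y.1 + y.2 := by exact_mod_cast hxy.1
      have hc : ((x.1:ℤ)^3 + x.2^3) = (y.1:ℤ)^3 + y.2^3 := by exact_mod_cast hx.2.trans hy.2.symm
      have hpos : ((x.1:ℤ) + x.2) ≠ 0 := by
        intro h
        have h1 : x.1 = 0 := by omega
        have h2 : x.2 = 0 := by omega
        have := hx.2
        rw [h1, h2] at this
        exact hn (by simpa using this.symm)
      have hp : ((x.1:ℤ) - y.1) * (x.1 - y.2) = 0 := by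
        have h3 : 3 * ((x.1:ℤ) + x.2) * (((x.1:ℤ) - y.1) * (x.1 - y.2)) = 0 := by
          have e1 : (x.2:ℤ) = y.1 + y.2 - x.1 := by linarith
          rw [e1] at hc ⊢
          linear_combination hc
        rcases mul_eq_zero.1 h3 with h | h
        · exact absurd (by simpa using h) hpos
        · exact h
      rcases mul_eq_zero.1 hp with h | h
      · exact Prod.ext (by omega) (by omega)
      · have h1 : x.1 = y.2 := by omega
        have h2 : x.2 = y.1 := by omega
        rw [h1, h2] at hxy
        have := hxy.2
        refine Prod.ext ?_ ?_ <;> omega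
  rw [Finset.card_product] at this
  simp only [Finset.card_univ, Fintype.card_bool] at this
  unfold dv
  have h2 : (((s ×ˢ s).filter (fun y => y.1 ^ 3 + y.2 ^ 3 = n)).card : ℝ) ≤
    (n.divisors.card : ℝ) * 2 := by exact_mod_cast this
  linarith

/-- weighted cubic exponential sum -/
def CS (s : Finset ℕ) (w : ℕ → ℂ) (α : ℝ) : ℂ := ∑ n ∈ s, w n * eu ((n:ℝ) ^ 3 * α)

lemma CS_TP (s : Finset ℕ) (w : ℕ → ℂ) (α : ℝ) : CS s w α = TP s w (fun n => (n:ℤ) ^ 3) α := by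
  unfold CS TP
  refine Finset.sum_congr rfl fun l _ => ?_
  push_cast; rfl

@[fun_prop]
lemma continuous_CS (s : Finset ℕ) (w : ℕ → ℂ) : Continuous (CS s w) := by
  unfold CS; fun_prop

@[fun_prop]
lemma continuous_DK (M : ℕ) : Continuous (DK M) := by
  unfold DK; fun_prop

lemma four_moment (s : Finset ℕ) (w : ℕ → ℂ) (B D : ℝ) (hs : ∀ n ∈ s, n ≠ 0)
    (hB : ∀ n ∈ s, ‖w n‖ ≤ B) (hB0 : 0 ≤ B)
    (hD : ∀ x ∈ s, ∀ y ∈ s, dv (x ^ 3 + y ^ 3) ≤ D) :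
    ∫ α in (0:ℝ)..1, ‖CS s w α‖ ^ 4 ≤ 2 * D * B ^ 4 * (s.card:ℝ) ^ 2 := by
  have e : ∀ α, ‖CS s w α‖ ^ 4 = ‖TP (s ×ˢ s) (fun j => w j.1 * w j.2)
      (fun j => (j.1:ℤ) ^ 3 + (j.2:ℤ) ^ 3) α‖ ^ 2 := by
    intro α
    rw [← TP_mul s w (fun n => (n:ℤ)^3) s w (fun n => (n:ℤ)^3), ← CS_TP, norm_mul]; ring
  simp_rw [e]
  refine (parseval_le _ _ _ (fun _ => B ^ 2) ?_).trans ?_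
  · intro j hj
    rw [norm_mul, sq]
    have h1 := hB _ (Finset.mem_product.1 hj).1
    have h2 := hB _ (Finset.mem_product.1 hj).2
    gcongr
  · calc _ ≤ ∑ j ∈ s ×ˢ s, (2 * D * (B ^ 2 * B ^ 2)) := by
          refine Finset.sum_le_sum fun j hj => ?_
          rw [sum_ite_card]
          gcongr
          have hj1 := (Finset.mem_product.1 hj).1
          have hj2 := (Finset.mem_product.1 hj).2
          have := cube_sum_count s (j.1 ^ 3 + j.2 ^ 3) (by
            have := hs _ hj1
            positivity)
          have h2 := hD _ hj1 _ hj2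
          refine le_trans ?_ (this.trans (by linarith))
          rw [Nat.cast_le]
          refine Finset.card_le_card fun y hy => ?_
          simp only [Finset.mem_filter] at hy ⊢
          exact ⟨hy.1, by exact_mod_cast hy.2.symm⟩
      _ = _ := by simp; ring

lemma D2_bound (s : Finset ℕ) (w : ℕ → ℂ) (B D : ℝ) (Q M : ℕ)
    (hB : ∀ n ∈ s, ‖w n‖ ≤ B) (hB0 : 0 ≤ B) (hD0 : 0 ≤ D)
    (hD : ∀ x ∈ s, ∀ y ∈ s, x ≠ y → dv (((x:ℤ) ^ 3 - (y:ℤ) ^ 3).natAbs) ≤ D) :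
    ∑ q ∈ Finset.Icc 1 Q, ∫ α in (0:ℝ)..1, ‖DK M (q * α)‖ ^ 2 * ‖CS s w α‖ ^ 2 ≤
      B ^ 2 * (M * (s.card * Q + (s.card:ℝ) ^ 2 * D)) := by
  have e : ∀ q : ℕ, ∀ α : ℝ, ‖DK M (q * α)‖ ^ 2 * ‖CS s w α‖ ^ 2 =
     ‖TP (range M ×ˢ s) (fun j => 1 * w j.2) (fun j => (q:ℤ) * (j.1:ℤ) + (j.2:ℤ) ^ 3) α‖ ^ 2 := by
    intro q α
    rw [← TP_mul (range M) (fun _ => 1) (fun l => (q:ℤ) * l) s w (fun n => (n:ℤ)^3), ← CS_TP,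
      ← DK_TP, norm_mul]; ring
  simp_rw [e]
  have h1 : ∀ q ∈ Finset.Icc 1 Q, ∫ α in (0:ℝ)..1, ‖TP (range M ×ˢ s) (fun j => 1 * w j.2)
      (fun j => (q:ℤ) * (j.1:ℤ) + (j.2:ℤ) ^ 3) α‖ ^ 2 ≤
      ∑ j ∈ range M ×ˢ s, ∑ y ∈ s, if (q:ℤ) ∣ (j.2:ℤ) ^ 3 - (y:ℤ) ^ 3 then B * B else 0 := by
    intro q hq
    have hq0 : (q:ℤ) ≠ 0 := by have := (Finset.mem_Icc.1 hq).1; omega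
    refine (parseval_le _ _ _ (fun _ => B) ?_).trans ?_
    · intro j hj
      rw [one_mul]; exact hB _ (Finset.mem_product.1 hj).2
    · refine Finset.sum_le_sum fun j hj => ?_
      rw [Finset.sum_product_right]
      refine Finset.sum_le_sum fun y hy => ?_
      rw [sum_ite_card]
      split_ifs with hd
      · refine mul_le_of_le_one_left (by positivity) ?_
        refine Nat.cast_le_one.2 (Finset.card_le_one.2 ?_)
        intro a ha b hb
        simp only [Finset.mem_filter] at ha hb
        have : (q:ℤ) * a = q * b := by linarith [ha.2, hb.2]
        exact_mod_cast mul_left_cancel₀ hq0 this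
      · refine le_of_eq ?_
        rw [Finset.filter_false_of_mem]
        · simp
        · intro a ha h
          exact hd ⟨a - j.1, by linarith⟩
  refine (Finset.sum_le_sum h1).trans ?_
  rw [Finset.sum_comm]
  have h2 : ∀ j ∈ range M ×ˢ s, ∑ q ∈ Finset.Icc 1 Q, ∑ y ∈ s,
      (if (q:ℤ) ∣ (j.2:ℤ) ^ 3 - (y:ℤ) ^ 3 then B * B else 0) ≤ B * B * (Q + s.card * D) := by
    intro j hj
    have hj2 := (Finset.mem_product.1 hj).2
    rw [Finset.sum_comm, ← Finset.add_sum_erase _ _ hj2]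
    have i1 : ∑ q ∈ Finset.Icc 1 Q, (if (q:ℤ) ∣ (j.2:ℤ) ^ 3 - (j.2:ℤ) ^ 3 then B * B else 0) =
      B * B * Q := by simp; ring
    rw [i1]
    have i2 : ∀ y ∈ s.erase j.2, ∑ q ∈ Finset.Icc 1 Q,
        (if (q:ℤ) ∣ (j.2:ℤ) ^ 3 - (y:ℤ) ^ 3 then B * B else 0) ≤ D * (B * B) := by
      intro y hy
      rw [sum_ite_card]
      gcongr
      have hy' := Finset.mem_erase.1 hy
      refine le_trans ?_ (hD _ hj2 _ hy'.2 hy'.1.symm)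
      unfold dv
      rw [Nat.cast_le]
      refine Finset.card_le_card fun q hq => ?_
      simp only [Finset.mem_filter, Nat.mem_divisors] at hq ⊢
      refine ⟨Int.natCast_dvd.1 hq.2, ?_⟩
      rw [Int.natAbs_ne_zero, sub_ne_zero]
      intro h
      have h' : j.2 ^ 3 = y ^ 3 := by exact_mod_cast h
      exact hy'.1 (Nat.pow_left_injective (n := 3) (by norm_num) h').symm
    have i3 := Finset.sum_le_sum i2
    rw [Finset.sum_const, nsmul_eq_mul] at i3
    have i4 : ((s.erase j.2).card : ℝ) * (D * (B * B)) ≤ (s.card:ℝ) * (D * (B * B)) := by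
      gcongr; exact Finset.erase_subset _ _
    linarith
  refine (Finset.sum_le_sum h2).trans (le_of_eq ?_)
  simp; ring

lemma D3_bound (A M : ℕ) (hA : 0 < A) :
    ∫ β in (0:ℝ)..1, ‖DK M β‖ ^ 2 * ‖CS (Finset.Ico A (2 * A)) (fun _ => 1) β‖ ^ 4 ≤
      M * A ^ 3 * ((M:ℝ) / A ^ 2 + 1) := by
  set s := Finset.Ico A (2 * A) with hs
  have hcard : s.card = A := by rw [hs, Nat.card_Ico]; omega
  have e : ∀ α : ℝ, ‖DK M α‖ ^ 2 * ‖CS s (fun _ => 1) α‖ ^ 4 =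
     ‖TP ((range M ×ˢ s) ×ˢ s) (fun j => (1 * 1) * 1)
      (fun j => (((1:ℕ):ℤ) * (j.1.1:ℤ) + (j.1.2:ℤ) ^ 3) + (j.2:ℤ)^3) α‖ ^ 2 := by
    intro α
    rw [← TP_mul (range M ×ˢ s) (fun _ => 1 * 1) (fun l => ((1:ℕ):ℤ) * l.1 + (l.2:ℤ)^3)
        s (fun _ => 1) (fun n => (n:ℤ)^3),
      ← TP_mul (range M) (fun _ => 1) (fun l => ((1:ℕ):ℤ) * l) s (fun _ => 1) (fun n => (n:ℤ)^3), ← CS_TP,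
      ← DK_TP, norm_mul, norm_mul]; push_cast; rw [one_mul]; ring
  simp_rw [e]
  refine (parseval_le _ _ _ (fun _ => 1) (fun _ _ => by simp)).trans ?_
  have hAR : (0:ℝ) < A := by exact_mod_cast hA
  have key : ∀ j ∈ (range M ×ˢ s) ×ˢ s, ∑ k ∈ (range M ×ˢ s) ×ˢ s,
      (if (((1:ℕ):ℤ) * (j.1.1:ℤ) + (j.1.2:ℤ) ^ 3) + (j.2:ℤ)^3 =
        (((1:ℕ):ℤ) * (k.1.1:ℤ) + (k.1.2:ℤ) ^ 3) + (k.2:ℤ)^3 then (1:ℝ) * 1 else 0) ≤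
      A * ((M:ℝ) / A ^ 2 + 1) := by
    intro j _
    rw [Finset.sum_product_right]
    have hsum : ∑ y ∈ s, ((M:ℝ) / A ^ 2 + 1) = A * ((M:ℝ) / A ^ 2 + 1) := by
      rw [Finset.sum_const, hcard, nsmul_eq_mul]
    rw [← hsum]
    refine Finset.sum_le_sum fun y hy => ?_
    rw [sum_ite_card]
    set c : ℤ := (((1:ℕ):ℤ) * (j.1.1:ℤ) + (j.1.2:ℤ) ^ 3) + (j.2:ℤ)^3 - (y:ℤ)^3 with hc
    set T := (range M ×ˢ s).filter (fun k : ℕ × ℕ => (((1:ℕ):ℤ) * (j.1.1:ℤ) + (j.1.2:ℤ) ^ 3) + (j.2:ℤ)^3 =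
        (((1:ℕ):ℤ) * (k.1:ℤ) + (k.2:ℤ) ^ 3) + (y:ℤ)^3) with hT
    have hTm : ∀ k ∈ T, (k.1 < M ∧ A ≤ k.2) ∧ (k.1:ℤ) + (k.2:ℤ)^3 = c := by
      intro k hk
      simp only [hT, hs, Finset.mem_filter, Finset.mem_product, Finset.mem_range, Finset.mem_Ico] at hk
      refine ⟨⟨hk.1.1, hk.1.2.1⟩, ?_⟩
      rw [hc]; push_cast at *; linarith [hk.2]
    simp only [mul_one]
    rcases T.eq_empty_or_nonempty with h0 | hne
    · rw [h0]; simp; positivity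
    · obtain ⟨k0, hk0, hmin⟩ := Finset.exists_min_image T (fun k => k.2) hne
      have hsub : ∀ k ∈ T, k.2 ∈ Finset.Icc k0.2 (k0.2 + M / A ^ 2) := by
        intro k hk
        refine Finset.mem_Icc.2 ⟨hmin k hk, ?_⟩
        obtain ⟨t, ht⟩ := Nat.exists_eq_add_of_le (hmin k hk)
        have h1 := hTm k hk
        have h2 := hTm k0 hk0
        rw [ht]
        gcongr
        rw [Nat.le_div_iff_mul_le (by positivity)]
        have h3 : ((k.2:ℤ))^3 - (k0.2:ℤ)^3 < M := by
          have := h1.1.1; have := h2.1.1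
          have h4 : (k.1:ℤ) + (k.2:ℤ)^3 = (k0.1:ℤ) + (k0.2:ℤ)^3 := h1.2.trans h2.2.symm
          omega
        rw [ht] at h3
        push_cast at h3
        have h5 : (A:ℤ) ≤ k0.2 := by exact_mod_cast h2.1.2
        have h6 : (t:ℤ) * A ^ 2 ≤ t * (k0.2:ℤ)^2 := by gcongr
        have h7 : (t:ℤ) * (k0.2:ℤ)^2 ≤ ((k0.2:ℤ) + t)^3 - (k0.2:ℤ)^3 := by
          have : ((k0.2:ℤ) + t)^3 - (k0.2:ℤ)^3 = t * (k0.2:ℤ)^2 + (2 * t * (k0.2:ℤ)^2 + 3 * k0.2 * t^2 + t^3) := by ring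
          rw [this]
          have : (0:ℤ) ≤ 2 * t * (k0.2:ℤ)^2 + 3 * k0.2 * t^2 + t^3 := by positivity
          linarith
        have : (t:ℤ) * A ^ 2 ≤ M := by linarith
        exact_mod_cast this
      have hcardT : T.card ≤ M / A ^ 2 + 1 := by
        have h1 : T.card ≤ (Finset.Icc k0.2 (k0.2 + M / A ^ 2)).card := by
          refine Finset.card_le_card_of_injOn (fun k => k.2) hsub ?_
          intro k hk k' hk' h
          dsimp only at h
          have h1 := (hTm k hk).2
          have h2 := (hTm k' hk').2
          rw [h] at h1
          exact Prod.ext (by omega) h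
        rw [Nat.card_Icc] at h1
        generalize M / A ^ 2 = x at h1 ⊢
        omega
      calc (T.card:ℝ) ≤ ((M / A ^ 2 + 1 : ℕ) : ℝ) := by exact_mod_cast hcardT
        _ = ((M / A ^ 2 : ℕ) : ℝ) + 1 := by push_cast; ring
        _ ≤ _ := by
          gcongr
          refine Nat.cast_div_le.trans ?_
          push_cast; rfl
  refine (Finset.sum_le_sum key).trans (le_of_eq ?_)
  simp [hcard]; ring

lemma abel_bound (u : ℕ → ℂ) (T : ℝ) (hu : ∀ x, ‖∑ n ∈ range x, u n‖ ≤ T) (β : ℝ) (k L : ℕ) :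
    ‖∑ n ∈ range L, u n * eu ((n:ℝ) ^ k * β)‖ ≤ T * (1 + 2 * Real.pi * |β| * (L:ℝ) ^ k) := by
  have hT : 0 ≤ T := (norm_nonneg _).trans (hu 0)
  have h := Finset.sum_range_by_parts (fun n : ℕ => eu ((n:ℝ) ^ k * β)) u L
  simp only [smul_eq_mul] at h
  have e : ∑ n ∈ range L, u n * eu ((n:ℝ) ^ k * β) = ∑ n ∈ range L, eu ((n:ℝ) ^ k * β) * u n :=
    Finset.sum_congr rfl fun _ _ => mul_comm _ _
  rw [e, h]
  have h1 : ‖∑ i ∈ range (L - 1), (eu (((i + 1 : ℕ):ℝ) ^ k * β) - eu ((i:ℝ) ^ k * β)) *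
      ∑ j ∈ range (i + 1), u j‖ ≤ T * (2 * Real.pi * |β| * (L:ℝ) ^ k) := by
    have tele : ∑ i ∈ range (L - 1), ((((i + 1 : ℕ):ℝ) ^ k) - (i:ℝ) ^ k) ≤ (L:ℝ) ^ k := by
      rw [Finset.sum_range_sub (fun i : ℕ => (i:ℝ) ^ k)]
      have h1 : ((L - 1 : ℕ) : ℝ) ^ k ≤ (L:ℝ) ^ k := by
        gcongr; exact_mod_cast Nat.sub_le _ _
      have h2 : (0:ℝ) ≤ ((0:ℕ):ℝ) ^ k := by positivity
      linarith
    calc _ ≤ ∑ i ∈ range (L - 1), ‖(eu (((i + 1 : ℕ):ℝ) ^ k * β) - eu ((i:ℝ) ^ k * β)) *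
      ∑ j ∈ range (i + 1), u j‖ := norm_sum_le _ _
      _ ≤ ∑ i ∈ range (L - 1), (2 * Real.pi * |β| * ((((i + 1 : ℕ):ℝ) ^ k) - (i:ℝ) ^ k)) * T := by
          refine Finset.sum_le_sum fun i _ => ?_
          rw [norm_mul]
          have := eu_sub_eu_le (((i + 1 : ℕ):ℝ) ^ k * β) ((i:ℝ) ^ k * β)
          have h0 : (0:ℝ) ≤ (((i + 1 : ℕ):ℝ) ^ k) - (i:ℝ) ^ k := by
            rw [sub_nonneg]; gcongr; simp
          rw [← sub_mul, abs_mul, abs_of_nonneg h0] at this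
          have h3 := hu (i + 1)
          refine mul_le_mul (this.trans (le_of_eq (by ring))) h3 (norm_nonneg _) ?_
          have := Real.pi_pos
          positivity
      _ = T * (2 * Real.pi * |β| * ∑ i ∈ range (L - 1), ((((i + 1 : ℕ):ℝ) ^ k) - (i:ℝ) ^ k)) := by
          rw [← Finset.sum_mul, ← Finset.mul_sum]; ring
      _ ≤ _ := by
          have := Real.pi_pos
          gcongr
  refine (norm_sub_le _ _).trans ?_
  rw [norm_mul, norm_eu, one_mul]
  have := hu L
  linarith

lemma nu_abel {R q : ℕ} (hR : 1 ≤ R) (hq : 0 < q) (a k L : ℕ) (β : ℝ) :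
    ‖∑ n ∈ range L, (nu R n : ℂ) * eu ((n:ℝ) ^ k * (a / q + β)) -
      EE R q (psi k q a) * ∑ n ∈ range L, 1 * eu ((n:ℝ) ^ k * β)‖ ≤
      2 * q * R ^ 4 * (1 + 2 * Real.pi * |β| * (L:ℝ) ^ k) := by
  have h := abel_bound (fun n => (nu R n : ℂ) * psi k q a n - EE R q (psi k q a))
    (2 * q * R ^ 4) (fun x => by
      rw [Finset.sum_sub_distrib, Finset.sum_const, Finset.card_range, nsmul_eq_mul]
      exact nu_partial hR hq _ (psi_periodic k hq a) (fun n => (norm_psi k q a n).le) x) β k L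
  refine le_trans (le_of_eq ?_) h
  congr 1
  rw [Finset.mul_sum, ← Finset.sum_sub_distrib]
  refine Finset.sum_congr rfl fun n _ => ?_
  have : (n:ℝ) ^ k * (a / q + β) = (a:ℝ) * n ^ k / q + n ^ k * β := by ring
  rw [this, eu_add, psi]; ring

/-- weighted quadratic exponential sum -/
def Gf (R X : ℕ) (α : ℝ) : ℂ := ∑ n ∈ range X, (nu R n : ℂ) * eu ((n:ℝ) ^ 2 * α)

/-- weighted cubic exponential sum -/
def Ff (R A : ℕ) (α : ℝ) : ℂ := CS (Finset.Ico A (2 * A)) (fun n => (nu R n : ℂ)) α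

def V3 (A : ℕ) (β : ℝ) : ℂ := CS (Finset.Ico A (2 * A)) (fun _ => 1) β

@[fun_prop]
lemma continuous_Gf (R X : ℕ) : Continuous (Gf R X) := by unfold Gf; fun_prop

@[fun_prop]
lemma continuous_Ff (R X : ℕ) : Continuous (Ff R X) := by unfold Ff; fun_prop

@[fun_prop]
lemma continuous_V3 (X : ℕ) : Continuous (V3 X) := by unfold V3; fun_prop

lemma G_major {R q : ℕ} (hR : 1 ≤ R) (hq : 0 < q) (a X : ℕ) (β : ℝ) :
    ‖Gf R X (a / q + β)‖ ≤ ‖EE R q (psi 2 q a)‖ * X +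
      2 * q * R ^ 4 * (1 + 2 * Real.pi * |β| * (X:ℝ) ^ 2) := by
  have h := nu_abel hR hq a 2 X β
  have h1 : ‖∑ n ∈ range X, 1 * eu ((n:ℝ) ^ 2 * β)‖ ≤ X := by
    refine (norm_sum_le _ _).trans (le_of_eq ?_)
    simp [norm_eu]
  have h2 := norm_sub_norm_le (Gf R X (a / q + β))
    (EE R q (psi 2 q a) * ∑ n ∈ range X, 1 * eu ((n:ℝ) ^ 2 * β))
  rw [norm_mul] at h2
  have h3 : ‖EE R q (psi 2 q a)‖ * ‖∑ n ∈ range X, 1 * eu ((n:ℝ) ^ 2 * β)‖ ≤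
    ‖EE R q (psi 2 q a)‖ * X := by gcongr
  unfold Gf at *
  linarith

lemma F_major {R q : ℕ} (hR : 1 ≤ R) (hq : 0 < q) (a A : ℕ) (β : ℝ) :
    ‖Ff R A (a / q + β)‖ ≤ ‖EE R q (psi 3 q a)‖ * ‖V3 A β‖ +
      4 * q * R ^ 4 * (1 + 2 * Real.pi * |β| * (2 * A : ℝ) ^ 3) := by
  have h1 := nu_abel hR hq a 3 (2 * A) β
  have h2 := nu_abel hR hq a 3 A β
  have e : Ff R A (a / q + β) - EE R q (psi 3 q a) * V3 A β =
    (∑ n ∈ range (2 * A), (nu R n : ℂ) * eu ((n:ℝ) ^ 3 * (a / q + β)) -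
      EE R q (psi 3 q a) * ∑ n ∈ range (2 * A), 1 * eu ((n:ℝ) ^ 3 * β)) -
    (∑ n ∈ range A, (nu R n : ℂ) * eu ((n:ℝ) ^ 3 * (a / q + β)) -
      EE R q (psi 3 q a) * ∑ n ∈ range A, 1 * eu ((n:ℝ) ^ 3 * β)) := by
    unfold Ff V3 CS
    rw [Finset.sum_Ico_eq_sub _ (by omega), Finset.sum_Ico_eq_sub _ (by omega)]
    ring
  have h3 := norm_sub_norm_le (Ff R A (a / q + β)) (EE R q (psi 3 q a) * V3 A β)
  rw [e, norm_mul] at h3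
  have h4 := h3.trans (norm_sub_le _ _)
  have h5 : 2 * (q:ℝ) * R ^ 4 * (1 + 2 * Real.pi * |β| * (A:ℝ) ^ 3) ≤
    2 * q * R ^ 4 * (1 + 2 * Real.pi * |β| * (2 * A : ℝ) ^ 3) := by
    have := Real.pi_pos
    gcongr
    linarith [show (0:ℝ) ≤ A by positivity]
  push_cast at h1
  linarith

structure Par (z : ℝ) (R A X N : ℕ) : Prop where
  hz : 10 ^ 9 ≤ z
  hR1 : 1 ≤ R
  hR : (R:ℝ) ≤ z
  hA : z ^ 1000 ≤ (A:ℝ)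
  hAN : A ^ 3 ≤ N
  hNA : N ≤ 17 * A ^ 3
  hNX : N ≤ X ^ 2
  hXN : X ^ 2 ≤ 4 * N
  hdv : ∀ u : ℕ, u ≠ 0 → u ≤ N ^ 2 → dv u ≤ z
  hlog : 1 + Real.log N ≤ z
  hJ : ((Nat.log 2 N + 1 : ℕ) : ℝ) ≤ z

section
variable {z : ℝ} {R A X N : ℕ}

lemma Par.z1 (P : Par z R A X N) : 1 ≤ z := le_trans (by norm_num) P.hz
lemma Par.z0 (P : Par z R A X N) : 0 < z := lt_of_lt_of_le one_pos P.z1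
lemma Par.zA (P : Par z R A X N) {k : ℕ} (hk : k ≤ 1000) : z ^ k ≤ (A:ℝ) :=
  (pow_le_pow_right₀ P.z1 hk).trans P.hA
lemma Par.A1 (P : Par z R A X N) : (1:ℝ) ≤ A := by simpa using P.zA (k := 0) (by norm_num)
lemma Par.A0 (P : Par z R A X N) : 0 < A := by
  have := P.A1; exact_mod_cast lt_of_lt_of_le one_pos this
lemma Par.A10 (P : Par z R A X N) : 1000 ≤ A := by
  have h1 := P.zA (k := 1) (by norm_num)
  have h2 := P.hz
  have : (1000:ℝ) ≤ A := by rw [pow_one] at h1; linarith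
  exact_mod_cast this
lemma Par.AN (P : Par z R A X N) : (A:ℝ) ^ 3 ≤ N := by exact_mod_cast P.hAN
lemma Par.NA (P : Par z R A X N) : (N:ℝ) ≤ 17 * A ^ 3 := by exact_mod_cast P.hNA
lemma Par.NX (P : Par z R A X N) : (N:ℝ) ≤ X ^ 2 := by exact_mod_cast P.hNX
lemma Par.XN (P : Par z R A X N) : (X:ℝ) ^ 2 ≤ 4 * N := by exact_mod_cast P.hXN
lemma Par.N0 (P : Par z R A X N) : 0 < N := lt_of_lt_of_le (pow_pos P.A0 3) P.hAN

lemma Par.logq (P : Par z R A X N) {q : ℕ} (hq : 0 < q) (hqN : q ≤ N) : 1 + Real.log q ≤ z := by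
  refine le_trans ?_ P.hlog
  gcongr

lemma Par.G_minor (P : Par z R A X N) {q : ℕ} (hq : 0 < q) (hqN : q ≤ N) (a : ℤ)
    (haq : IsCoprime a (q:ℤ)) (α : ℝ) (hα : |α - a / q| ≤ 1 / q ^ 2) :
    ‖Gf R X α‖ ^ 2 ≤ z ^ 6 * ((X:ℝ) ^ 2 / q + X + q) := by
  have hqR : (0:ℝ) < q := by exact_mod_cast hq
  have hz := P.hz
  have hz0 := P.z0
  have hlog := P.logq hq hqN
  set B := 77 * z * ((X:ℝ) ^ 2 / q + X + q) with hB
  have hB0 : 0 ≤ B := by positivity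
  have h1 : ∀ θ : ℝ, ‖∑ n ∈ range X, eu ((n:ℝ) ^ 2 * α) * eu (θ * n)‖ ≤ Real.sqrt B := by
    intro θ
    apply Real.le_sqrt_of_sq_le
    have := W_sq q hq a haq α hα θ 0 X
    have e : ∀ m : ℕ, eu ((m:ℝ) ^ 2 * α) * eu (θ * m) = eu (α * m ^ 2 + θ * m + 0) := by
      intro m; rw [← eu_add]; congr 1; ring
    simp_rw [e]
    refine this.trans ?_
    calc _ ≤ (X:ℝ) + 2 * (((2 * X : ℕ) : ℝ) / q + 1) * (6 * X + 16 * q * z) := by gcongr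
      _ = 24 * ((X:ℝ) ^ 2 / q) + (13 + 64 * z) * X + 32 * z * q := by
          push_cast; field_simp; ring
      _ ≤ 77 * z * ((X:ℝ) ^ 2 / q) + (77 * z) * X + 77 * z * q := by
          gcongr <;> linarith
      _ = B := by rw [hB]; ring
  have h2 := AN_nu P.hR1 (fun n : ℕ => eu ((n:ℝ) ^ 2 * α)) (range X) _ h1 0
  simp only [zero_mul, eu_zero, mul_one] at h2
  change ‖Gf R X α‖ ≤ _ at h2
  have hR := P.hR
  calc ‖Gf R X α‖ ^ 2 ≤ ((R:ℝ) ^ 2 * Real.sqrt B) ^ 2 := by gcongr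
    _ = (R:ℝ) ^ 4 * B := by rw [mul_pow, Real.sq_sqrt hB0]; ring
    _ ≤ z ^ 4 * B := by gcongr
    _ = 77 * z ^ 5 * ((X:ℝ) ^ 2 / q + X + q) := by rw [hB]; ring
    _ ≤ z ^ 6 * ((X:ℝ) ^ 2 / q + X + q) := by
        gcongr
        have : 77 * z ^ 5 ≤ z * z ^ 5 := by gcongr; linarith
        linarith [show z * z ^ 5 = z ^ 6 by ring]

lemma Par.F_minor (P : Par z R A X N) {q : ℕ} (hq : 0 < q) (hqN : q ≤ N) (a : ℤ)
    (haq : IsCoprime a (q:ℤ)) (α : ℝ) (hα : |α - a / q| ≤ 1 / q ^ 2) :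
    ‖Ff R A α‖ ^ 4 ≤ z ^ 11 * ((A:ℝ) ^ 4 / q + A ^ 3 + A * q) := by
  have hqR : (0:ℝ) < q := by exact_mod_cast hq
  have hz := P.hz
  have hz1 := P.z1
  have hz0 := P.z0
  have hA1 := P.A1
  have hlog := P.logq hq hqN
  set B := 1700 * z ^ 2 * ((A:ℝ) ^ 4 / q + A ^ 3 + A * q) with hB
  have hB0 : 0 ≤ B := by positivity
  have hD : ∀ u : ℕ, u ≠ 0 → u ≤ 6 * A ^ 2 → dv u ≤ z := by
    intro u hu hu2
    refine P.hdv u hu (hu2.trans ?_)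
    calc 6 * A ^ 2 ≤ A * A ^ 2 := Nat.mul_le_mul_right _ (by have := P.A10; omega)
      _ = A ^ 3 := by ring
      _ ≤ N := P.hAN
      _ ≤ N ^ 2 := Nat.le_self_pow (by norm_num) _
  have h1 : ∀ θ : ℝ, ‖∑ n ∈ Finset.Ico A (2 * A), eu ((n:ℝ) ^ 3 * α) * eu (θ * n)‖ ≤
      Real.sqrt (Real.sqrt B) := by
    intro θ
    apply Real.le_sqrt_of_sq_le
    apply Real.le_sqrt_of_sq_le
    rw [← pow_mul]
    have := W_cube q hq a haq α hα (3 * A * α) (3 * A ^ 2 * α + θ) (A ^ 3 * α + θ * A) A z hz0.le hD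
    have e : ∑ n ∈ Finset.Ico A (2 * A), eu ((n:ℝ) ^ 3 * α) * eu (θ * n) =
       ∑ n ∈ range A, eu (α * n ^ 3 + 3 * A * α * n ^ 2 + (3 * A ^ 2 * α + θ) * n +
        (A ^ 3 * α + θ * A)) := by
      rw [Finset.sum_Ico_eq_sum_range]
      have : 2 * A - A = A := by omega
      rw [this]
      refine Finset.sum_congr rfl fun m _ => ?_
      rw [← eu_add]; congr 1; push_cast; ring
    rw [e]
    refine this.trans ?_
    have hA2 : (A:ℝ) ^ 2 ≤ A ^ 3 := pow_le_pow_right₀ hA1 (by norm_num)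
    have hzz : z ≤ z ^ 2 := by nlinarith
    have hzz1 : 1 ≤ z ^ 2 := by nlinarith
    calc _ ≤ 10 * (A:ℝ) ^ 3 + 16 * A * (z *
        ((((6 * A ^ 2 : ℕ) : ℝ) / q + 1) * (6 * A + 16 * q * z))) := by gcongr
      _ = (576 * z) * ((A:ℝ) ^ 4 / q) + (10 + 1536 * z ^ 2) * A ^ 3 + 96 * z * A ^ 2 +
          256 * z ^ 2 * (A * q) := by
          push_cast; field_simp; ring
      _ ≤ (576 * z ^ 2) * ((A:ℝ) ^ 4 / q) + (10 * z ^ 2 + 1536 * z ^ 2) * A ^ 3 + 96 * z ^ 2 * A ^ 3 +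
          256 * z ^ 2 * (A * q) := by
          gcongr
          linarith
      _ = z ^ 2 * (576 * ((A:ℝ) ^ 4 / q) + 1642 * A ^ 3 + 256 * (A * q)) := by ring
      _ ≤ z ^ 2 * (1700 * ((A:ℝ) ^ 4 / q) + 1700 * A ^ 3 + 1700 * (A * q)) := by
          gcongr <;> norm_num
      _ = B := by rw [hB]; ring
  have h2 := AN_nu P.hR1 (fun n : ℕ => eu ((n:ℝ) ^ 3 * α)) (Finset.Ico A (2 * A)) _ h1 0
  simp only [zero_mul, eu_zero, mul_one] at h2
  change ‖Ff R A α‖ ≤ _ at h2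
  have hR := P.hR
  calc ‖Ff R A α‖ ^ 4 ≤ ((R:ℝ) ^ 2 * Real.sqrt (Real.sqrt B)) ^ 4 := by gcongr
    _ = (R:ℝ) ^ 8 * ((Real.sqrt (Real.sqrt B)) ^ 2) ^ 2 := by ring
    _ = (R:ℝ) ^ 8 * B := by rw [Real.sq_sqrt (Real.sqrt_nonneg _), Real.sq_sqrt hB0]
    _ ≤ z ^ 8 * B := by gcongr
    _ = 1700 * z ^ 10 * ((A:ℝ) ^ 4 / q + A ^ 3 + A * q) := by rw [hB]; ring
    _ ≤ z ^ 11 * ((A:ℝ) ^ 4 / q + A ^ 3 + A * q) := by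
        gcongr
        have : 1700 * z ^ 10 ≤ z * z ^ 10 := by gcongr; linarith
        linarith [show z * z ^ 10 = z ^ 11 by ring]

lemma dirichlet (α : ℝ) (n : ℕ) (hn : 0 < n) : ∃ (q : ℕ) (a : ℤ), 0 < q ∧ q ≤ n ∧
    IsCoprime a (q:ℤ) ∧ |q * α - a| ≤ 1 / (n + 1) ∧ |α - a / q| ≤ 1 / q ^ 2 := by
  obtain ⟨r, h1, h2⟩ := Real.exists_rat_abs_sub_le_and_den_le α hn
  have hd : (0:ℝ) < r.den := by exact_mod_cast r.den_pos
  have e : (r:ℝ) = (r.num:ℝ) / r.den := Rat.cast_def r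
  have h3 : |(r.den:ℝ) * α - r.num| ≤ 1 / (n + 1) := by
    have : (r.den:ℝ) * α - r.num = r.den * (α - r) := by rw [e]; field_simp
    rw [this, abs_mul, Nat.abs_cast]
    calc _ ≤ (r.den:ℝ) * (1 / ((n + 1) * r.den)) := by gcongr
      _ = _ := by field_simp
  refine ⟨r.den, r.num, r.den_pos, h2, ?_, h3, ?_⟩
  · rw [Int.isCoprime_iff_gcd_eq_one]; exact r.reduced
  · rw [← e]
    refine h1.trans ?_
    rw [sq]
    have : (r.den:ℝ) ≤ n := by exact_mod_cast h2
    gcongr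
    linarith
end

section
variable {z : ℝ} {R A X N : ℕ}

lemma eu_pow_periodic (m k : ℕ) (x : ℝ) (n : ℤ) :
    eu ((m:ℝ) ^ k * (x + n)) = eu ((m:ℝ) ^ k * x) := by
  have : (m:ℝ) ^ k * (x + n) = (m:ℝ) ^ k * x + (((m:ℤ) ^ k * n : ℤ) : ℝ) := by push_cast; ring
  rw [this, eu_add_int]

lemma Gf_periodic (R X : ℕ) (x : ℝ) (n : ℤ) : Gf R X (x + n) = Gf R X x := by
  unfold Gf; simp_rw [eu_pow_periodic]

lemma CS_periodic (s : Finset ℕ) (w : ℕ → ℂ) (x : ℝ) (n : ℤ) : CS s w (x + n) = CS s w x := by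
  unfold CS; simp_rw [eu_pow_periodic]

lemma DK_periodic (M : ℕ) (x : ℝ) (n : ℤ) : DK M (x + n) = DK M x := by
  unfold DK
  refine Finset.sum_congr rfl fun m _ => ?_
  have := eu_pow_periodic m 1 x n
  simpa using this

/-- major arc condition -/
def Maj (z : ℝ) (N : ℕ) (α : ℝ) : Prop := ∃ q a : ℕ, ∃ n : ℤ, 0 < q ∧ (q:ℝ) ≤ z ^ 100 ∧ a < q ∧
  Nat.Coprime a q ∧ |q * (α - n) - a| ≤ z ^ 100 / N

/-- major arc majorant -/
def HII (z : ℝ) (R A N : ℕ) (α : ℝ) : ℝ := (A:ℝ) ^ 4 + 8528 * N * (4 / ((A ^ 2 : ℕ) : ℝ) ^ 2) *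
  ∑ q ∈ Finset.Icc 1 ⌊z ^ 100⌋₊, ∑ a ∈ (range q).filter (fun a => Nat.Coprime a q),
    sig q * ‖EE R q (psi 3 q a)‖ ^ 4 *
      (‖DK (A ^ 2) (α - a / q)‖ ^ 2 * ‖V3 A (α - a / q)‖ ^ 4)

lemma inv_le_sig {q : ℕ} (hq : 0 < q) : 1 / (q:ℝ) ≤ sig q := by
  unfold sig
  have h1 := one_le_dv hq
  have h2 := cast_log_nonneg q
  gcongr
  have : 1 ≤ dv q ^ 4 := one_le_pow₀ h1
  nlinarith

lemma Par.sig_le (P : Par z R A X N) {q : ℕ} (hq : 0 < q) (hqN : q ≤ N) : sig q ≤ z ^ 5 := by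
  unfold sig
  have h1 := P.logq hq hqN
  have h2 := P.hdv q hq.ne' (hqN.trans (Nat.le_self_pow (by norm_num) _))
  have h3 := dv_nonneg q
  have h4 := cast_log_nonneg q
  have hqR : (1:ℝ) ≤ q := by exact_mod_cast hq
  have := P.z0
  refine (div_le_self (by positivity) hqR).trans ?_
  calc _ ≤ z ^ 4 * z := by gcongr
    _ = _ := by ring

lemma add_pow_four_le (x y : ℝ) : (x + y) ^ 4 ≤ 8 * (x ^ 4 + y ^ 4) := by
  have h1 : (x + y) ^ 2 ≤ 2 * (x ^ 2 + y ^ 2) := by nlinarith [sq_nonneg (x - y)]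
  have h2 : ((x + y) ^ 2) ^ 2 ≤ (2 * (x ^ 2 + y ^ 2)) ^ 2 := by gcongr
  nlinarith [sq_nonneg (x ^ 2 - y ^ 2)]

lemma Par.maj_pt (P : Par z R A X N) (α : ℝ) (h : Maj z N α) :
    ‖Gf R X α‖ ^ 2 * ‖Ff R A α‖ ^ 4 ≤ HII z R A N α := by
  obtain ⟨q, a, n, hq, hqz, haq, hco, hn⟩ := h
  have hz := P.hz
  have hz1 := P.z1
  have hz0 := P.z0
  have hR := P.hR
  have hR1 := P.hR1
  have hA1 := P.A1
  have hAN := P.AN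
  have hNA := P.NA
  have hXN := P.XN
  have hN0 : (0:ℝ) < N := by exact_mod_cast P.N0
  have hqR : (1:ℝ) ≤ q := by exact_mod_cast hq
  have hAN1 : (A:ℝ) ≤ N := le_trans (le_self_pow₀ hA1 (by norm_num)) hAN
  have hqN : q ≤ N := by
    have : (q:ℝ) ≤ N := hqz.trans ((P.zA (by norm_num)).trans hAN1)
    exact_mod_cast this
  set β := α - n - a / q with hβ
  have hqβ : (q:ℝ) * |β| ≤ z ^ 100 / N := by
    have : (q:ℝ) * (α - n) - a = q * β := by rw [hβ]; field_simp
    rw [this, abs_mul, Nat.abs_cast] at hn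
    exact hn
  have hqβN : (q:ℝ) * |β| * N ≤ z ^ 100 := by rwa [le_div_iff₀ hN0] at hqβ
  have hpi := Real.pi_lt_four
  have hpi0 := Real.pi_pos
  have eα : α = (a / q + β) + n := by rw [hβ]; ring
  have eα' : α - a / q = β + n := by rw [hβ]; ring
  have eG : Gf R X α = Gf R X (a / q + β) := by
    conv_lhs => rw [eα]
    exact Gf_periodic _ _ _ _
  have eF : Ff R A α = Ff R A (a / q + β) := by
    conv_lhs => rw [eα]
    exact CS_periodic _ _ _ _
  have eD : DK (A ^ 2) (α - a / q) = DK (A ^ 2) β := by rw [eα', DK_periodic]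
  have eV : V3 A (α - a / q) = V3 A β := by rw [eα']; exact CS_periodic _ _ _ _
  have z105 : z * z ^ 104 = z ^ 105 := by ring
  -- G
  have hG1 := G_major P.hR1 hq a X β
  have hGerr : 2 * (q:ℝ) * R ^ 4 * (1 + 2 * Real.pi * |β| * (X:ℝ) ^ 2) ≤ z ^ 105 := by
    calc _ = 2 * (R:ℝ) ^ 4 * (q + 2 * Real.pi * (q * |β| * X ^ 2)) := by ring
      _ ≤ 2 * z ^ 4 * (z ^ 100 + 2 * 4 * (q * |β| * (4 * N))) := by gcongr
      _ = 2 * z ^ 4 * (z ^ 100 + 32 * (q * |β| * N)) := by ring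
      _ ≤ 2 * z ^ 4 * (z ^ 100 + 32 * z ^ 100) := by gcongr
      _ = 66 * z ^ 104 := by ring
      _ ≤ z * z ^ 104 := by gcongr; linarith
      _ = _ := z105
  have hsig := inv_le_sig hq
  have hsig0 := sig_nonneg q
  have hzN : z ^ 210 ≤ N * sig q := by
    have h1 : z ^ 310 ≤ (N:ℝ) := (P.zA (by norm_num)).trans hAN1
    have h2 : 1 / z ^ 100 ≤ sig q := le_trans (by gcongr) hsig
    calc z ^ 210 = z ^ 310 * (1 / z ^ 100) := by field_simp
      _ ≤ _ := by gcongr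
  have hE2 := E2_le hR1 hq hco
  have hG : ‖Gf R X α‖ ^ 2 ≤ 1066 * (N * sig q) := by
    rw [eG]
    have h1 : ‖Gf R X (a / q + β)‖ ≤ ‖EE R q (psi 2 q a)‖ * X + z ^ 105 := by linarith
    calc _ ≤ (‖EE R q (psi 2 q a)‖ * X + z ^ 105) ^ 2 := by gcongr
      _ ≤ 2 * ((‖EE R q (psi 2 q a)‖ * X) ^ 2 + (z ^ 105) ^ 2) := by
          nlinarith [sq_nonneg (‖EE R q (psi 2 q a)‖ * X - z ^ 105)]
      _ = 2 * (‖EE R q (psi 2 q a)‖ ^ 2 * X ^ 2 + z ^ 210) := by ring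
      _ ≤ 2 * (133 * sig q * (4 * N) + N * sig q) := by
          unfold sig at *
          gcongr
      _ = _ := by ring
  -- F
  have hF1 := F_major P.hR1 hq a A β
  have hFerr : 4 * (q:ℝ) * R ^ 4 * (1 + 2 * Real.pi * |β| * (2 * A : ℝ) ^ 3) ≤ z ^ 105 := by
    calc _ = 4 * (R:ℝ) ^ 4 * (q + 16 * Real.pi * (q * |β| * A ^ 3)) := by ring
      _ ≤ 4 * z ^ 4 * (z ^ 100 + 16 * 4 * (q * |β| * N)) := by gcongr
      _ ≤ 4 * z ^ 4 * (z ^ 100 + 16 * 4 * z ^ 100) := by gcongr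
      _ = 260 * z ^ 104 := by ring
      _ ≤ z * z ^ 104 := by gcongr; linarith
      _ = _ := z105
  have hF : ‖Ff R A α‖ ^ 4 ≤ 8 * (‖EE R q (psi 3 q a)‖ ^ 4 * ‖V3 A β‖ ^ 4 + z ^ 420) := by
    rw [eF]
    have h1 : ‖Ff R A (a / q + β)‖ ≤ ‖EE R q (psi 3 q a)‖ * ‖V3 A β‖ + z ^ 105 := by linarith
    calc _ ≤ (‖EE R q (psi 3 q a)‖ * ‖V3 A β‖ + z ^ 105) ^ 4 := by gcongr
      _ ≤ 8 * ((‖EE R q (psi 3 q a)‖ * ‖V3 A β‖) ^ 4 + (z ^ 105) ^ 4) := add_pow_four_le _ _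
      _ = _ := by ring
  -- kernel
  have hker : 1 ≤ 4 / ((A ^ 2 : ℕ) : ℝ) ^ 2 * ‖DK (A ^ 2) β‖ ^ 2 := by
    refine DK_low _ (pow_pos P.A0 2) _ ?_
    have h0 := dn_le β 0
    rw [Int.cast_zero, sub_zero] at h0
    refine h0.trans ?_
    have h1 : |β| ≤ z ^ 100 / N := by
      refine le_trans ?_ hqβ
      exact le_mul_of_one_le_left (abs_nonneg _) hqR
    refine h1.trans ?_
    push_cast
    rw [div_le_div_iff₀ hN0 (by positivity)]
    have h2 : z ^ 101 ≤ (A:ℝ) := P.zA (by norm_num)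
    have h3 : 16 * z ^ 100 ≤ z ^ 101 := by
      calc _ ≤ z * z ^ 100 := by gcongr; linarith
        _ = _ := by ring
    calc z ^ 100 * (16 * (A:ℝ) ^ 2) = (16 * z ^ 100) * (A:ℝ) ^ 2 := by ring
      _ ≤ (A:ℝ) * (A:ℝ) ^ 2 := by gcongr; linarith
      _ = (A:ℝ) ^ 3 := by ring
      _ ≤ 1 * N := by linarith
  have hsecond : 8528 * (N * sig q) * z ^ 420 ≤ (A:ℝ) ^ 4 := by
    have h1 := P.sig_le hq hqN
    have h2 : z ^ 426 ≤ (A:ℝ) := P.zA (by norm_num)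
    calc _ ≤ 8528 * ((17 * (A:ℝ) ^ 3) * z ^ 5) * z ^ 420 := by gcongr
      _ = 144976 * z ^ 425 * A ^ 3 := by ring
      _ ≤ z * z ^ 425 * A ^ 3 := by gcongr; linarith
      _ = z ^ 426 * A ^ 3 := by ring
      _ ≤ A * A ^ 3 := by gcongr
      _ = _ := by ring
  have hterm : sig q * ‖EE R q (psi 3 q a)‖ ^ 4 * (‖DK (A ^ 2) β‖ ^ 2 * ‖V3 A β‖ ^ 4) ≤
      ∑ q ∈ Finset.Icc 1 ⌊z ^ 100⌋₊, ∑ a ∈ (range q).filter (fun a => Nat.Coprime a q),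
        sig q * ‖EE R q (psi 3 q a)‖ ^ 4 *
        (‖DK (A ^ 2) (α - a / q)‖ ^ 2 * ‖V3 A (α - a / q)‖ ^ 4) := by
    rw [← eD, ← eV]
    have hpos : ∀ q a : ℕ, 0 ≤ sig q * ‖EE R q (psi 3 q a)‖ ^ 4 *
        (‖DK (A ^ 2) (α - a / q)‖ ^ 2 * ‖V3 A (α - a / q)‖ ^ 4) := by
      intro q a
      have := sig_nonneg q
      positivity
    refine le_trans ?_ (Finset.single_le_sum (f := fun q : ℕ =>
      ∑ a ∈ (range q).filter (fun a => Nat.Coprime a q),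
        sig q * ‖EE R q (psi 3 q a)‖ ^ 4 *
        (‖DK (A ^ 2) (α - a / q)‖ ^ 2 * ‖V3 A (α - a / q)‖ ^ 4))
      (fun q _ => Finset.sum_nonneg fun a _ => hpos q a)
      (Finset.mem_Icc.2 ⟨hq, Nat.le_floor hqz⟩))
    exact Finset.single_le_sum (f := fun a : ℕ => sig q * ‖EE R q (psi 3 q a)‖ ^ 4 *
        (‖DK (A ^ 2) (α - a / q)‖ ^ 2 * ‖V3 A (α - a / q)‖ ^ 4)) (fun a _ => hpos q a)
        (Finset.mem_filter.2 ⟨Finset.mem_range.2 haq, hco⟩)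
  set W := ‖EE R q (psi 3 q a)‖ ^ 4 * ‖V3 A β‖ ^ 4 with hW
  have hW0 : 0 ≤ W := by positivity
  set KK := 4 / ((A ^ 2 : ℕ) : ℝ) ^ 2 with hKK
  have hKK0 : 0 ≤ KK := by positivity
  calc _ ≤ 1066 * (N * sig q) * (8 * (W + z ^ 420)) := by gcongr
    _ = 8528 * (N * sig q) * z ^ 420 + 8528 * (N * sig q) * W * 1 := by ring
    _ ≤ (A:ℝ) ^ 4 + 8528 * (N * sig q) * W * (KK * ‖DK (A ^ 2) β‖ ^ 2) := by gcongr
    _ = (A:ℝ) ^ 4 + 8528 * N * KK * (sig q * ‖EE R q (psi 3 q a)‖ ^ 4 *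
        (‖DK (A ^ 2) β‖ ^ 2 * ‖V3 A β‖ ^ 4)) := by rw [hW]; ring
    _ ≤ _ := by
        unfold HII
        gcongr

lemma integral_shift (f : ℝ → ℝ) (hf : Function.Periodic f 1) (c : ℝ) :
    ∫ α in (0:ℝ)..1, f (α - c) = ∫ α in (0:ℝ)..1, f α := by
  rw [intervalIntegral.integral_comp_sub_right]
  have := hf.intervalIntegral_add_eq (0 - c) 0
  simp only [zero_add] at this
  rw [← this]; congr 1; ring

lemma Par.int_HII (P : Par z R A X N) (C : ℝ)
    (hC : ∀ R Q : ℕ, 1 ≤ R → ∑ q ∈ Finset.Icc 1 Q, (sig q *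
    ∑ a ∈ (range q).filter (fun a => Nat.Coprime a q), ‖EE R q (psi 3 q a)‖ ^ 4) ≤ C) :
    ∫ α in (0:ℝ)..1, HII z R A N α ≤ (1 + 8528 * 17 * 8 * C) * (A:ℝ) ^ 4 := by
  have hA1 := P.A1
  have hA0 : (0:ℝ) < A := by linarith
  have hI : ∀ q a : ℕ, ∫ α in (0:ℝ)..1, sig q * ‖EE R q (psi 3 q a)‖ ^ 4 *
      (‖DK (A ^ 2) (α - a / q)‖ ^ 2 * ‖V3 A (α - a / q)‖ ^ 4) ≤
      sig q * ‖EE R q (psi 3 q a)‖ ^ 4 * (2 * (A:ℝ) ^ 5) := by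
    intro q a
    rw [intervalIntegral.integral_const_mul]
    have := sig_nonneg q
    gcongr
    rw [integral_shift (fun β => ‖DK (A ^ 2) β‖ ^ 2 * ‖V3 A β‖ ^ 4)]
    · refine (D3_bound A (A ^ 2) P.A0).trans (le_of_eq ?_)
      push_cast; field_simp; norm_num
    · intro x
      have h1 := DK_periodic (A ^ 2) x 1
      have h2 := CS_periodic (Finset.Ico A (2 * A)) (fun _ => 1) x 1
      rw [Int.cast_one] at h1 h2
      unfold V3
      dsimp only
      rw [h1, h2]
  have hcont : ∀ q a : ℕ, IntervalIntegrable (fun α : ℝ => sig q * ‖EE R q (psi 3 q a)‖ ^ 4 *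
      (‖DK (A ^ 2) (α - a / q)‖ ^ 2 * ‖V3 A (α - a / q)‖ ^ 4)) volume 0 1 := fun q a =>
    Continuous.intervalIntegrable (by fun_prop) _ _
  have hcont2 : ∀ q : ℕ, IntervalIntegrable (fun α : ℝ =>
      ∑ a ∈ (range q).filter (fun a => Nat.Coprime a q), sig q * ‖EE R q (psi 3 q a)‖ ^ 4 *
      (‖DK (A ^ 2) (α - a / q)‖ ^ 2 * ‖V3 A (α - a / q)‖ ^ 4)) volume 0 1 := fun q =>
    Continuous.intervalIntegrable (by fun_prop) _ _
  unfold HII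
  rw [intervalIntegral.integral_add (by simp) (Continuous.intervalIntegrable (by fun_prop) _ _),
    intervalIntegral.integral_const_mul, intervalIntegral.integral_finsetSum (fun q _ => hcont2 q)]
  simp_rw [intervalIntegral.integral_finsetSum (fun a _ => hcont _ a)]
  have hsum : ∑ q ∈ Finset.Icc 1 ⌊z ^ 100⌋₊, ∑ a ∈ (range q).filter (fun a => Nat.Coprime a q),
      ∫ α in (0:ℝ)..1, sig q * ‖EE R q (psi 3 q a)‖ ^ 4 *
      (‖DK (A ^ 2) (α - a / q)‖ ^ 2 * ‖V3 A (α - a / q)‖ ^ 4) ≤ C * (2 * (A:ℝ) ^ 5) := by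
    calc _ ≤ ∑ q ∈ Finset.Icc 1 ⌊z ^ 100⌋₊, ∑ a ∈ (range q).filter (fun a => Nat.Coprime a q),
        sig q * ‖EE R q (psi 3 q a)‖ ^ 4 * (2 * (A:ℝ) ^ 5) :=
          Finset.sum_le_sum fun q _ => Finset.sum_le_sum fun a _ => hI q a
      _ = (∑ q ∈ Finset.Icc 1 ⌊z ^ 100⌋₊, (sig q *
          ∑ a ∈ (range q).filter (fun a => Nat.Coprime a q), ‖EE R q (psi 3 q a)‖ ^ 4)) *
            (2 * (A:ℝ) ^ 5) := by
          rw [Finset.sum_mul]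
          refine Finset.sum_congr rfl fun q _ => ?_
          rw [Finset.mul_sum, Finset.sum_mul]
      _ ≤ _ := by gcongr; exact hC R _ P.hR1
  have hnn : 0 ≤ ∑ q ∈ Finset.Icc 1 ⌊z ^ 100⌋₊, ∑ a ∈ (range q).filter (fun a => Nat.Coprime a q),
      ∫ α in (0:ℝ)..1, sig q * ‖EE R q (psi 3 q a)‖ ^ 4 *
      (‖DK (A ^ 2) (α - a / q)‖ ^ 2 * ‖V3 A (α - a / q)‖ ^ 4) :=
    Finset.sum_nonneg fun q _ => Finset.sum_nonneg fun a _ =>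
      intervalIntegral.integral_nonneg (by norm_num) fun _ _ => by
        have := sig_nonneg q
        positivity
  have hC0 : 0 ≤ C := by simpa using hC R 0 P.hR1
  have hNA := P.NA
  calc _ ≤ (A:ℝ) ^ 4 + 8528 * (17 * (A:ℝ) ^ 3) * (4 / ((A ^ 2 : ℕ) : ℝ) ^ 2) * (C * (2 * (A:ℝ) ^ 5)) := by
        simp only [intervalIntegral.integral_const, sub_zero, one_smul]
        gcongr
    _ = _ := by push_cast; field_simp; ring
end

section
variable {z : ℝ} {R A X N : ℕ}

lemma Par.nu_norm (P : Par z R A X N) (n : ℕ) : ‖(nu R n : ℂ)‖ ≤ z ^ 2 := by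
  rw [Complex.norm_real, Real.norm_of_nonneg (nu_nonneg _ _)]
  have := P.hR
  refine (nu_le P.hR1 n).trans ?_
  gcongr

lemma Par.N2 (P : Par z R A X N) {u : ℕ} (hu : u ≤ 16 * A ^ 3) : u ≤ N ^ 2 := by
  have h1 := P.hAN
  have h2 : 16 ≤ N := by
    have := P.A10
    have h3 : A ≤ A ^ 3 := Nat.le_self_pow (by norm_num) _
    omega
  calc u ≤ 16 * A ^ 3 := hu
    _ ≤ N * N := Nat.mul_le_mul h2 h1
    _ = N ^ 2 := by ring

lemma Par.four (P : Par z R A X N) (s : Finset ℕ) (hs : s ⊆ Finset.Ico A (2 * A)) (w : ℕ → ℂ) (B : ℝ)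
    (hB0 : 0 ≤ B) (hB : ∀ n ∈ s, ‖w n‖ ≤ B) :
    ∫ α in (0:ℝ)..1, ‖CS s w α‖ ^ 4 ≤ 2 * z * B ^ 4 * (A:ℝ) ^ 2 := by
  have hz0 := P.z0
  have hA0 := P.A0
  have hc : s.card ≤ A := by
    have := Finset.card_le_card hs
    rw [Nat.card_Ico] at this
    omega
  have hcR : (s.card : ℝ) ≤ A := by exact_mod_cast hc
  refine (four_moment s w B z ?_ hB hB0 ?_).trans ?_
  · intro n hn
    have := Finset.mem_Ico.1 (hs hn)
    omega
  · intro x hx y hy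
    have h1 := Finset.mem_Ico.1 (hs hx)
    have h2 := Finset.mem_Ico.1 (hs hy)
    have h3 : x ^ 3 ≤ (2 * A) ^ 3 := Nat.pow_le_pow_left h1.2.le 3
    have h4 : y ^ 3 ≤ (2 * A) ^ 3 := Nat.pow_le_pow_left h2.2.le 3
    have h5 : 0 < x ^ 3 := pow_pos (by omega) 3
    have h6 : (2 * A) ^ 3 = 8 * A ^ 3 := by ring
    exact P.hdv _ (by omega) (P.N2 (by omega))
  · gcongr

lemma Par.D2 (P : Par z R A X N) (Q M : ℕ) :
    ∑ q ∈ Finset.Icc 1 Q, ∫ α in (0:ℝ)..1, ‖DK M (q * α)‖ ^ 2 * ‖Ff R A α‖ ^ 2 ≤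
      z ^ 4 * (M * (A * Q + (A:ℝ) ^ 2 * z)) := by
  have hz0 := P.z0
  have hA0 := P.A0
  have := D2_bound (Finset.Ico A (2 * A)) (fun n => (nu R n : ℂ)) (z ^ 2) z Q M
    (fun n _ => P.nu_norm n) (by positivity) hz0.le ?_
  · refine this.trans (le_of_eq ?_)
    rw [Nat.card_Ico]
    have : 2 * A - A = A := by omega
    rw [this]; ring
  · intro x hx y hy hxy
    have h1 := Finset.mem_Ico.1 hx
    have h2 := Finset.mem_Ico.1 hy
    have h3 : x ^ 3 ≤ (2 * A) ^ 3 := Nat.pow_le_pow_left h1.2.le 3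
    have h4 : y ^ 3 ≤ (2 * A) ^ 3 := Nat.pow_le_pow_left h2.2.le 3
    have h6 : (2 * A) ^ 3 = 8 * A ^ 3 := by ring
    have h7 : x ^ 3 ≠ y ^ 3 := fun h => hxy (Nat.pow_left_injective (n := 3) (by norm_num) h)
    have e1 : ((x:ℤ) ^ 3 - (y:ℤ) ^ 3) = ((x ^ 3 : ℕ) : ℤ) - ((y ^ 3 : ℕ) : ℤ) := by push_cast; ring
    rw [e1]
    exact P.hdv _ (by omega) (P.N2 (by omega))

lemma Par.nonmaj_F (P : Par z R A X N) (α : ℝ) (h : ¬ Maj z N α) :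
    ‖Ff R A α‖ ^ 2 ≤ (A:ℝ) ^ 2 / z ^ 44 := by
  have hz := P.hz
  have hz1 := P.z1
  have hz0 := P.z0
  have hA1 := P.A1
  have hA0 : (0:ℝ) < A := by linarith
  have hN0 : (0:ℝ) < N := by exact_mod_cast P.N0
  have hAN := P.AN
  have hNA := P.NA
  have hzN : z ^ 100 ≤ (N:ℝ) := (P.zA (by norm_num)).trans
    ((le_self_pow₀ hA1 (by norm_num)).trans hAN)
  have hn : 0 < ⌊(N:ℝ) / z ^ 100⌋₊ := by
    rw [Nat.floor_pos, le_div_iff₀ (by positivity)]; linarith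
  obtain ⟨q, a, hq, hqn, hco, h1, h2⟩ := dirichlet α _ hn
  have hqR : (0:ℝ) < q := by exact_mod_cast hq
  have hq1 : (q:ℝ) ≤ N / z ^ 100 := (Nat.le_floor_iff (by positivity)).1 hqn
  have h3 : |q * α - a| ≤ z ^ 100 / N := by
    refine h1.trans ?_
    have h4 := Nat.lt_floor_add_one ((N:ℝ) / z ^ 100)
    calc 1 / ((⌊(N:ℝ) / z ^ 100⌋₊ : ℝ) + 1) ≤ 1 / ((N:ℝ) / z ^ 100) := by gcongr
      _ = _ := by field_simp
  have hq2 : z ^ 100 < q := by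
    by_contra hcon
    push Not at hcon
    apply h
    have hqz : (q:ℤ) ≠ 0 := by exact_mod_cast hq.ne'
    have hm0 := Int.emod_nonneg a hqz
    have hmlt := Int.emod_lt_of_pos a (by exact_mod_cast hq : (0:ℤ) < q)
    have hme : ((a % q).toNat : ℤ) = a % q := Int.toNat_of_nonneg hm0
    refine ⟨q, (a % q).toNat, a / q, hq, hcon, by omega, ?_, ?_⟩
    · rw [← Nat.isCoprime_iff_coprime, hme]
      have e := Int.emod_add_mul_ediv a q
      have : IsCoprime (a % q + (q:ℤ) * (a / q)) (q:ℤ) := by rw [e]; exact hco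
      exact IsCoprime.of_add_mul_left_left this
    · have e := Int.emod_add_mul_ediv a q
      have e2 : ((a % q : ℤ):ℝ) + q * ((a / q : ℤ) : ℝ) = a := by exact_mod_cast e
      have e3 : (((a % q).toNat : ℕ) : ℝ) = ((a % q : ℤ) : ℝ) := by exact_mod_cast hme
      rw [e3]
      have : (q:ℝ) * (α - ((a / q : ℤ) : ℝ)) - ((a % q : ℤ):ℝ) = q * α - a := by rw [← e2]; ring
      rw [this]; exact h3
  have hqN : q ≤ N := by
    have : (q:ℝ) ≤ N := hq1.trans (div_le_self hN0.le (one_le_pow₀ hz1))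
    exact_mod_cast this
  have hF := P.F_minor hq hqN a hco α h2
  have hA101 : z ^ 100 ≤ (A:ℝ) := P.zA (by norm_num)
  have hF4 : ‖Ff R A α‖ ^ 4 ≤ ((A:ℝ) ^ 2 / z ^ 44) ^ 2 := by
    have e1 : (A:ℝ) ^ 3 ≤ A ^ 4 / z ^ 100 := by
      rw [le_div_iff₀ (by positivity)]
      calc (A:ℝ) ^ 3 * z ^ 100 ≤ A ^ 3 * A := by gcongr
        _ = _ := by ring
    have e2 : (A:ℝ) * q ≤ 17 * (A ^ 4 / z ^ 100) := by
      calc (A:ℝ) * q ≤ A * (17 * A ^ 3 / z ^ 100) := by gcongr; exact hq1.trans (by gcongr)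
        _ = _ := by ring
    have e3 : (A:ℝ) ^ 4 / q ≤ A ^ 4 / z ^ 100 := by gcongr
    calc _ ≤ z ^ 11 * (19 * ((A:ℝ) ^ 4 / z ^ 100)) := by
          refine hF.trans ?_
          gcongr
          linarith
      _ = 19 * (z ^ 11 * ((A:ℝ) ^ 4 / z ^ 100)) := by ring
      _ ≤ z * (z ^ 11 * ((A:ℝ) ^ 4 / z ^ 100)) := by gcongr; linarith
      _ = _ := by field_simp
  have : (‖Ff R A α‖ ^ 2) ^ 2 ≤ ((A:ℝ) ^ 2 / z ^ 44) ^ 2 := by rw [← pow_mul]; exact hF4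
  exact le_of_sq_le_sq this (by positivity)

lemma Par.G_sup (P : Par z R A X N) (α : ℝ) : ‖Gf R X α‖ ^ 2 ≤ 4 * z ^ 4 * N := by
  have hz0 := P.z0
  have h : ‖Gf R X α‖ ≤ X * z ^ 2 := by
    unfold Gf
    refine (norm_sum_le _ _).trans ?_
    calc _ ≤ ∑ n ∈ range X, z ^ 2 := Finset.sum_le_sum fun n _ => by
          rw [norm_mul, norm_eu, mul_one]; exact P.nu_norm n
      _ = _ := by simp
  have := P.XN
  calc _ ≤ ((X:ℝ) * z ^ 2) ^ 2 := by gcongr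
    _ = z ^ 4 * X ^ 2 := by ring
    _ ≤ z ^ 4 * (4 * N) := by gcongr
    _ = _ := by ring

/-- minor arc majorant at level `l` -/
def MT (z : ℝ) (R A N : ℕ) (l : ℝ) (α : ℝ) : ℝ :=
  2 * l * ((A:ℝ) ^ 2 / z ^ 44) * (4 / (⌊l / (64 * z ^ 6)⌋₊ : ℝ) ^ 2) *
    ∑ q ∈ Finset.Icc 1 ⌊8 * z ^ 6 * N / l⌋₊,
      ‖DK ⌊l / (64 * z ^ 6)⌋₊ (q * α)‖ ^ 2 * ‖Ff R A α‖ ^ 2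

lemma Par.l0 (P : Par z R A X N) {l : ℝ} (hl : (A:ℝ) ^ 2 ≤ l * z ^ 10) : 0 < l := by
  have hz0 := P.z0
  have hA1 := P.A1
  have : 0 < l * z ^ 10 := lt_of_lt_of_le (by positivity) hl
  exact pos_of_mul_pos_left this (by positivity)

lemma Par.lbig (P : Par z R A X N) {l : ℝ} (hl : (A:ℝ) ^ 2 ≤ l * z ^ 10) : z ^ 20 ≤ l := by
  have hz0 := P.z0
  have hA1 := P.A1
  have h1 : z ^ 30 ≤ (A:ℝ) := P.zA (by norm_num)
  have h2 : (A:ℝ) ≤ A ^ 2 := le_self_pow₀ hA1 (by norm_num)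
  have h3 : z ^ 20 * z ^ 10 ≤ l * z ^ 10 := by
    calc z ^ 20 * z ^ 10 = z ^ 30 := by ring
      _ ≤ _ := by linarith
  exact le_of_mul_le_mul_right h3 (by positivity)

lemma Par.z6l (P : Par z R A X N) {l : ℝ} (hl : (A:ℝ) ^ 2 ≤ l * z ^ 10) : 64 * z ^ 6 ≤ l := by
  have hz0 := P.z0
  have hz1 := P.z1
  have hz := P.hz
  have h := P.lbig hl
  calc 64 * z ^ 6 ≤ z * z ^ 6 := by gcongr; linarith
    _ = z ^ 7 := by ring
    _ ≤ z ^ 20 := pow_le_pow_right₀ hz1 (by norm_num)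
    _ ≤ l := h

lemma Par.MT_nonneg (P : Par z R A X N) {l : ℝ} (hl : (A:ℝ) ^ 2 ≤ l * z ^ 10) (α : ℝ) :
    0 ≤ MT z R A N l α := by
  have hz0 := P.z0
  have := P.l0 hl
  unfold MT
  have : 0 ≤ ∑ q ∈ Finset.Icc 1 ⌊8 * z ^ 6 * N / l⌋₊,
      ‖DK ⌊l / (64 * z ^ 6)⌋₊ (q * α)‖ ^ 2 * ‖Ff R A α‖ ^ 2 :=
    Finset.sum_nonneg fun _ _ => by positivity
  positivity

@[fun_prop]
lemma continuous_MT (z : ℝ) (R A N : ℕ) (l : ℝ) : Continuous (MT z R A N l) := by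
  unfold MT; fun_prop

lemma Par.MT_pt (P : Par z R A X N) {l : ℝ} (hl : (A:ℝ) ^ 2 ≤ l * z ^ 10) (α : ℝ)
    (hM : ¬ Maj z N α) (h1 : l < ‖Gf R X α‖ ^ 2) (h2 : ‖Gf R X α‖ ^ 2 ≤ 2 * l) :
    ‖Gf R X α‖ ^ 2 * ‖Ff R A α‖ ^ 4 ≤ MT z R A N l α := by
  have hz := P.hz
  have hz1 := P.z1
  have hz0 := P.z0
  have hA1 := P.A1
  have hN0 : (0:ℝ) < N := by exact_mod_cast P.N0
  have hl0 := P.l0 hl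
  have h64 := P.z6l hl
  have hn : 0 < ⌊l / (4 * z ^ 6)⌋₊ := by
    rw [Nat.floor_pos, le_div_iff₀ (by positivity)]; nlinarith [pow_pos hz0 6]
  have hMp : 0 < ⌊l / (64 * z ^ 6)⌋₊ := by
    rw [Nat.floor_pos, le_div_iff₀ (by positivity)]; linarith
  obtain ⟨q, a, hq, hqn, hco, h3, h4⟩ := dirichlet α _ hn
  have hqR : (0:ℝ) < q := by exact_mod_cast hq
  have hq1 : (q:ℝ) ≤ l / (4 * z ^ 6) := (Nat.le_floor_iff (by positivity)).1 hqn
  have hqN : q ≤ N := by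
    have hs := P.G_sup α
    have : (q:ℝ) ≤ N := by
      refine hq1.trans ?_
      rw [div_le_iff₀ (by positivity)]
      have : z ^ 4 ≤ z ^ 6 := pow_le_pow_right₀ hz1 (by norm_num)
      calc l ≤ 4 * z ^ 4 * N := by linarith
        _ ≤ 4 * z ^ 6 * N := by gcongr
        _ = _ := by ring
    exact_mod_cast this
  have hG := P.G_minor hq hqN a hco α h4
  have hX : z ^ 6 * X ≤ l / 4 := by
    have e : (4 * z ^ 16 * X) ^ 2 ≤ ((A:ℝ) ^ 2) ^ 2 := by
      have hXN := P.XN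
      have hNA := P.NA
      have h5 : z ^ 33 ≤ (A:ℝ) := P.zA (by norm_num)
      calc (4 * z ^ 16 * X) ^ 2 = 16 * z ^ 32 * X ^ 2 := by ring
        _ ≤ 16 * z ^ 32 * (4 * (17 * A ^ 3)) := by gcongr; linarith
        _ = 1088 * (z ^ 32 * (A:ℝ) ^ 3) := by ring
        _ ≤ z * (z ^ 32 * (A:ℝ) ^ 3) := by gcongr; linarith
        _ = z ^ 33 * A ^ 3 := by ring
        _ ≤ A * (A:ℝ) ^ 3 := by gcongr
        _ = _ := by ring
    have e2 := le_of_sq_le_sq e (by positivity)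
    have e3 : (4 * (z ^ 6 * X)) * z ^ 10 ≤ l * z ^ 10 := by
      calc _ = 4 * z ^ 16 * X := by ring
        _ ≤ _ := by linarith
    have := le_of_mul_le_mul_right e3 (by positivity)
    linarith
  have hq6 : z ^ 6 * q ≤ l / 4 := by
    rw [le_div_iff₀ (by positivity)] at hq1
    linarith
  have hqQ : (q:ℝ) ≤ 8 * z ^ 6 * N / l := by
    have e : l / 2 < z ^ 6 * X ^ 2 / q := by
      have : z ^ 6 * ((X:ℝ) ^ 2 / q + X + q) = z ^ 6 * X ^ 2 / q + z ^ 6 * X + z ^ 6 * q := by ring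
      linarith
    rw [lt_div_iff₀ hqR] at e
    rw [le_div_iff₀ hl0]
    have hXN := P.XN
    have : z ^ 6 * (X:ℝ) ^ 2 ≤ z ^ 6 * (4 * N) := by gcongr
    linarith
  have hdn : dn (q * α) ≤ 1 / (16 * (⌊l / (64 * z ^ 6)⌋₊ : ℝ)) := by
    refine (dn_le _ a).trans (h3.trans ?_)
    have e1 := Nat.lt_floor_add_one (l / (4 * z ^ 6))
    have e2 : (⌊l / (64 * z ^ 6)⌋₊ : ℝ) ≤ l / (64 * z ^ 6) := Nat.floor_le (by positivity)
    have hMR : (0:ℝ) < (⌊l / (64 * z ^ 6)⌋₊ : ℝ) := by exact_mod_cast hMp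
    gcongr
    calc 16 * (⌊l / (64 * z ^ 6)⌋₊ : ℝ) ≤ 16 * (l / (64 * z ^ 6)) := by gcongr
      _ = l / (4 * z ^ 6) := by field_simp; norm_num
      _ ≤ _ := e1.le
  have hker := DK_low _ hMp _ hdn
  have hF := P.nonmaj_F α hM
  have hterm : ‖DK ⌊l / (64 * z ^ 6)⌋₊ (q * α)‖ ^ 2 * ‖Ff R A α‖ ^ 2 ≤
    ∑ q ∈ Finset.Icc 1 ⌊8 * z ^ 6 * N / l⌋₊,
      ‖DK ⌊l / (64 * z ^ 6)⌋₊ (q * α)‖ ^ 2 * ‖Ff R A α‖ ^ 2 :=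
    Finset.single_le_sum (f := fun q : ℕ => ‖DK ⌊l / (64 * z ^ 6)⌋₊ (q * α)‖ ^ 2 * ‖Ff R A α‖ ^ 2)
      (fun _ _ => by positivity) (Finset.mem_Icc.2 ⟨hq, Nat.le_floor hqQ⟩)
  unfold MT
  calc _ = ‖Gf R X α‖ ^ 2 * ‖Ff R A α‖ ^ 2 * (1 * ‖Ff R A α‖ ^ 2) := by ring
    _ ≤ 2 * l * ((A:ℝ) ^ 2 / z ^ 44) * ((4 / (⌊l / (64 * z ^ 6)⌋₊ : ℝ) ^ 2 *
        ‖DK ⌊l / (64 * z ^ 6)⌋₊ (q * α)‖ ^ 2) * ‖Ff R A α‖ ^ 2) := by gcongr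
    _ = 2 * l * ((A:ℝ) ^ 2 / z ^ 44) * (4 / (⌊l / (64 * z ^ 6)⌋₊ : ℝ) ^ 2) *
        (‖DK ⌊l / (64 * z ^ 6)⌋₊ (q * α)‖ ^ 2 * ‖Ff R A α‖ ^ 2) := by ring
    _ ≤ _ := by gcongr

lemma Par.int_MT (P : Par z R A X N) {l : ℝ} (hl : (A:ℝ) ^ 2 ≤ l * z ^ 10) :
    ∫ α in (0:ℝ)..1, MT z R A N l α ≤ (A:ℝ) ^ 4 / z ^ 17 := by
  have hz := P.hz
  have hz1 := P.z1
  have hz0 := P.z0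
  have hA1 := P.A1
  have hA0 : (0:ℝ) < A := by linarith
  have hl0 := P.l0 hl
  have h64 := P.z6l hl
  have hNA := P.NA
  unfold MT
  rw [intervalIntegral.integral_const_mul, intervalIntegral.integral_finsetSum
    (fun q _ => Continuous.intervalIntegrable (by fun_prop) _ _)]
  have hD := P.D2 ⌊8 * z ^ 6 * N / l⌋₊ ⌊l / (64 * z ^ 6)⌋₊
  have hM : 1 ≤ ⌊l / (64 * z ^ 6)⌋₊ := by
    rw [Nat.one_le_floor_iff, le_div_iff₀ (by positivity)]; linarith
  have hMR : (1:ℝ) ≤ ⌊l / (64 * z ^ 6)⌋₊ := by exact_mod_cast hM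
  have hMl : l ≤ 128 * z ^ 6 * ⌊l / (64 * z ^ 6)⌋₊ := by
    have := Nat.lt_floor_add_one (l / (64 * z ^ 6))
    have h2 : l / (64 * z ^ 6) ≤ 2 * ⌊l / (64 * z ^ 6)⌋₊ := by linarith
    rw [div_le_iff₀ (by positivity)] at h2
    linarith
  have hQ : (⌊8 * z ^ 6 * N / l⌋₊ : ℝ) ≤ 136 * z ^ 16 * A := by
    refine (Nat.floor_le (by positivity)).trans ?_
    rw [div_le_iff₀ hl0]
    calc 8 * z ^ 6 * N ≤ 8 * z ^ 6 * (17 * (A:ℝ) ^ 3) := by gcongr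
      _ = 136 * z ^ 6 * A * (A:ℝ) ^ 2 := by ring
      _ ≤ 136 * z ^ 6 * A * (l * z ^ 10) := by gcongr
      _ = _ := by ring
  set M := (⌊l / (64 * z ^ 6)⌋₊ : ℝ)
  set Q := (⌊8 * z ^ 6 * N / l⌋₊ : ℝ)
  have hM0 : 0 < M := by linarith
  have hlM : l / M ≤ 128 * z ^ 6 := by rw [div_le_iff₀ hM0]; exact hMl
  have hz16 : z ≤ z ^ 16 := le_self_pow₀ hz1 (by norm_num)
  calc _ ≤ 2 * l * ((A:ℝ) ^ 2 / z ^ 44) * (4 / M ^ 2) * (z ^ 4 * (M * (A * Q + (A:ℝ) ^ 2 * z))) := by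
        gcongr
    _ = 8 * (l / M) * ((A:ℝ) ^ 2 / z ^ 40) * (A * Q + (A:ℝ) ^ 2 * z) := by field_simp; ring
    _ ≤ 8 * (128 * z ^ 6) * ((A:ℝ) ^ 2 / z ^ 40) * (A * (136 * z ^ 16 * A) + (A:ℝ) ^ 2 * z ^ 16) := by
        gcongr
    _ = 140288 * ((A:ℝ) ^ 4 / z ^ 18) := by field_simp; ring
    _ ≤ z * ((A:ℝ) ^ 4 / z ^ 18) := by gcongr; linarith
    _ = _ := by field_simp

lemma dyadic (x : ℝ) (hx : 1 < x) (J : ℕ) (hJ : x ≤ 2 ^ J) :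
    ∃ j < J, 2 ^ j < x ∧ x ≤ 2 * 2 ^ j := by
  induction J with
  | zero => simp at hJ; linarith
  | succ J ih =>
    by_cases h : x ≤ 2 ^ J
    · obtain ⟨j, hj, h2⟩ := ih h
      exact ⟨j, by omega, h2⟩
    · push Not at h
      exact ⟨J, by omega, h, by rw [pow_succ] at hJ; linarith⟩

theorem core : ∃ C : ℝ, 0 < C ∧ ∀ (z : ℝ) (R A X N : ℕ), Par z R A X N →
    ∫ α in (0:ℝ)..1, ‖Gf R X α‖ ^ 2 * ‖Ff R A α‖ ^ 4 ≤ C * (A:ℝ) ^ 4 := by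
  obtain ⟨C, hC0, hC⟩ := sing_sum
  refine ⟨(1 + 8528 * 17 * 8 * C) + 1 + 1, by positivity, fun z R A X N P => ?_⟩
  have hz := P.hz
  have hz1 := P.z1
  have hz0 := P.z0
  have hA1 := P.A1
  have hA0 : (0:ℝ) < A := by linarith
  have hN0 : (0:ℝ) < N := by exact_mod_cast P.N0
  set T := (A:ℝ) ^ 2 / z ^ 10 with hT
  have hT0 : 0 < T := by positivity
  set J := Nat.log 2 N + 1 with hJ
  have hl : ∀ j : ℕ, (A:ℝ) ^ 2 ≤ (T * 2 ^ j) * z ^ 10 := by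
    intro j
    have e : (T * 2 ^ j) * z ^ 10 = (A:ℝ) ^ 2 * 2 ^ j := by rw [hT]; field_simp
    rw [e]
    exact le_mul_of_one_le_right (by positivity) (one_le_pow₀ (by norm_num))
  have hHnn : ∀ α, 0 ≤ HII z R A N α := by
    intro α
    unfold HII
    have : 0 ≤ ∑ q ∈ Finset.Icc 1 ⌊z ^ 100⌋₊, ∑ a ∈ (range q).filter (fun a => Nat.Coprime a q),
      sig q * ‖EE R q (psi 3 q a)‖ ^ 4 *
      (‖DK (A ^ 2) (α - a / q)‖ ^ 2 * ‖V3 A (α - a / q)‖ ^ 4) :=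
      Finset.sum_nonneg fun q _ => Finset.sum_nonneg fun a _ => by
        have := sig_nonneg q
        positivity
    positivity
  have hMnn : ∀ α, 0 ≤ ∑ j ∈ range J, MT z R A N (T * 2 ^ j) α := fun α =>
    Finset.sum_nonneg fun j _ => P.MT_nonneg (hl j) α
  have hpt : ∀ α, ‖Gf R X α‖ ^ 2 * ‖Ff R A α‖ ^ 4 ≤ HII z R A N α + T * ‖Ff R A α‖ ^ 4 +
      ∑ j ∈ range J, MT z R A N (T * 2 ^ j) α := by
    intro α
    have hH := hHnn α
    have hMs := hMnn α
    have hF0 : 0 ≤ T * ‖Ff R A α‖ ^ 4 := by positivity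
    by_cases hMaj : Maj z N α
    · have := P.maj_pt α hMaj
      linarith
    by_cases hG : ‖Gf R X α‖ ^ 2 ≤ T
    · have : ‖Gf R X α‖ ^ 2 * ‖Ff R A α‖ ^ 4 ≤ T * ‖Ff R A α‖ ^ 4 := by gcongr
      linarith
    push Not at hG
    obtain ⟨j, hj, h1, h2⟩ := dyadic (‖Gf R X α‖ ^ 2 / T) (by rwa [one_lt_div hT0]) J (by
      have hs := P.G_sup α
      have hlt : (N:ℝ) ≤ 2 ^ J := by
        exact_mod_cast (Nat.lt_pow_succ_log_self (by norm_num) N).le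
      refine le_trans ?_ hlt
      rw [div_le_iff₀ hT0]
      refine hs.trans ?_
      rw [mul_comm]
      gcongr
      rw [hT, le_div_iff₀ (by positivity)]
      have : z ^ 15 ≤ (A:ℝ) := P.zA (by norm_num)
      calc 4 * z ^ 4 * z ^ 10 = 4 * z ^ 14 := by ring
        _ ≤ z * z ^ 14 := by gcongr; linarith
        _ = z ^ 15 := by ring
        _ ≤ A := this
        _ ≤ (A:ℝ) ^ 2 := le_self_pow₀ hA1 (by norm_num))
    rw [lt_div_iff₀ hT0] at h1
    rw [div_le_iff₀ hT0] at h2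
    have h3 := P.MT_pt (hl j) α hMaj (by linarith) (by linarith)
    have h4 := Finset.single_le_sum (f := fun j => MT z R A N (T * 2 ^ j) α)
      (fun j _ => P.MT_nonneg (hl j) α) (Finset.mem_range.2 hj)
    linarith
  have cH : Continuous (HII z R A N) := by unfold HII; fun_prop
  have hintegral : ∫ α in (0:ℝ)..1, ‖Gf R X α‖ ^ 2 * ‖Ff R A α‖ ^ 4 ≤ ∫ α in (0:ℝ)..1,
      (HII z R A N α + T * ‖Ff R A α‖ ^ 4 + ∑ j ∈ range J, MT z R A N (T * 2 ^ j) α) := by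
    apply intervalIntegral.integral_mono (by norm_num)
    · exact Continuous.intervalIntegrable (by fun_prop) _ _
    · exact Continuous.intervalIntegrable (by fun_prop) _ _
    · exact hpt
  refine hintegral.trans ?_
  rw [intervalIntegral.integral_add (Continuous.intervalIntegrable (by fun_prop) _ _)
    (Continuous.intervalIntegrable (by fun_prop) _ _),
    intervalIntegral.integral_add (Continuous.intervalIntegrable (by fun_prop) _ _)
    (Continuous.intervalIntegrable (by fun_prop) _ _), intervalIntegral.integral_const_mul,
    intervalIntegral.integral_finsetSum
    (fun q _ => Continuous.intervalIntegrable (by fun_prop) _ _)]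
  have i1 := P.int_HII C hC
  have i2 : T * ∫ α in (0:ℝ)..1, ‖Ff R A α‖ ^ 4 ≤ (A:ℝ) ^ 4 := by
    have := P.four (Finset.Ico A (2 * A)) subset_rfl (fun n => (nu R n : ℂ)) (z ^ 2) (by positivity)
      (fun n _ => P.nu_norm n)
    change ∫ α in (0:ℝ)..1, ‖Ff R A α‖ ^ 4 ≤ _ at this
    calc _ ≤ T * (2 * z * (z ^ 2) ^ 4 * (A:ℝ) ^ 2) := by gcongr
      _ = 2 * ((A:ℝ) ^ 4 / z) := by rw [hT]; field_simp
      _ ≤ z * ((A:ℝ) ^ 4 / z) := by gcongr; linarith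
      _ = _ := by field_simp
  have i3 : ∑ j ∈ range J, ∫ α in (0:ℝ)..1, MT z R A N (T * 2 ^ j) α ≤ (A:ℝ) ^ 4 := by
    calc _ ≤ ∑ j ∈ range J, (A:ℝ) ^ 4 / z ^ 17 := Finset.sum_le_sum fun j _ => P.int_MT (hl j)
      _ = (J:ℝ) * ((A:ℝ) ^ 4 / z ^ 17) := by simp
      _ ≤ z * ((A:ℝ) ^ 4 / z ^ 17) := by gcongr; exact P.hJ
      _ = (A:ℝ) ^ 4 / z ^ 16 := by field_simp
      _ ≤ _ := div_le_self (by positivity) (one_le_pow₀ hz1)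
  linarith
end

lemma U_cube (N : ℕ) : Uconst N ^ 3 = (N:ℝ) / (16 * (1 + 1e-4)) := by
  unfold Uconst
  rw [← Real.rpow_natCast, ← Real.rpow_mul (by positivity)]
  norm_num

lemma U_nonneg (N : ℕ) : 0 ≤ Uconst N := by unfold Uconst; positivity

/-- choice of parameters -/
lemma params : ∃ N₀ : ℕ, ∀ N : ℕ, N₀ ≤ N → ∃ z : ℝ,
    Par z ⌊z⌋₊ (⌊Uconst N⌋₊ + 1) (Nat.sqrt N + 1) N ∧ z ^ 3100 = N := by
  obtain ⟨C, hC1, hC⟩ := divisor_bound (1 / 12400) (by norm_num)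
  have ht : Filter.Tendsto (fun N : ℕ => (N:ℝ) ^ ((1:ℝ) / 6200)) Filter.atTop Filter.atTop :=
    (tendsto_rpow_atTop (by norm_num)).comp tendsto_natCast_atTop_atTop
  obtain ⟨N₀, hN₀⟩ := Filter.eventually_atTop.1
    (ht.eventually_ge_atTop (max C (10 ^ 5)))
  refine ⟨max N₀ 1, fun N hN => ?_⟩
  have hy := hN₀ N (le_trans (le_max_left _ _) hN)
  have hN1 : 1 ≤ N := le_trans (le_max_right _ _) hN
  have hN1R : (1:ℝ) ≤ N := by exact_mod_cast hN1
  set y := (N:ℝ) ^ ((1:ℝ) / 6200) with hyd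
  have hyC : C ≤ y := (le_max_left _ _).trans hy
  have hy5 : (10:ℝ) ^ 5 ≤ y := (le_max_right _ _).trans hy
  have hy0 : 0 < y := lt_of_lt_of_le (by norm_num) hy5
  have hy1 : 1 ≤ y := le_trans (by norm_num) hy5
  have hyN : (y ^ 2) ^ 3100 = N := by
    rw [← pow_mul, hyd, ← Real.rpow_natCast, ← Real.rpow_mul (by positivity)]
    norm_num
  have hz9 : (10:ℝ) ^ 9 ≤ y ^ 2 := by
    calc (10:ℝ) ^ 9 ≤ (10 ^ 5) ^ 2 := by norm_num
      _ ≤ y ^ 2 := by gcongr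
  have hz1 : (1:ℝ) ≤ y ^ 2 := le_trans (by norm_num) hz9
  have hlogN : Real.log N ≤ 6200 * y := by
    have := Real.log_le_rpow_div (x := (N:ℝ)) (by positivity) (ε := 1 / 6200) (by norm_num)
    refine this.trans (le_of_eq ?_)
    rw [← hyd]; ring
  have hU3 := U_cube N
  have hU0 := U_nonneg N
  set U := Uconst N with hUd
  have hzU : (y ^ 2) ^ 1000 ≤ U := by
    apply le_of_pow_le_pow_left₀ (n := 3) (by norm_num) hU0
    rw [hU3, le_div_iff₀ (by norm_num), ← hyN, ← pow_mul]
    calc (y ^ 2) ^ (1000 * 3) * (16 * (1 + 1e-4)) ≤ (y ^ 2) ^ (1000 * 3) * (y ^ 2) ^ 100 := by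
          gcongr
          refine le_trans ?_ (le_self_pow₀ hz1 (by norm_num))
          refine le_trans ?_ hz9
          norm_num
      _ = _ := by rw [← pow_add]
  have hU1 : 1 ≤ U := le_trans (one_le_pow₀ hz1) hzU
  have hfl := Nat.lt_floor_add_one U
  have hfl2 : (⌊U⌋₊ : ℝ) ≤ U := Nat.floor_le hU0
  refine ⟨y ^ 2, ⟨hz9, ?_, ?_, ?_, ?_, ?_, ?_, ?_, ?_, ?_, ?_⟩, hyN⟩
  · rw [Nat.one_le_floor_iff]; exact hz1
  · exact Nat.floor_le (by positivity)
  · push_cast; linarith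
  · have : (((⌊U⌋₊ + 1) ^ 3 : ℕ) : ℝ) ≤ N := by
      push_cast
      calc ((⌊U⌋₊ : ℝ) + 1) ^ 3 ≤ (2 * U) ^ 3 := by gcongr; linarith
        _ = 8 * U ^ 3 := by ring
        _ ≤ N := by rw [hU3]; rw [← mul_div_assoc, div_le_iff₀ (by norm_num)]; nlinarith
    exact_mod_cast this
  · have : (N:ℝ) ≤ ((17 * (⌊U⌋₊ + 1) ^ 3 : ℕ) : ℝ) := by
      push_cast
      have h1 : U ^ 3 ≤ ((⌊U⌋₊ : ℝ) + 1) ^ 3 := by gcongr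
      have h2 : (N:ℝ) = 16 * (1 + 1e-4) * U ^ 3 := by rw [hU3]; field_simp
      rw [h2]
      calc 16 * (1 + 1e-4) * U ^ 3 ≤ 17 * U ^ 3 := by gcongr; norm_num
        _ ≤ _ := by gcongr
    exact_mod_cast this
  · have := Nat.lt_succ_sqrt N
    rw [sq]; exact this.le
  · have h1 := Nat.sqrt_le N
    have h2 : 1 ≤ Nat.sqrt N := by rw [Nat.le_sqrt]; omega
    nlinarith
  · intro u hu huN
    have h1 := dv_le_of_le (ε := 1 / 12400) (by norm_num) hC1 hC u ((N:ℝ) ^ 2) (by exact_mod_cast huN)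
    have h2 : ((N:ℝ) ^ 2) ^ ((1:ℝ) / 12400) = y := by
      rw [hyd, ← Real.rpow_natCast, ← Real.rpow_mul (by positivity)]
      norm_num
    rw [h2] at h1
    refine h1.trans ?_
    rw [sq]; gcongr
  · nlinarith
  · have h1 : 2 ^ Nat.log 2 N ≤ N := Nat.pow_log_le_self 2 (by omega)
    have h2 : ((2:ℝ) ^ Nat.log 2 N) ≤ N := by exact_mod_cast h1
    have h3 := Real.log_le_log (by positivity) h2
    rw [Real.log_pow] at h3
    have h4 := Real.log_two_gt_d9
    have h5 : (Nat.log 2 N : ℝ) * (1 / 2) ≤ Nat.log 2 N * Real.log 2 := by gcongr; linarith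
    push_cast
    nlinarith

section
variable {z : ℝ} {R A X N : ℕ}

lemma Gf_TP (R X : ℕ) (α : ℝ) :
    Gf R X α = TP (range X) (fun n => (nu R n : ℂ)) (fun n => (n:ℤ) ^ 2) α := by
  unfold Gf TP
  refine Finset.sum_congr rfl fun l _ => ?_
  push_cast; rfl

/-- comparison of the prime sums with the sieve-weighted sums -/
lemma compare (R X A : ℕ) (c : ℝ) (hc : 0 ≤ c) (P : Finset ℕ) (hP : P ⊆ range X) (s : Finset ℕ)
    (hs : s ⊆ Finset.Ico A (2 * A)) (hPw : ∀ p ∈ P, ‖(Real.log p : ℂ)‖ ≤ c * nu R p)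
    (hsw : ∀ p ∈ s, ‖(Real.log p : ℂ)‖ ≤ c * nu R p) :
    ∫ α in (0:ℝ)..1, ‖∑ p ∈ P, (Real.log p : ℂ) * eu ((p:ℝ) ^ 2 * α)‖ ^ 2 *
      ‖CS s (fun p => (Real.log p : ℂ)) α‖ ^ 4 ≤
    c ^ 6 * ∫ α in (0:ℝ)..1, ‖Gf R X α‖ ^ 2 * ‖Ff R A α‖ ^ 4 := by
  set w1 : ℕ → ℂ := fun p => if p ∈ P then (Real.log p : ℂ) else 0 with hw1
  set w2 : ℕ → ℂ := fun p => if p ∈ s then (Real.log p : ℂ) else 0 with hw2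
  set I := Finset.Ico A (2 * A) with hI
  have b1 : ∀ p, ‖w1 p‖ ≤ c * nu R p := by
    intro p
    by_cases h : p ∈ P
    · simp only [hw1, h, if_true]; exact hPw p h
    · simp only [hw1, h, if_false, norm_zero]; exact mul_nonneg hc (nu_nonneg _ _)
  have b2 : ∀ p, ‖w2 p‖ ≤ c * nu R p := by
    intro p
    by_cases h : p ∈ s
    · simp only [hw2, h, if_true]; exact hsw p h
    · simp only [hw2, h, if_false, norm_zero]; exact mul_nonneg hc (nu_nonneg _ _)
  have e1 : ∀ α, ∑ p ∈ P, (Real.log p : ℂ) * eu ((p:ℝ) ^ 2 * α) =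
      TP (range X) w1 (fun n => (n:ℤ) ^ 2) α := by
    intro α
    unfold TP
    simp only [hw1, ite_mul, zero_mul]
    rw [← Finset.sum_filter, Finset.filter_mem_eq_inter, Finset.inter_eq_right.2 hP]
    refine Finset.sum_congr rfl fun l _ => ?_
    push_cast; rfl
  have e2 : ∀ α, CS s (fun p => (Real.log p : ℂ)) α = TP I w2 (fun n => (n:ℤ) ^ 3) α := by
    intro α
    unfold CS TP
    simp only [hw2, ite_mul, zero_mul]
    rw [← Finset.sum_filter, Finset.filter_mem_eq_inter, Finset.inter_eq_right.2 hs]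
    refine Finset.sum_congr rfl fun l _ => ?_
    push_cast; rfl
  have e3 : ∀ (u v : ℂ), ‖u‖ ^ 2 * ‖v‖ ^ 4 = ‖u * (v * v)‖ ^ 2 := by
    intro u v; rw [norm_mul, norm_mul]; ring
  have hL : ∀ α, ‖∑ p ∈ P, (Real.log p : ℂ) * eu ((p:ℝ) ^ 2 * α)‖ ^ 2 *
      ‖CS s (fun p => (Real.log p : ℂ)) α‖ ^ 4 = ‖TP (range X ×ˢ (I ×ˢ I))
        (fun j => w1 j.1 * (w2 j.2.1 * w2 j.2.2))
        (fun j => (j.1:ℤ) ^ 2 + ((j.2.1:ℤ) ^ 3 + (j.2.2:ℤ) ^ 3)) α‖ ^ 2 := by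
    intro α
    rw [e1, e2, e3, TP_mul, TP_mul]
  have hRt : ∀ α, c ^ 6 * (‖Gf R X α‖ ^ 2 * ‖Ff R A α‖ ^ 4) = ‖TP (range X ×ˢ (I ×ˢ I))
        (fun j => ((c * nu R j.1 * ((c * nu R j.2.1) * (c * nu R j.2.2)) : ℝ) : ℂ))
        (fun j => (j.1:ℤ) ^ 2 + ((j.2.1:ℤ) ^ 3 + (j.2.2:ℤ) ^ 3)) α‖ ^ 2 := by
    intro α
    rw [e3, Gf_TP, Ff, CS_TP, TP_mul, TP_mul]
    have : c ^ 6 = ‖(c:ℂ) ^ 3‖ ^ 2 := by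
      rw [norm_pow, Complex.norm_real, Real.norm_of_nonneg hc]; ring
    rw [this, ← mul_pow, ← norm_mul]
    congr 2
    unfold TP
    rw [Finset.mul_sum]
    refine Finset.sum_congr rfl fun l _ => ?_
    push_cast; ring
  rw [← intervalIntegral.integral_const_mul]
  simp_rw [hL, hRt]
  apply parseval_mono
  intro j _
  rw [norm_mul, norm_mul]
  have n1 := nu_nonneg R j.1
  have n2 := nu_nonneg R j.2.1
  have n3 := nu_nonneg R j.2.2
  exact mul_le_mul (b1 _) (mul_le_mul (b2 _) (b2 _) (norm_nonneg _) (by positivity))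
    (by positivity) (by positivity)
end

lemma final_bound (C : ℝ) (hC : 0 < C) (hcore : ∀ (z : ℝ) (R A X N : ℕ), Par z R A X N →
    ∫ α in (0:ℝ)..1, ‖Gf R X α‖ ^ 2 * ‖Ff R A α‖ ^ 4 ≤ C * (A:ℝ) ^ 4)
    (N : ℕ) (z : ℝ) (P : Par z ⌊z⌋₊ (⌊Uconst N⌋₊ + 1) (Nat.sqrt N + 1) N) (hzN : z ^ 3100 = N) :
    ∫ α in (0 : ℝ)..1, ‖gsum N α‖ ^ 2 * ‖cubeSum (Uconst N) α‖ ^ 4 ≤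
        (2 * 6200 ^ 6 * C + 2) * (N : ℝ) ^ ((4 : ℝ) / 3) := by
  have hz := P.hz
  have hz1 := P.z1
  have hz0 := P.z0
  have hN0 : (0:ℝ) < N := by exact_mod_cast P.N0
  set R := ⌊z⌋₊ with hR
  set A := ⌊Uconst N⌋₊ + 1 with hA
  have hU0 := U_nonneg N
  have hA1 := P.A1
  set s := (Finset.range (⌊2 * Uconst N⌋₊ + 1)).filter
      (fun p : ℕ => p.Prime ∧ Uconst N < (p : ℝ) ∧ (p : ℝ) ≤ 2 * Uconst N) with hs
  set T := (Finset.range (N + 1)).filter (fun p : ℕ => p.Prime ∧ (p : ℝ) ≤ Real.sqrt N) with hT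
  have hsA : s ⊆ Finset.Ico A (2 * A) := by
    intro p hp
    obtain ⟨_, _, h1, h2⟩ := Finset.mem_filter.1 hp
    have h3 := Nat.lt_floor_add_one (Uconst N)
    rw [Finset.mem_Ico]
    constructor
    · exact (Nat.floor_lt hU0).2 h1
    · have : (p:ℝ) < ((2 * A : ℕ) : ℝ) := by rw [hA]; push_cast; linarith
      exact_mod_cast this
  have hsN : ∀ p ∈ s, p ≤ N := by
    intro p hp
    have h1 := Finset.mem_Ico.1 (hsA hp)
    have h2 := P.hAN
    have h3 := P.A10
    have : 2 * A ≤ A ^ 3 := by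
      calc 2 * A ≤ A ^ 2 * A := Nat.mul_le_mul_right _ ((show 2 ≤ A by omega).trans (Nat.le_self_pow (by norm_num) _))
        _ = A ^ 3 := by ring
    omega
  have hlog : ∀ p : ℕ, 1 ≤ p → p ≤ N → ‖(Real.log p : ℂ)‖ ≤ Real.log N := by
    intro p h1 h2
    rw [Complex.norm_real, Real.norm_of_nonneg (Real.log_natCast_nonneg p)]
    have : (0:ℝ) < p := by exact_mod_cast h1
    gcongr
  have hlogz : Real.log N ≤ z := by linarith [P.hlog]
  have hVV : Real.log N ≤ 6200 * VV R := by
    have h1 : Real.log z ≤ Real.log (R + 1) := by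
      gcongr
      exact (Nat.lt_floor_add_one z).le
    have h2 := log_le_VV (R := R)
    rw [← hzN, Real.log_pow]
    push_cast
    linarith
  have hprime : ∀ p : ℕ, p.Prime → R < p → p ≤ N → ‖(Real.log p : ℂ)‖ ≤ 6200 * nu R p := by
    intro p hp h1 h2
    rw [nu_prime P.hR1 hp h1]
    exact (hlog p hp.one_lt.le h2).trans hVV
  have hRA : R < A := by
    have h1 := P.hR
    have h2 : z ^ 2 ≤ (A:ℝ) := P.zA (by norm_num)
    have : (R:ℝ) < A := by nlinarith
    exact_mod_cast this
  set T1 := T.filter (fun p => R < p) with hT1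
  set T2 := T.filter (fun p => ¬ R < p) with hT2
  set g1 : ℝ → ℂ := fun α => ∑ p ∈ T1, (Real.log p : ℂ) * eu ((p : ℝ) ^ 2 * α) with hg1
  set g2 : ℝ → ℂ := fun α => ∑ p ∈ T2, (Real.log p : ℂ) * eu ((p : ℝ) ^ 2 * α) with hg2
  have hg : ∀ α, gsum N α = g1 α + g2 α := fun α =>
    (Finset.sum_filter_add_sum_filter_not T (fun p => R < p) _).symm
  have hS : ∀ α, cubeSum (Uconst N) α = CS s (fun p => (Real.log p : ℂ)) α := fun α => rfl
  have hg2b : ∀ α, ‖g2 α‖ ^ 2 ≤ 4 * z ^ 4 := by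
    intro α
    have h1 : ‖g2 α‖ ≤ 2 * z * z := by
      refine (norm_sum_le _ _).trans ?_
      calc _ ≤ ∑ p ∈ T2, z := Finset.sum_le_sum fun p hp => by
            rw [norm_mul, norm_eu, mul_one]
            have h1 := Finset.mem_filter.1 (Finset.mem_filter.1 hp).1
            have h2 := Finset.mem_range.1 h1.1
            exact (hlog p h1.2.1.one_lt.le (by omega)).trans hlogz
        _ = (T2.card : ℝ) * z := by simp
        _ ≤ 2 * z * z := by
            gcongr
            have h1 : T2.card ≤ R + 1 := by
              have : T2 ⊆ range (R + 1) := by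
                intro p hp
                have := (Finset.mem_filter.1 hp).2
                rw [Finset.mem_range]; omega
              simpa using Finset.card_le_card this
            have h2 : (T2.card : ℝ) ≤ R + 1 := by exact_mod_cast h1
            have h3 := P.hR
            linarith
    calc _ ≤ (2 * z * z) ^ 2 := by gcongr
      _ = _ := by ring
  have i1 : ∫ α in (0:ℝ)..1, ‖g1 α‖ ^ 2 * ‖CS s (fun p => (Real.log p : ℂ)) α‖ ^ 4 ≤
      6200 ^ 6 * (C * (A:ℝ) ^ 4) := by
    refine (compare R (Nat.sqrt N + 1) A 6200 (by norm_num) T1 ?_ s hsA ?_ ?_).trans ?_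
    · intro p hp
      have h1 := (Finset.mem_filter.1 (Finset.mem_filter.1 hp).1).2.2
      rw [Finset.mem_range, Nat.lt_succ_iff, Nat.le_sqrt']
      have h2 := (Real.le_sqrt' (by exact_mod_cast (Finset.mem_filter.1 (Finset.mem_filter.1 hp).1).2.1.pos)).1 h1
      exact_mod_cast h2
    · intro p hp
      have h0 := Finset.mem_filter.1 hp
      have h1 := Finset.mem_filter.1 h0.1
      have h2 := Finset.mem_range.1 h1.1
      exact hprime p h1.2.1 h0.2 (by omega)
    · intro p hp
      have h1 := Finset.mem_Ico.1 (hsA hp)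
      exact hprime p (Finset.mem_filter.1 hp).2.1 (by omega) (hsN p hp)
    · gcongr
      exact hcore _ _ _ _ _ P
  have i2 : ∫ α in (0:ℝ)..1, ‖CS s (fun p => (Real.log p : ℂ)) α‖ ^ 4 ≤ 2 * z * z ^ 4 * (A:ℝ) ^ 2 :=
    P.four s hsA _ z hz0.le fun p hp =>
      (hlog p (Finset.mem_filter.1 hp).2.1.one_lt.le (hsN p hp)).trans hlogz
  have cg1 : Continuous g1 := by rw [hg1]; fun_prop
  have hmain : ∫ α in (0 : ℝ)..1, ‖gsum N α‖ ^ 2 * ‖cubeSum (Uconst N) α‖ ^ 4 ≤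
      ∫ α in (0:ℝ)..1, (2 * (‖g1 α‖ ^ 2 * ‖CS s (fun p => (Real.log p : ℂ)) α‖ ^ 4) +
        8 * z ^ 4 * ‖CS s (fun p => (Real.log p : ℂ)) α‖ ^ 4) := by
    have cg2 : Continuous g2 := by rw [hg2]; fun_prop
    simp_rw [hg, hS]
    apply intervalIntegral.integral_mono (by norm_num)
    · exact Continuous.intervalIntegrable (by fun_prop) _ _
    · exact Continuous.intervalIntegrable (by fun_prop) _ _
    · intro α
      have h1 : ‖g1 α + g2 α‖ ^ 2 ≤ 2 * ‖g1 α‖ ^ 2 + 8 * z ^ 4 := by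
        have := hg2b α
        calc _ ≤ (‖g1 α‖ + ‖g2 α‖) ^ 2 := by gcongr; exact norm_add_le _ _
          _ ≤ _ := by nlinarith [sq_nonneg (‖g1 α‖ - ‖g2 α‖)]
      dsimp only
      calc _ ≤ (2 * ‖g1 α‖ ^ 2 + 8 * z ^ 4) * ‖CS s (fun p => (Real.log p : ℂ)) α‖ ^ 4 := by
            gcongr
        _ = _ := by ring
  rw [intervalIntegral.integral_add (Continuous.intervalIntegrable (by fun_prop) _ _)
    (Continuous.intervalIntegrable (by fun_prop) _ _), intervalIntegral.integral_const_mul,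
    intervalIntegral.integral_const_mul] at hmain
  have i3 : 8 * z ^ 4 * ∫ α in (0:ℝ)..1, ‖CS s (fun p => (Real.log p : ℂ)) α‖ ^ 4 ≤ 2 * (A:ℝ) ^ 4 := by
    have h1 : z ^ 10 ≤ (A:ℝ) := P.zA (by norm_num)
    have h2 : z ^ 10 ≤ (A:ℝ) ^ 2 := h1.trans (le_self_pow₀ hA1 (by norm_num))
    calc _ ≤ 8 * z ^ 4 * (2 * z * z ^ 4 * (A:ℝ) ^ 2) := by gcongr
      _ = 2 * (8 * z ^ 9 * (A:ℝ) ^ 2) := by ring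
      _ ≤ 2 * (z * z ^ 9 * (A:ℝ) ^ 2) := by gcongr; linarith
      _ = 2 * (z ^ 10 * (A:ℝ) ^ 2) := by ring
      _ ≤ 2 * ((A:ℝ) ^ 2 * (A:ℝ) ^ 2) := by gcongr
      _ = _ := by ring
  have hA4 : (A:ℝ) ^ 4 ≤ (N:ℝ) ^ ((4:ℝ) / 3) := by
    have h1 := P.AN
    have h2 : (A:ℝ) ^ 4 = ((A:ℝ) ^ 3) ^ ((4:ℝ) / 3) := by
      rw [← Real.rpow_natCast (A:ℝ) 3, ← Real.rpow_mul (by positivity), ← Real.rpow_natCast]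
      norm_num
    rw [h2]
    gcongr
  calc _ ≤ (2 * 6200 ^ 6 * C + 2) * (A:ℝ) ^ 4 := by linarith
    _ ≤ _ := by gcongr



/-- `∫₀¹ |g(α)|² |S(α)|⁴ dα ≪ N^{4/3}`. -/
theorem g_sq_S_four_integral :
    ∃ C > (0 : ℝ), ∃ N₀ : ℕ, ∀ N : ℕ, N₀ ≤ N →
      ∫ α in (0 : ℝ)..1, ‖gsum N α‖ ^ 2 * ‖cubeSum (Uconst N) α‖ ^ 4 ≤
        C * (N : ℝ) ^ ((4 : ℝ) / 3) := by
  obtain ⟨C, hC, hcore⟩ := core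
  obtain ⟨N₀, hN₀⟩ := params
  refine ⟨2 * 6200 ^ 6 * C + 2, by positivity, N₀, fun N hN => ?_⟩
  obtain ⟨z, P, hzN⟩ := hN₀ N hN
  exact final_bound C hC hcore N z P hzN
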